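/- There exists Q₀ such that for every integer q ≥ Q₀ and every integer a with gcd(a,q) = 1, there is a prime p with p ≡ a (mod q) and p ≤ q^75744000. -/

import Mathlib

namespace Linnik

open Complex Metric Set

lemma norm_le_of_sphere {g : ℂ → ℂ} (hg : Differentiable ℂ g) {c s : ℂ} {R C : ℝ} (hR : 0 < R)
    (h : ∀ z ∈ sphere c R, ‖g z‖ ≤ C) (hs : s ∈ closedBall c R) : ‖g s‖ ≤ C := by
  refine Complex.norm_le_of_forall_mem_frontier_norm_le (U := ball c R) isBounded_ball
    hg.diffContOnCl ?_ ?_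
  · rwa [frontier_ball c hR.ne']
  · rwa [closure_ball c (ne_of_gt hR)]

/-- The cofactor left after dividing out zeros in a disc is bounded on the disc of triple radius. -/
lemma cofactor_bound {f g : ℂ → ℂ} (hg : Differentiable ℂ g) {c : ℂ} {R K : ℝ}
    (hR : 0 < R) (hK : 0 ≤ K) (hfK : ∀ s ∈ closedBall c (3 * R), ‖f s‖ ≤ K * ‖f c‖) {n : ℕ} {ρ : Fin n → ℂ}
    (hρ : ∀ i, ρ i ∈ closedBall c R) (hfg : ∀ s, f s = (∏ i, (s - ρ i)) * g s)
    {s : ℂ} (hs : s ∈ closedBall c (3 * R)) : ‖g s‖ ≤ K * ‖g c‖ * (1 / 2) ^ n := by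
  refine norm_le_of_sphere hg (by positivity) (fun z hz ↦ ?_) hs
  have h1 : (2 * R) ^ n ≤ ∏ i, ‖z - ρ i‖ := by
    rw [show (2 * R) ^ n = ∏ _i : Fin n, (2 * R) by simp]
    refine Finset.prod_le_prod (fun _ _ ↦ by positivity) fun i _ ↦ ?_
    have h2 := hρ i
    rw [mem_closedBall, dist_eq_norm] at h2
    rw [mem_sphere, dist_eq_norm] at hz
    have h3 : ‖z - c‖ ≤ ‖z - ρ i‖ + ‖ρ i - c‖ := norm_sub_le_norm_sub_add_norm_sub z (ρ i) c
    linarith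
  have h4 : ∏ i, ‖c - ρ i‖ ≤ R ^ n := by
    rw [show R ^ n = ∏ _i : Fin n, R by simp]
    refine Finset.prod_le_prod (fun _ _ ↦ by positivity) fun i _ ↦ ?_
    have h2 := hρ i
    rwa [mem_closedBall', dist_eq_norm] at h2
  have h5 := hfK z (sphere_subset_closedBall hz)
  rw [hfg z, hfg c, norm_mul, norm_mul, norm_prod, norm_prod] at h5
  have key : (2 * R) ^ n * ‖g z‖ ≤ R ^ n * (K * ‖g c‖) :=
    calc (2 * R) ^ n * ‖g z‖ ≤ (∏ i, ‖z - ρ i‖) * ‖g z‖ := by gcongr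
      _ ≤ K * ((∏ i, ‖c - ρ i‖) * ‖g c‖) := h5
      _ = (∏ i, ‖c - ρ i‖) * (K * ‖g c‖) := by ring
      _ ≤ R ^ n * (K * ‖g c‖) := by gcongr
  rw [mul_pow] at key
  have hRn : 0 < R ^ n := by positivity
  have h8 : 2 ^ n * ‖g z‖ ≤ K * ‖g c‖ := by
    refine le_of_mul_le_mul_left ?_ hRn
    linarith
  rw [one_div, inv_pow, ← div_eq_mul_inv, le_div_iff₀ (by positivity)]
  linarith

/-- Dividing out all the zeros of an entire function in a disc. -/
lemma exists_zero_factorization {f : ℂ → ℂ} (hf : Differentiable ℂ f) {c : ℂ} {R K : ℝ}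
    (hR : 0 < R) (hK : 0 ≤ K) (hfc : f c ≠ 0)
    (hfK : ∀ s ∈ closedBall c (3 * R), ‖f s‖ ≤ K * ‖f c‖) :
    ∃ (n : ℕ) (ρ : Fin n → ℂ) (g : ℂ → ℂ), Differentiable ℂ g ∧ (∀ i, ρ i ∈ closedBall c R) ∧
      (∀ s, f s = (∏ i, (s - ρ i)) * g s) ∧ ∀ s ∈ closedBall c R, g s ≠ 0 := by
  by_contra! hcon
  have hall (n : ℕ) : ∃ (ρ : Fin n → ℂ) (g : ℂ → ℂ), Differentiable ℂ g ∧
      (∀ i, ρ i ∈ closedBall c R) ∧ (∀ s, f s = (∏ i, (s - ρ i)) * g s) := by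
    induction n with
    | zero => exact ⟨fun i ↦ i.elim0, f, hf, fun i ↦ i.elim0, by simp⟩
    | succ n ih =>
      obtain ⟨ρ, g, hg, hρ, hfg⟩ := ih
      obtain ⟨s, hs, hgs⟩ := hcon n ρ g hg hρ hfg
      refine ⟨Fin.cons s ρ, dslope g s, ?_, ?_, fun z ↦ ?_⟩
      · have := (Complex.differentiableOn_dslope (f := g) (c := s) (s := univ) (by simp)).2
          hg.differentiableOn
        exact differentiableOn_univ.1 this
      · refine Fin.cases (by simpa using hs) (by simpa using hρ)
      · have h1 := sub_smul_dslope g s z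
        rw [hgs, sub_zero, smul_eq_mul] at h1
        rw [Fin.prod_univ_succ, hfg z, ← h1]
        simp only [Fin.cons_zero, Fin.cons_succ]
        ring
  obtain ⟨n, hn⟩ := pow_unbounded_of_one_lt K (by norm_num : (1 : ℝ) < 2)
  obtain ⟨ρ, g, hg, hρ, hfg⟩ := hall n
  have h1 := cofactor_bound hg hR hK hfK hρ hfg (s := c) (by simp [hR.le])
  have hgc : 0 < ‖g c‖ := by
    refine norm_pos_iff.2 fun h ↦ hfc ?_
    rw [hfg, h, mul_zero]
  rw [one_div, inv_pow, ← div_eq_mul_inv, le_div_iff₀ (by positivity)] at h1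
  nlinarith

/-- Taylor coefficients of the logarithmic derivative of a zero-free bounded function. -/
lemma norm_iteratedDeriv_logDeriv_le {g : ℂ → ℂ} (hg : Differentiable ℂ g) {c : ℂ}
    {R M r t : ℝ} (hM : 0 < M) (ht : 0 < t) (hrt : r + t < R) (hr : 0 ≤ r)
    (h0 : ∀ s ∈ closedBall c R, g s ≠ 0)
    (hgM : ∀ s ∈ ball c R, ‖g s‖ ≤ Real.exp M * ‖g c‖) {s : ℂ} (hs : s ∈ closedBall c r) (j : ℕ) :
    ‖iteratedDeriv j (logDeriv g) s‖ ≤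
      (j + 1).factorial * (2 * M * (r + t) / (R - (r + t))) / t ^ (j + 1) := by
  have hd : DifferentiableOn ℂ (logDeriv g) (ball c R) := by
    refine DifferentiableOn.div ?_ hg.differentiableOn fun z hz ↦ h0 z (ball_subset_closedBall hz)
    exact (hg.contDiff (n := 2)).differentiable_deriv_two.differentiableOn
  obtain ⟨H, hHc, hH⟩ := hd.isExactOn_ball.with_val_at c 0
  have hR : 0 < R := by linarith
  have hcR : c ∈ ball c R := mem_ball_self hR
  have hexp : ∀ z ∈ ball c R, g z * exp (-H z) = g c := by
    intro z hz
    have hder : ∀ w ∈ ball c R, HasDerivAt (fun w ↦ g w * exp (-H w)) 0 w := by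
      intro w hw
      have h1 := (hg w).hasDerivAt.mul ((hH w hw).neg.cexp)
      refine h1.congr_deriv ?_
      have := h0 w (ball_subset_closedBall hw)
      rw [logDeriv_apply]
      field_simp
      ring
    have := (convex_ball c R).is_const_of_fderivWithin_eq_zero (𝕜 := ℂ)
      (f := fun w ↦ g w * exp (-H w))
      (fun w hw ↦ (hder w hw).differentiableAt.differentiableWithinAt)
      (fun w hw ↦ by
        rw [fderivWithin_of_isOpen isOpen_ball hw]
        ext
        simpa using (hder w hw).deriv) hz hcR
    simpa [hHc] using this
  have hre : ∀ z ∈ ball c R, (H z).re ≤ M := by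
    intro z hz
    have h1 := congrArg norm (hexp z hz)
    rw [norm_mul, norm_exp, neg_re] at h1
    have h2 := hgM z hz
    have hgz : 0 < ‖g z‖ := norm_pos_iff.2 (h0 z (ball_subset_closedBall hz))
    rw [← h1] at h2
    have h3 : 1 ≤ Real.exp M * Real.exp (-(H z).re) := by
      by_contra! h
      nlinarith
    rw [← Real.exp_add, Real.one_le_exp_iff] at h3
    linarith
  have hbc : ∀ z ∈ closedBall c (r + t), ‖H z‖ ≤ 2 * M * (r + t) / (R - (r + t)) := by
    intro z hz
    have hz' : ‖z - c‖ ≤ r + t := by rwa [← dist_eq_norm]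
    have hHd : DifferentiableOn ℂ (fun w ↦ H (w + c)) (ball 0 R) := by
      intro w hw
      have : w + c ∈ ball c R := by simpa using hw
      exact ((hH _ this).comp_add_const w c).differentiableAt.differentiableWithinAt
    have := Complex.borelCaratheodory_zero (f := fun w ↦ H (w + c)) (M := M) (R := R) (z := z - c)
      hM hHd (fun w hw ↦ hre _ (by simpa using hw)) hR (by simp; linarith) (by simpa using hHc)
    simp only [sub_add_cancel] at this
    refine this.trans ?_
    have : 0 < R - (r + t) := by linarith
    gcongr
  have hsb : s ∈ ball c R := by
    rw [mem_closedBall] at hs; rw [mem_ball]; linarith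
  have hsub : closedBall s t ⊆ closedBall c (r + t) := by
    intro z hz
    rw [mem_closedBall] at *
    linarith [dist_triangle z s c]
  have hsub' : closedBall s t ⊆ ball c R := fun z hz ↦ by
    have := hsub hz
    rw [mem_closedBall] at this; rw [mem_ball]; linarith
  have heq : iteratedDeriv j (logDeriv g) s = iteratedDeriv (j + 1) H s := by
    rw [iteratedDeriv_succ']
    refine Filter.EventuallyEq.iteratedDeriv_eq j ?_
    filter_upwards [isOpen_ball.mem_nhds hsb] with w hw
    exact (hH w hw).deriv.symm
  rw [heq]
  refine Complex.norm_iteratedDeriv_le_of_forall_mem_sphere_norm_le (j + 1) ht ?_ ?_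
  · refine DifferentiableOn.diffContOnCl fun z hz ↦ ?_
    rw [closure_ball s ht.ne'] at hz
    exact (hH z (hsub' hz)).differentiableAt.differentiableWithinAt
  · exact fun z hz ↦ hbc z (hsub (sphere_subset_closedBall hz))

end Linnik

namespace Linnik

open Complex Metric Set

lemma iteratedDeriv_inv_sub (j : ℕ) (ρ s : ℂ) :
    iteratedDeriv j (fun z ↦ (z - ρ)⁻¹) s = (-1) ^ j * j.factorial * ((s - ρ) ^ (j + 1))⁻¹ := by
  have h := congrFun (iter_deriv_inv_linear_sub j (1 : ℂ) ρ) s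
  rw [iteratedDeriv_eq_iterate]
  simp only [one_mul, one_pow, mul_one] at h
  rw [h, ← zpow_natCast (s - ρ), ← zpow_neg]
  congr 2
  push_cast
  ring

/-- Local partial fraction expansion of the logarithmic derivative. -/
lemma local_zero_expansion {f : ℂ → ℂ} (hf : Differentiable ℂ f) {c : ℂ}
    {R M r t : ℝ} (hM : 0 < M) (ht : 0 < t) (hrt : r + t < R) (hr : 0 ≤ r) (hfc : f c ≠ 0)
    (hfK : ∀ s ∈ closedBall c (3 * R), ‖f s‖ ≤ Real.exp M * ‖f c‖) :
    ∃ (n : ℕ) (ρ : Fin n → ℂ), (∀ i, ρ i ∈ closedBall c R) ∧ (∀ i, f (ρ i) = 0) ∧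
      (∀ s ∈ closedBall c R, f s = 0 → ∃ i, ρ i = s) ∧
      ∀ s ∈ closedBall c r, f s ≠ 0 → ∀ j : ℕ,
        ‖iteratedDeriv j (logDeriv f) s - (-1) ^ j * j.factorial * ∑ i, ((s - ρ i) ^ (j + 1))⁻¹‖ ≤
          (j + 1).factorial * (2 * M * (r + t) / (R - (r + t))) / t ^ (j + 1) := by
  have hR : 0 < R := by linarith
  obtain ⟨n, ρ, g, hg, hρ, hfg, hg0⟩ :=
    exists_zero_factorization hf hR (Real.exp_pos M).le hfc hfK
  refine ⟨n, ρ, hρ, fun i ↦ ?_, fun s hs hfs ↦ ?_, fun s hs hfs j ↦ ?_⟩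
  · rw [hfg, Finset.prod_eq_zero (Finset.mem_univ i) (sub_self _), zero_mul]
  · rw [hfg, mul_eq_zero, or_iff_left (hg0 s hs), Finset.prod_eq_zero_iff] at hfs
    obtain ⟨i, -, hi⟩ := hfs
    exact ⟨i, (sub_eq_zero.1 hi).symm⟩
  have hgb : ∀ s ∈ ball c R, ‖g s‖ ≤ Real.exp M * ‖g c‖ := by
    intro s hs
    refine (cofactor_bound hg hR (Real.exp_pos M).le hfK hρ hfg (s := s) ?_).trans ?_
    · rw [mem_closedBall]; rw [mem_ball] at hs; linarith
    · exact mul_le_of_le_one_right (by positivity) (pow_le_one₀ (by norm_num) (by norm_num))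
  convert norm_iteratedDeriv_logDeriv_le hg hM ht hrt hr hg0 hgb hs j using 2
  have hne (i : Fin n) : s - ρ i ≠ 0 := fun h ↦ hfs (by
    rw [hfg, Finset.prod_eq_zero (Finset.mem_univ i) h, zero_mul])
  have hgs : g s ≠ 0 := fun h ↦ hfs (by rw [hfg, h, mul_zero])
  have hev : logDeriv f =ᶠ[nhds s] fun z ↦ (∑ i, (z - ρ i)⁻¹) + logDeriv g z := by
    filter_upwards [hf.continuous.continuousAt.eventually_ne hfs] with z hz
    have hz1 : ∏ i, (z - ρ i) ≠ 0 := fun h ↦ hz (by rw [hfg, h, zero_mul])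
    have hz2 : g z ≠ 0 := fun h ↦ hz (by rw [hfg, h, mul_zero])
    rw [show f = fun s ↦ (∏ i, (s - ρ i)) * g s from funext hfg,
      logDeriv_mul z hz1 hz2 (by fun_prop) (hg z),
      logDeriv_prod (fun i hi ↦ (Finset.prod_ne_zero_iff.1 hz1) i hi) (fun i _ ↦ by fun_prop)]
    simp [logDeriv_apply]
  rw [hev.iteratedDeriv_eq j]
  have hc1 (i : Fin n) : ContDiffAt ℂ j (fun z ↦ (z - ρ i)⁻¹) s :=
    ContDiffAt.inv (by fun_prop) (hne i)
  have hc2 : ContDiffAt ℂ j (logDeriv g) s :=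
    ContDiffAt.div ((hg.contDiff (n := (j + 1 : ℕ))).iterate_deriv' j 1).contDiffAt
      hg.contDiff.contDiffAt hgs
  rw [iteratedDeriv_fun_add (ContDiffAt.sum fun i _ ↦ hc1 i) hc2,
    iteratedDeriv_fun_sum (fun i _ ↦ hc1 i)]
  simp only [iteratedDeriv_inv_sub]
  rw [← Finset.mul_sum]
  ring

end Linnik

namespace Linnik

open Complex Metric Set

lemma sum_range_zmod {q : ℕ} [NeZero q] {E : Type*} [AddCommMonoid E] (f : ZMod q → E) :
    ∑ k ∈ Finset.range q, f k = ∑ x, f x := by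
  refine Finset.sum_bij (fun k _ ↦ (k : ZMod q)) (by simp) (fun a ha b hb h ↦ ?_)
    (fun x _ ↦ ⟨x.val, by simpa using ZMod.val_lt x, by simp⟩) (by simp)
  rw [Finset.mem_range] at ha hb
  rwa [ZMod.natCast_eq_natCast_iff', Nat.mod_eq_of_lt ha, Nat.mod_eq_of_lt hb] at h

lemma one_le_norm_LSeries_mul {q : ℕ} (χ : DirichletCharacter ℂ q) {σ : ℝ} (hσ : 1 < σ) :
    1 ≤ ‖LSeries (χ ·) σ‖ * ∑' n : ℕ, (n : ℝ) ^ (-σ) := by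
  have h := congrArg norm (DirichletCharacter.LSeries.mul_mu_eq_one χ (s := σ) (by simpa using hσ))
  rw [norm_mul, norm_one] at h
  rw [← h]
  gcongr
  refine tsum_of_norm_bounded (Real.summable_nat_rpow.2 (by linarith)).hasSum fun n ↦ ?_
  rw [LSeries.norm_term_eq]
  split_ifs with hn
  · positivity
  · rw [Real.rpow_neg (by positivity), ← one_div, ofReal_re]
    gcongr
    simp only [Pi.mul_apply, norm_mul]
    refine mul_le_one₀ (χ.norm_le_one _) (norm_nonneg _) ?_
    have := ArithmeticFunction.abs_moebius_le_one (n := n)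
    simp only [Complex.norm_intCast]
    exact_mod_cast this

variable {q : ℕ} [NeZero q]

lemma norm_sum_range_char_le {χ : DirichletCharacter ℂ q} (hχ : χ ≠ 1) (m : ℕ) :
    ‖∑ k ∈ Finset.range m, χ k‖ ≤ q := by
  have h0 (d : ℕ) : ∑ k ∈ Finset.range (q * d), χ k = 0 := by
    induction d with
    | zero => simp
    | succ d ih =>
      rw [mul_add_one, Finset.sum_range_add, ih, zero_add]
      have := sum_range_zmod (q := q) (fun x ↦ χ x)
      rw [MulChar.sum_eq_zero_of_ne_one hχ] at this
      simpa using this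
  rw [← Nat.div_add_mod m q, Finset.sum_range_add, h0, zero_add]
  refine (norm_sum_le_of_le _ fun k _ ↦ χ.norm_le_one _).trans ?_
  simpa using (Nat.mod_lt m (NeZero.pos q)).le

lemma norm_sum_Icc_char_le {χ : DirichletCharacter ℂ q} (hχ : χ ≠ 1) (m : ℕ) :
    ‖∑ k ∈ Finset.Icc 1 m, χ k‖ ≤ q := by
  have hq : q ≠ 1 := fun h ↦ by subst h; exact hχ (DirichletCharacter.level_one χ)
  have h := norm_sum_range_char_le hχ (m + 1)
  have : Nontrivial (ZMod q) := ZMod.nontrivial_iff.2 hq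
  rw [Finset.range_eq_Ico, Finset.sum_eq_sum_Ico_succ_bot (by omega)] at h
  have h2 : Finset.Icc 1 m = Finset.Ico 1 (m + 1) := by ext; simp
  rw [h2]
  simpa [MulChar.map_zero] using h

open MeasureTheory Filter Asymptotics in
lemma LFunction_eq_mul_integral {χ : DirichletCharacter ℂ q} (hχ : χ ≠ 1) {s : ℂ} (hs : 0 < s.re) :
    χ.LFunction s =
      s * ∫ t in Ioi (1 : ℝ), (∑ k ∈ Finset.Icc 1 ⌊t⌋₊, χ k) * (t : ℂ) ^ (-(s + 1)) := by
  set S : ℝ → ℂ := fun t ↦ ∑ k ∈ Finset.Icc 1 ⌊t⌋₊, χ k with hS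
  set F : ℝ → ℂ := (Ioi (1 : ℝ)).indicator S with hF
  have hSb (t : ℝ) : ‖S t‖ ≤ q := norm_sum_Icc_char_le hχ _
  have hSm : Measurable S :=
    (measurable_from_nat (f := fun m ↦ ∑ k ∈ Finset.Icc 1 m, χ k)).comp Nat.measurable_floor
  have hFm : Measurable F := hSm.indicator measurableSet_Ioi
  have hFb (t : ℝ) : ‖F t‖ ≤ q := (norm_indicator_le_norm_self _ _).trans (hSb t)
  have hmel (s : ℂ) : mellin F (-s) = ∫ t in Ioi (1 : ℝ), S t * (t : ℂ) ^ (-(s + 1)) := by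
    have h1 : ∀ t : ℝ, (t : ℂ) ^ (-s - 1) • F t
        = (Ioi (1 : ℝ)).indicator (fun t ↦ S t * (t : ℂ) ^ (-(s + 1))) t := by
      intro t
      by_cases ht : t ∈ Ioi (1 : ℝ)
      · simp only [hF, indicator_of_mem ht, smul_eq_mul]
        rw [mul_comm, neg_add, sub_eq_add_neg]
      · simp [hF, indicator_of_notMem ht]
    rw [mellin]
    simp_rw [h1]
    rw [setIntegral_indicator measurableSet_Ioi]
    congr 2
    rw [inter_eq_right]
    exact Ioi_subset_Ioi zero_le_one
  have hdiff : DifferentiableOn ℂ (fun s ↦ s * mellin F (-s)) {s | 0 < s.re} := by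
    intro s hs
    have hs : 0 < s.re := hs
    refine (differentiableAt_id.mul (DifferentiableAt.fun_comp' (g := mellin F) (f := Neg.neg) s ?_
      differentiable_neg.differentiableAt)).differentiableWithinAt
    refine mellin_differentiableAt_of_isBigO_rpow (a := 0) (b := -s.re - 1) ?_ ?_ (by simpa using hs)
      ?_ (by simp)
    · refine LocallyIntegrable.locallyIntegrableOn (fun t ↦ ?_) _
      refine ⟨Icc (t - 1) (t + 1), Icc_mem_nhds (by linarith) (by linarith), ?_⟩
      exact Measure.integrableOn_of_bounded (M := q) (by simp) hFm.aestronglyMeasurable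
        (Eventually.of_forall hFb)
    · refine IsBigO.of_bound q (Eventually.of_forall fun t ↦ ?_)
      simpa using hFb t
    · refine IsBigO.of_bound 0 ?_
      filter_upwards [mem_nhdsWithin_of_mem_nhds (Iio_mem_nhds (zero_lt_one' ℝ))] with t ht
      have : t ∉ Ioi (1 : ℝ) := by simpa using (le_of_lt ht)
      simp [hF, indicator_of_notMem this]
  have hopen : IsOpen {s : ℂ | 0 < s.re} := isOpen_lt continuous_const continuous_re
  have hpre : IsPreconnected {s : ℂ | 0 < s.re} := (convex_halfSpace_re_gt 0).isPreconnected
  have heq := (χ.differentiable_LFunction hχ).differentiableOn.analyticOnNhd hopen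
    |>.eqOn_of_preconnected_of_eventuallyEq (hdiff.analyticOnNhd hopen) hpre
    (z₀ := 2) (by simp) ?_
  · have h := heq hs
    simp only [hmel] at h
    exact h
  · filter_upwards [(isOpen_lt continuous_const continuous_re).mem_nhds
      (show (1 : ℝ) < (2 : ℂ).re by norm_num)] with s hs
    rw [χ.LFunction_eq_LSeries hs, hmel]
    refine LSeries_eq_mul_integral _ le_rfl (by linarith [show (1 : ℝ) < s.re from hs])
      (χ.LSeriesSummable_of_one_lt_re hs) ?_
    refine IsBigO.of_bound q (Eventually.of_forall fun n ↦ ?_)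
    simpa using norm_sum_Icc_char_le hχ n

lemma norm_LFunction_le {χ : DirichletCharacter ℂ q} (hχ : χ ≠ 1) {s : ℂ} (hs : 0 < s.re) :
    ‖χ.LFunction s‖ ≤ q * ‖s‖ / s.re := by
  rw [LFunction_eq_mul_integral hχ hs, norm_mul]
  have h1 : ‖∫ t in Ioi (1 : ℝ), (∑ k ∈ Finset.Icc 1 ⌊t⌋₊, χ k) * (t : ℂ) ^ (-(s + 1))‖ ≤
      ∫ t in Ioi (1 : ℝ), q * t ^ (-(s.re + 1)) := by
    refine MeasureTheory.norm_integral_le_of_norm_le ?_ ?_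
    · exact (integrableOn_Ioi_rpow_of_lt (by linarith) zero_lt_one).const_mul _
    · filter_upwards [MeasureTheory.ae_restrict_mem measurableSet_Ioi] with t ht
      have ht : (1 : ℝ) < t := ht
      rw [norm_mul, norm_cpow_eq_rpow_re_of_pos (by linarith)]
      have := norm_sum_Icc_char_le hχ ⌊t⌋₊
      simp only [neg_re, add_re, one_re]
      gcongr
  rw [MeasureTheory.integral_const_mul, integral_Ioi_rpow_of_lt (by linarith) zero_lt_one,
    Real.one_rpow] at h1
  calc _ ≤ ‖s‖ * (q * (-1 / (-(s.re + 1) + 1))) := by gcongr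
    _ = _ := by
      rw [show -(s.re + 1) + 1 = -s.re by ring]
      field_simp

end Linnik

namespace Linnik

open Complex Metric Set
open scoped ArithmeticFunction.vonMangoldt

/-- The Dirichlet series `∑ χ(n) Λ(n) (log n)^j n^{-σ}`. -/
noncomputable def psiSum {q : ℕ} (χ : DirichletCharacter ℂ q) (j : ℕ) (σ : ℝ) : ℂ :=
  ∑' n : ℕ, χ n * ((Λ n * Real.log n ^ j * (n : ℝ) ^ (-σ) : ℝ) : ℂ)

lemma logMul_iterate_apply (f : ℕ → ℂ) (j n : ℕ) :
    (LSeries.logMul^[j] f) n = Complex.log n ^ j * f n := by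
  induction j generalizing f with
  | zero => simp
  | succ j ih => rw [Function.iterate_succ_apply, ih, LSeries.logMul]; ring

lemma term_logMul_iterate {q : ℕ} (χ : DirichletCharacter ℂ q) (j n : ℕ) (σ : ℝ) :
    LSeries.term (LSeries.logMul^[j] ((fun n : ℕ ↦ χ n) * fun n : ℕ ↦ (Λ n : ℂ))) σ n =
      χ n * ((Λ n * Real.log n ^ j * (n : ℝ) ^ (-σ) : ℝ) : ℂ) := by
  rcases eq_or_ne n 0 with rfl | hn
  · simp
  rw [LSeries.term_of_ne_zero hn, logMul_iterate_apply]
  push_cast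
  rw [Complex.ofReal_cpow (by positivity), ← natCast_log]
  simp only [Pi.mul_apply, ofReal_natCast, ofReal_neg, cpow_neg, div_eq_mul_inv]
  ring

lemma abscissa_lt {q : ℕ} (χ : DirichletCharacter ℂ q) {s : ℂ} (hs : 1 < s.re) :
    LSeries.abscissaOfAbsConv ((fun n : ℕ ↦ χ n) * fun n : ℕ ↦ (Λ n : ℂ)) < s.re := by
  refine lt_of_le_of_lt (LSeries.abscissaOfAbsConv_le_of_forall_lt_LSeriesSummable
    (x := 1) fun y hy ↦ ?_) (by exact_mod_cast hs)
  exact χ.LSeriesSummable_twist_vonMangoldt (by simpa using hy)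

lemma summable_psi (j : ℕ) {σ : ℝ} (hσ : 1 < σ) :
    Summable fun n : ℕ ↦ Λ n * Real.log n ^ j * (n : ℝ) ^ (-σ) := by
  have h : LSeriesSummable (LSeries.logMul^[j] ((fun n : ℕ ↦ (1 : DirichletCharacter ℂ 1) n) * fun n : ℕ ↦ (Λ n : ℂ))) σ := by
    refine LSeriesSummable_of_abscissaOfAbsConv_lt_re ?_
    rw [LSeries.absicssaOfAbsConv_logPowMul]
    exact abscissa_lt 1 (by simpa using hσ)
  have h2 := h.norm
  refine h2.congr fun n ↦ ?_
  rw [term_logMul_iterate, norm_mul, Subsingleton.elim (n : ZMod 1) 1, map_one, norm_one, one_mul,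
    norm_real, Real.norm_of_nonneg]
  have := ArithmeticFunction.vonMangoldt_nonneg (n := n)
  have := Real.log_natCast_nonneg n
  positivity

lemma iteratedDeriv_logDeriv_LFunction {q : ℕ} [NeZero q] (χ : DirichletCharacter ℂ q) (j : ℕ)
    {σ : ℝ} (hσ : 1 < σ) :
    iteratedDeriv j (logDeriv χ.LFunction) σ = -((-1) ^ j * psiSum χ j σ) := by
  have hev : logDeriv χ.LFunction =ᶠ[nhds (σ : ℂ)] fun z ↦ -LSeries ((fun n : ℕ ↦ χ n) * fun n : ℕ ↦ (Λ n : ℂ)) z := by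
    filter_upwards [(isOpen_lt continuous_const continuous_re).mem_nhds
      (show (1 : ℝ) < (σ : ℂ).re by simpa using hσ)] with s hs
    rw [χ.LSeries_twist_vonMangoldt_eq hs, logDeriv_apply, χ.deriv_LFunction_eq_deriv_LSeries hs,
      χ.LFunction_eq_LSeries hs]
    ring
  rw [hev.iteratedDeriv_eq j, iteratedDeriv_fun_neg,
    LSeries_iteratedDeriv j (abscissa_lt χ (by simpa using hσ)), LSeries, psiSum]
  simp_rw [term_logMul_iterate]

/-- Zeros of `L(s, χ)` near `1` and the corresponding explicit formula. -/
theorem exists_zeros : ∃ C : ℝ, 0 < C ∧ ∀ (q : ℕ) [NeZero q] (χ : DirichletCharacter ℂ q), χ ≠ 1 →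
    ∃ (n : ℕ) (ρ : Fin n → ℂ), (∀ i, χ.LFunction (ρ i) = 0) ∧ (∀ i, (ρ i).re < 1) ∧
      (∀ s ∈ closedBall (17 / 16 : ℂ) (5 / 16), χ.LFunction s = 0 → ∃ i, ρ i = s) ∧
      ∀ σ : ℝ, 1 < σ → σ ≤ 17 / 16 → ∀ j : ℕ,
        ‖psiSum χ j σ + j.factorial * ∑ i, (((σ : ℂ) - ρ i) ^ (j + 1))⁻¹‖ ≤
          (j + 1).factorial * (3 * (Real.log q + C)) * 8 ^ (j + 1) := by
  set K : ℝ := ∑' n : ℕ, (n : ℝ) ^ (-(17 / 16 : ℝ)) with hK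
  have hK1 : 1 ≤ K := by
    have hs : Summable fun n : ℕ ↦ (n : ℝ) ^ (-(17 / 16 : ℝ)) :=
      Real.summable_nat_rpow.2 (by norm_num)
    have := hs.le_tsum 1 (fun n _ ↦ by positivity)
    simpa using this
  refine ⟨Real.log (16 * K), Real.log_pos (by linarith), fun q _ χ hχ ↦ ?_⟩
  have hq : (1 : ℝ) ≤ q := by exact_mod_cast NeZero.one_le
  have hL1 := one_le_norm_LSeries_mul χ (σ := 17 / 16) (by norm_num)
  rw [← χ.LFunction_eq_LSeries (by norm_num), ← hK] at hL1
  have hcast : ((17 / 16 : ℝ) : ℂ) = 17 / 16 := by push_cast; rfl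
  rw [hcast] at hL1
  have hne : χ.LFunction (17 / 16 : ℂ) ≠ 0 := fun h ↦ by
    rw [h, norm_zero, zero_mul] at hL1; linarith
  set M := Real.log q + Real.log (16 * K) with hM
  have hexp : Real.exp M = q * (16 * K) := by
    rw [hM, Real.exp_add, Real.exp_log (by linarith), Real.exp_log (by linarith)]
  have hM0 : 0 < M := by
    have := Real.log_nonneg hq
    have := Real.log_pos (show (1 : ℝ) < 16 * K by linarith)
    linarith
  have hbd : ∀ s ∈ closedBall (17 / 16 : ℂ) (3 * (5 / 16)),
      ‖χ.LFunction s‖ ≤ Real.exp M * ‖χ.LFunction (17 / 16)‖ := by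
    intro s hs
    rw [mem_closedBall, dist_eq_norm] at hs
    have hre : 1 / 8 ≤ s.re := by
      have := (abs_le.1 ((abs_re_le_norm _).trans hs)).1
      norm_num at this
      linarith
    have hns : ‖s‖ ≤ 2 := by
      have h1 := norm_le_norm_sub_add s (17 / 16)
      have h2 : ‖(17 / 16 : ℂ)‖ = 17 / 16 := by norm_num
      linarith
    calc ‖χ.LFunction s‖ ≤ q * ‖s‖ / s.re := norm_LFunction_le hχ (by linarith)
      _ ≤ q * 2 / (1 / 8) := by gcongr
      _ = q * 16 * 1 := by ring
      _ ≤ q * 16 * (‖χ.LFunction (17 / 16)‖ * K) := by gcongr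
      _ = _ := by rw [hexp]; ring
  obtain ⟨n, ρ, hρ, h0, hcomp, hexpn⟩ := local_zero_expansion (χ.differentiable_LFunction hχ)
    (c := 17 / 16) (R := 5 / 16) (M := M) (r := 1 / 16) (t := 1 / 8) hM0 (by norm_num)
    (by norm_num) (by norm_num) hne hbd
  · refine ⟨n, ρ, h0, fun i ↦ ?_, hcomp, fun σ h1 h2 j ↦ ?_⟩
    · by_contra! h
      exact χ.LFunction_ne_zero_of_one_le_re (.inl hχ) h (h0 i)
    · have hmem : (σ : ℂ) ∈ closedBall (17 / 16 : ℂ) (1 / 16) := by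
        rw [mem_closedBall, dist_eq_norm, ← hcast, ← ofReal_sub, norm_real, Real.norm_eq_abs,
          abs_le]
        constructor <;> linarith
      have h3 := hexpn σ hmem (χ.LFunction_ne_zero_of_one_le_re (.inl hχ) (by simpa using h1.le)) j
      rw [iteratedDeriv_logDeriv_LFunction χ j h1] at h3
      have h4 : -((-1) ^ j * psiSum χ j σ) - (-1) ^ j * j.factorial * ∑ i, ((σ - ρ i) ^ (j + 1))⁻¹ =
        -(-1) ^ j * (psiSum χ j σ + j.factorial * ∑ i, (((σ : ℂ) - ρ i) ^ (j + 1))⁻¹) := by ring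
      rw [h4, norm_mul, norm_neg, norm_pow, norm_neg, norm_one, one_pow, one_mul] at h3
      refine h3.trans (le_of_eq ?_)
      rw [show (1 / 8 : ℝ) ^ (j + 1) = (8 ^ (j + 1))⁻¹ by rw [one_div, inv_pow], div_inv_eq_mul]
      ring

lemma exists_zeta_bound (j : ℕ) : ∃ C : ℝ, 0 < C ∧ ∀ σ : ℝ, 1 < σ → σ ≤ 17 / 16 →
    |(∑' n : ℕ, Λ n * Real.log n ^ j * (n : ℝ) ^ (-σ)) - j.factorial / (σ - 1) ^ (j + 1)| ≤ C := by
  set h := DirichletCharacter.LFunctionTrivChar₁ 1 with hh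
  have hd : Differentiable ℂ h := DirichletCharacter.differentiable_LFunctionTrivChar₁ 1
  have hne : ∀ s : ℂ, 1 ≤ s.re → h s ≠ 0 := by
    intro s hs
    rcases eq_or_ne s 1 with rfl | hs1
    · exact DirichletCharacter.LFunctionTrivChar₁_apply_one_ne_zero 1
    · rw [hh, DirichletCharacter.LFunctionTrivChar₁, Function.update_of_ne hs1, mul_ne_zero_iff]
      exact ⟨sub_ne_zero_of_ne hs1, DirichletCharacter.LFunction_ne_zero_of_one_le_re _ (.inr hs1) hs⟩
  have hcont : ContinuousOn (fun σ : ℝ ↦ iteratedDeriv j (logDeriv h) σ) (Icc 1 (17 / 16)) := by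
    intro σ hσ
    have hc2 : AnalyticAt ℂ (logDeriv h) σ :=
      (hd.analyticAt σ).deriv.div (hd.analyticAt σ) (hne σ (by simpa using hσ.1))
    have := hc2.iterated_deriv j
    rw [← iteratedDeriv_eq_iterate] at this
    exact (this.continuousAt.comp continuous_ofReal.continuousAt).continuousWithinAt
  obtain ⟨C, hC⟩ := isCompact_Icc.exists_bound_of_continuousOn hcont
  refine ⟨max C 1, by positivity, fun σ h1 h2 ↦ ?_⟩
  refine le_trans ?_ ((hC σ ⟨h1.le, h2⟩).trans (le_max_left _ _))
  have hev : logDeriv h =ᶠ[nhds (σ : ℂ)]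
      fun z ↦ (z - 1)⁻¹ + logDeriv (DirichletCharacter.LFunction (1 : DirichletCharacter ℂ 1)) z := by
    filter_upwards [(isOpen_lt continuous_const continuous_re).mem_nhds
      (show (1 : ℝ) < (σ : ℂ).re by simpa using h1)] with s hs
    have hs1 : s ≠ 1 := fun h ↦ by rw [h] at hs; simp at hs
    have hL := DirichletCharacter.LFunction_ne_zero_of_one_le_re (1 : DirichletCharacter ℂ 1)
      (.inr hs1) (le_of_lt hs)
    have := sub_ne_zero_of_ne hs1
    rw [logDeriv_apply, logDeriv_apply, hh,
      DirichletCharacter.deriv_LFunctionTrivChar₁_apply_of_ne_one 1 hs1,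
      DirichletCharacter.LFunctionTrivChar₁, Function.update_of_ne hs1]
    simp only [DirichletCharacter.LFunctionTrivChar]
    field_simp
    ring
  have hs1 : (σ : ℂ) ≠ 1 := fun h ↦ by
    have : σ = 1 := by exact_mod_cast h
    linarith
  have hL := DirichletCharacter.LFunction_ne_zero_of_one_le_re (1 : DirichletCharacter ℂ 1)
      (.inr hs1) (by simpa using h1.le)
  have hLa : AnalyticAt ℂ (DirichletCharacter.LFunction (1 : DirichletCharacter ℂ 1)) σ := by
    refine DifferentiableOn.analyticAt (s := {(1 : ℂ)}ᶜ) (fun z hz ↦ ?_)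
      (isOpen_compl_singleton.mem_nhds (by simpa using hs1))
    exact (DirichletCharacter.differentiableAt_LFunction _ z (.inl hz)).differentiableWithinAt
  have hc1 : ContDiffAt ℂ j (fun z : ℂ ↦ (z - 1)⁻¹) σ :=
    ContDiffAt.inv (by fun_prop) (sub_ne_zero_of_ne hs1)
  have hc2 : ContDiffAt ℂ j
      (logDeriv (DirichletCharacter.LFunction (1 : DirichletCharacter ℂ 1))) σ :=
    (hLa.deriv.div hLa hL).contDiffAt
  rw [hev.iteratedDeriv_eq j, iteratedDeriv_fun_add hc1 hc2,
    iteratedDeriv_inv_sub, iteratedDeriv_logDeriv_LFunction _ j h1]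
  have h5 : psiSum (1 : DirichletCharacter ℂ 1) j σ =
      ((∑' n : ℕ, Λ n * Real.log n ^ j * (n : ℝ) ^ (-σ) : ℝ) : ℂ) := by
    rw [psiSum, ofReal_tsum]
    congr 1
    ext n
    rw [Subsingleton.elim (n : ZMod 1) 1, map_one, one_mul]
  rw [h5]
  have h6 : (-1 : ℂ) ^ j * j.factorial * (((σ : ℂ) - 1) ^ (j + 1))⁻¹ +
      -((-1) ^ j * ((∑' n : ℕ, Λ n * Real.log n ^ j * (n : ℝ) ^ (-σ) : ℝ) : ℂ)) =
      -(-1) ^ j * (((∑' n : ℕ, Λ n * Real.log n ^ j * (n : ℝ) ^ (-σ)) -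
        j.factorial / (σ - 1) ^ (j + 1) : ℝ) : ℂ) := by
    push_cast
    ring
  rw [h6, norm_mul, norm_neg, norm_pow, norm_neg, norm_one, one_pow, one_mul, norm_real,
    Real.norm_eq_abs]

end Linnik

namespace Linnik

open Complex Metric Set
open scoped ArithmeticFunction.vonMangoldt

/-- The Dirichlet series `∑ Λ(n) (log n)^j n^{-σ}`. -/
noncomputable def psiZeta (j : ℕ) (σ : ℝ) : ℝ := ∑' n : ℕ, Λ n * Real.log n ^ j * (n : ℝ) ^ (-σ)

lemma psi_term_nonneg (j n : ℕ) (σ : ℝ) : 0 ≤ Λ n * Real.log n ^ j * (n : ℝ) ^ (-σ) := by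
  have := ArithmeticFunction.vonMangoldt_nonneg (n := n)
  have := Real.log_natCast_nonneg n
  positivity

section
variable {q : ℕ}

lemma norm_psi_term_le (χ : DirichletCharacter ℂ q) (j n : ℕ) (σ : ℝ) :
    ‖χ n * ((Λ n * Real.log n ^ j * (n : ℝ) ^ (-σ) : ℝ) : ℂ)‖ ≤
      Λ n * Real.log n ^ j * (n : ℝ) ^ (-σ) := by
  rw [norm_mul, norm_real, Real.norm_of_nonneg (psi_term_nonneg j n σ)]
  exact mul_le_of_le_one_left (psi_term_nonneg j n σ) (χ.norm_le_one _)

lemma summable_psi_char (χ : DirichletCharacter ℂ q) (j : ℕ) {σ : ℝ} (hσ : 1 < σ) :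
    Summable fun n : ℕ ↦ χ n * ((Λ n * Real.log n ^ j * (n : ℝ) ^ (-σ) : ℝ) : ℂ) :=
  Summable.of_norm_bounded (summable_psi j hσ) (norm_psi_term_le χ j · σ)

lemma norm_psiSum_le (χ : DirichletCharacter ℂ q) (j : ℕ) {σ : ℝ} (hσ : 1 < σ) :
    ‖psiSum χ j σ‖ ≤ psiZeta j σ :=
  tsum_of_norm_bounded (summable_psi j hσ).hasSum (norm_psi_term_le χ j · σ)

lemma re_psiSum (χ : DirichletCharacter ℂ q) (j : ℕ) {σ : ℝ} (hσ : 1 < σ) :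
    (psiSum χ j σ).re = ∑' n : ℕ, (χ n).re * (Λ n * Real.log n ^ j * (n : ℝ) ^ (-σ)) := by
  rw [psiSum, re_tsum (summable_psi_char χ j hσ)]
  simp only [re_mul_ofReal]

lemma summable_re_psi (χ : DirichletCharacter ℂ q) (j : ℕ) {σ : ℝ} (hσ : 1 < σ) :
    Summable fun n : ℕ ↦ (χ n).re * (Λ n * Real.log n ^ j * (n : ℝ) ^ (-σ)) := by
  have := (hasSum_re (summable_psi_char χ j hσ).hasSum).summable
  simpa only [re_mul_ofReal] using this

lemma three_char_nonneg (χ ψ : DirichletCharacter ℂ q) {σ : ℝ} (hσ : 1 < σ) :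
    0 ≤ 3 * psiZeta 0 σ + 2 * ((psiSum χ 0 σ).re + (psiSum ψ 0 σ).re + (psiSum (χ * ψ⁻¹) 0 σ).re) := by
  have h1 := summable_psi 0 hσ
  have h2 := summable_re_psi χ 0 hσ
  have h3 := summable_re_psi ψ 0 hσ
  have h4 := summable_re_psi (χ * ψ⁻¹) 0 hσ
  rw [re_psiSum _ _ hσ, re_psiSum _ _ hσ, re_psiSum _ _ hσ, psiZeta, ← h2.tsum_add h3,
    ← (h2.add h3).tsum_add h4, ← tsum_mul_left, ← tsum_mul_left,
    ← (h1.mul_left 3).tsum_add (((h2.add h3).add h4).mul_left 2)]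
  refine tsum_nonneg fun n ↦ ?_
  have h5 := psi_term_nonneg 0 n σ
  suffices h : 0 ≤ 3 + 2 * ((χ n).re + (ψ n).re + ((χ * ψ⁻¹) n).re) by nlinarith
  have e : ((χ * ψ⁻¹) n).re = (χ n).re * (ψ n).re + (χ n).im * (ψ n).im := by
    rw [MulChar.mul_apply, show ψ⁻¹ n = (starRingEnd ℂ) (ψ n) from MulChar.star_apply' ψ n ▸ rfl]
    simp
  rw [e]
  have h6 := χ.norm_le_one n
  have h7 := ψ.norm_le_one n
  rw [← sq_le_one_iff₀ (norm_nonneg _), ← normSq_eq_norm_sq, normSq_apply] at h6 h7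
  nlinarith [sq_nonneg (1 + (χ n).re + (ψ n).re), sq_nonneg ((χ n).im + (ψ n).im)]

end

lemma le_re_inv_of_near {w : ℂ} {k c : ℝ} (hc : 0 < c) (hck : c < k) (hw : ‖w - k‖ ≤ c) :
    1 / (k + c) ≤ (w⁻¹).re := by
  have h1 : |(w - k).re| ≤ c := (abs_re_le_norm _).trans hw
  have h2 : ‖w - k‖ ^ 2 ≤ c ^ 2 := by gcongr
  rw [← normSq_eq_norm_sq, normSq_apply] at h2
  simp only [sub_re, sub_im, ofReal_re, ofReal_im, sub_zero] at h1 h2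
  have h3 := (abs_le.1 h1)
  have h4 : 0 < w.re := by linarith
  have h5 : 0 < normSq w := by rw [normSq_apply]; nlinarith [mul_self_nonneg w.im]
  rw [inv_re, div_le_div_iff₀ (by linarith) h5, normSq_apply]
  nlinarith

lemma re_inv_sub_nonneg {σ : ℝ} {ρ : ℂ} (hσ : 1 < σ) (hρ : ρ.re < 1) :
    0 ≤ (((σ : ℂ) - ρ)⁻¹).re := by
  rw [inv_re]
  have := normSq_nonneg ((σ : ℂ) - ρ)
  simp only [sub_re, ofReal_re]
  have : 0 ≤ σ - ρ.re := by linarith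
  positivity

open scoped ComplexConjugate in
lemma LFunction_conj {q : ℕ} [NeZero q] {χ : DirichletCharacter ℂ q} (hχ : χ ≠ 1) (s : ℂ) :
    χ⁻¹.LFunction (conj s) = conj (χ.LFunction s) := by
  have hχ' : χ⁻¹ ≠ 1 := by simpa using hχ
  have hd : Differentiable ℂ fun s ↦ conj (χ.LFunction (conj s)) := fun s ↦ by
    have := (χ.differentiable_LFunction hχ (conj s)).conj_conj
    rw [conj_conj] at this
    exact this
  have heq : χ⁻¹.LFunction = fun s ↦ conj (χ.LFunction (conj s)) := by
    refine (AnalyticOnNhd.eq_of_eventuallyEq (z₀ := 2)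
      (fun s _ ↦ (χ⁻¹.differentiable_LFunction hχ').analyticAt s) (fun s _ ↦ hd.analyticAt s) ?_)
    filter_upwards [(isOpen_lt continuous_const continuous_re).mem_nhds
      (show (1 : ℝ) < (2 : ℂ).re by norm_num)] with s hs
    have hs : 1 < s.re := hs
    rw [χ⁻¹.LFunction_eq_LSeries hs, χ.LFunction_eq_LSeries (by simpa using hs), LSeries, LSeries,
      conj_tsum]
    congr 1
    ext n
    rcases eq_or_ne n 0 with rfl | hn
    · simp
    rw [LSeries.term_of_ne_zero hn, LSeries.term_of_ne_zero hn, map_div₀,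
      show χ⁻¹ n = conj (χ n) from MulChar.star_apply' χ n ▸ rfl]
    congr 1
    have := Complex.cpow_conj n s (by rw [natCast_arg]; exact Real.pi_pos.ne)
    rw [this, conj_natCast]
    simp
  rw [heq]
  simp

end Linnik

namespace Linnik

open Complex Metric Set
open scoped ArithmeticFunction.vonMangoldt

/-- `ρ` lists the zeros of `L(s, χ)` near `1`, and they satisfy the explicit formula. -/
structure IsZeroList {q n : ℕ} [NeZero q] (χ : DirichletCharacter ℂ q) (ρ : Fin n → ℂ) : Prop where
  zero : ∀ i, χ.LFunction (ρ i) = 0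
  re_lt : ∀ i, (ρ i).re < 1
  complete : ∀ s : ℂ, ‖s - 1‖ ≤ 1 / 4 → χ.LFunction s = 0 → ∃ i, ρ i = s
  explicit : ∀ σ : ℝ, 1 < σ → σ ≤ 17 / 16 → ∀ j : ℕ,
    ‖psiSum χ j σ + j.factorial * ∑ i, (((σ : ℂ) - ρ i) ^ (j + 1))⁻¹‖ ≤
      (j + 1).factorial * (25 * Real.log q) * 8 ^ j

lemma exists_isZeroList : ∃ L₀ : ℝ, 1 ≤ L₀ ∧ ∀ (q : ℕ) [NeZero q], L₀ ≤ Real.log q →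
    (∀ σ : ℝ, 1 < σ → σ ≤ 17 / 16 → psiZeta 0 σ ≤ 1 / (σ - 1) + Real.log q) ∧
    ∀ χ : DirichletCharacter ℂ q, χ ≠ 1 →
      ∃ (n : ℕ) (ρ : Fin n → ℂ), IsZeroList χ ρ := by
  obtain ⟨C, hC, h1⟩ := exists_zeros
  obtain ⟨C₀, hC₀, h2⟩ := exists_zeta_bound 0
  refine ⟨24 * C + C₀ + 1, by linarith, fun q _ hq ↦ ⟨fun σ hσ hσ' ↦ ?_, fun χ hχ ↦ ?_⟩⟩
  · have := (abs_le.1 (h2 σ hσ hσ')).2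
    rw [Nat.factorial_zero, zero_add, pow_one, Nat.cast_one] at this
    rw [psiZeta]
    linarith
  · obtain ⟨n, ρ, a1, a2, a3, a4⟩ := h1 q χ hχ
    refine ⟨n, ρ, a1, a2, fun s hs ↦ a3 s ?_, fun σ hσ hσ' j ↦ (a4 σ hσ hσ' j).trans ?_⟩
    · rw [mem_closedBall, dist_eq_norm]
      have := norm_sub_le_norm_sub_add_norm_sub s 1 (17 / 16)
      have e : ‖(1 : ℂ) - 17 / 16‖ = 1 / 16 := by norm_num
      linarith
    · rw [pow_succ]
      have : 3 * (Real.log q + C) * 8 ≤ 25 * Real.log q := by linarith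
      calc _ = (j + 1).factorial * (3 * (Real.log q + C) * 8) * 8 ^ j := by ring
        _ ≤ _ := by gcongr

lemma near_re_inv {q : ℕ} {ρ : ℂ} (hq : 1 ≤ Real.log q)
    (hρ : ‖1 - ρ‖ ≤ 1 / (2400 * Real.log q)) :
    800 / 3 * Real.log q ≤ ((((1 + 1 / (300 * Real.log q) : ℝ) : ℂ) - ρ)⁻¹).re := by
  have := le_re_inv_of_near (w := ((1 + 1 / (300 * Real.log q) : ℝ) : ℂ) - ρ)
    (k := 1 / (300 * Real.log q)) (c := 1 / (2400 * Real.log q)) (by positivity) (by gcongr; norm_num)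
    (by convert hρ using 2; push_cast; ring)
  refine le_trans (le_of_eq ?_) this
  field_simp
  norm_num

section
variable {q n : ℕ} [NeZero q] {χ : DirichletCharacter ℂ q} {ρ : Fin n → ℂ}

lemma IsZeroList.re_psiSum_le (h : IsZeroList χ ρ) {σ : ℝ} (h1 : 1 < σ) (h2 : σ ≤ 17 / 16)
    (I : Finset (Fin n)) :
    (psiSum χ 0 σ).re ≤ 25 * Real.log q - ∑ i ∈ I, (((σ : ℂ) - ρ i)⁻¹).re := by
  have h3 := (re_le_norm _).trans (h.explicit σ h1 h2 0)
  simp only [add_re, Nat.factorial_zero, Nat.cast_one, one_mul, zero_add, pow_one, re_sum,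
    Nat.factorial_one, pow_zero, mul_one] at h3
  have h4 : ∑ i ∈ I, (((σ : ℂ) - ρ i)⁻¹).re ≤ ∑ i, (((σ : ℂ) - ρ i)⁻¹).re :=
    Finset.sum_le_sum_of_subset_of_nonneg (Finset.subset_univ _)
      fun i _ _ ↦ re_inv_sub_nonneg h1 (h.re_lt i)
  linarith

lemma norm_one_sub_le {σ : ℝ} (h1 : 1 < σ) {z : ℂ} (hz : z.re < 1) : ‖1 - z‖ ≤ ‖(σ : ℂ) - z‖ := by
  rw [← sq_le_sq₀ (norm_nonneg _) (norm_nonneg _), ← normSq_eq_norm_sq, ← normSq_eq_norm_sq,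
    normSq_apply, normSq_apply]
  simp only [sub_re, one_re, sub_im, one_im, ofReal_re, ofReal_im]
  nlinarith

/-- The indices of zeros at distance more than `1 / (2400 log q)` from `1`. -/
noncomputable def farZeros (q : ℕ) (ρ : Fin n → ℂ) : Finset (Fin n) :=
  Finset.univ.filter fun i ↦ 1 / (2400 * Real.log q) < ‖1 - ρ i‖

lemma IsZeroList.sum_far_le (h : IsZeroList χ ρ) (hq : 1 ≤ Real.log q)
    (hz : ∀ σ : ℝ, 1 < σ → σ ≤ 17 / 16 → psiZeta 0 σ ≤ 1 / (σ - 1) + Real.log q)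
    {σ : ℝ} (h1 : 1 < σ) (h2 : σ ≤ 1 + 1 / (2400 * Real.log q)) :
    ∑ i ∈ farZeros q ρ, (‖(σ : ℂ) - ρ i‖ ^ 2)⁻¹ ≤ 5 * (2400 * Real.log q) ^ 2 := by
  set D := 2400 * Real.log q with hD
  have hD1 : 2400 ≤ D := by linarith
  have hD0 : 0 < D := by linarith
  set σ₁ : ℝ := 1 + 1 / D with hσ₁
  have hDi : 1 / D ≤ 1 / 2400 := by gcongr
  have hDi0 : 0 < 1 / D := by positivity
  have hσ11 : 1 < σ₁ := by linarith
  have hσ12 : σ₁ ≤ 17 / 16 := by linarith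
  have h3 := h.re_psiSum_le hσ11 hσ12 (farZeros q ρ)
  have h4 := hz σ₁ hσ11 hσ12
  have h5 := (abs_le.1 ((abs_re_le_norm _).trans (norm_psiSum_le χ 0 hσ11))).1
  have h6 : 1 / (σ₁ - 1) = D := by rw [hσ₁]; field_simp; ring
  rw [h6] at h4
  have h7 : ∑ i ∈ farZeros q ρ, (((σ₁ : ℂ) - ρ i)⁻¹).re ≤ D + 26 * Real.log q := by linarith
  have h8 : ∀ i ∈ farZeros q ρ, (‖(σ : ℂ) - ρ i‖ ^ 2)⁻¹ ≤ 4 * D * (((σ₁ : ℂ) - ρ i)⁻¹).re := by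
    intro i hi
    have hi : 1 / D < ‖1 - ρ i‖ := (Finset.mem_filter.1 hi).2
    have hre := h.re_lt i
    have a1 : 1 / D < ‖(σ : ℂ) - ρ i‖ := hi.trans_le (norm_one_sub_le h1 hre)
    have a2 : ‖(σ₁ : ℂ) - ρ i‖ ≤ 2 * ‖(σ : ℂ) - ρ i‖ := by
      have b1 := norm_sub_le_norm_sub_add_norm_sub (σ₁ : ℂ) σ (ρ i)
      have b2 : ‖(σ₁ : ℂ) - σ‖ ≤ 1 / D := by
        rw [← ofReal_sub, norm_real, Real.norm_eq_abs, abs_le]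
        constructor <;> linarith
      linarith
    have a3 : 0 < ‖(σ₁ : ℂ) - ρ i‖ := by
      have := norm_one_sub_le hσ11 hre
      linarith
    rw [inv_re, normSq_eq_norm_sq]
    have a4 : 1 / D ≤ ((σ₁ : ℂ) - ρ i).re := by
      simp only [sub_re, ofReal_re]; linarith
    calc (‖(σ : ℂ) - ρ i‖ ^ 2)⁻¹ ≤ ((‖(σ₁ : ℂ) - ρ i‖ / 2) ^ 2)⁻¹ := by
          gcongr; linarith
      _ = 4 * D * ((1 / D) / ‖(σ₁ : ℂ) - ρ i‖ ^ 2) := by field_simp; norm_num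
      _ ≤ _ := by gcongr
  calc _ ≤ ∑ i ∈ farZeros q ρ, 4 * D * (((σ₁ : ℂ) - ρ i)⁻¹).re := Finset.sum_le_sum h8
    _ = 4 * D * ∑ i ∈ farZeros q ρ, (((σ₁ : ℂ) - ρ i)⁻¹).re := by rw [Finset.mul_sum]
    _ ≤ 4 * D * (D + 26 * Real.log q) := by gcongr
    _ ≤ 5 * D ^ 2 := by nlinarith

lemma add_two_mul_eight_pow_le (j : ℕ) : ((j + 2 : ℕ) : ℝ) * 8 ^ (j + 1) ≤ 16 * 2400 ^ j := by
  induction j with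
  | zero => norm_num
  | succ j ih =>
    have : ((j + 1 + 2 : ℕ) : ℝ) ≤ 2 * (j + 2 : ℕ) := by push_cast; linarith [Nat.cast_nonneg (α := ℝ) j]
    calc ((j + 1 + 2 : ℕ) : ℝ) * 8 ^ (j + 1 + 1) ≤ (2 * (j + 2 : ℕ)) * 8 ^ (j + 1 + 1) := by gcongr
      _ = 16 * (((j + 2 : ℕ) : ℝ) * 8 ^ (j + 1)) := by ring
      _ ≤ 16 * (16 * 2400 ^ j) := by gcongr
      _ ≤ 2400 * (16 * 2400 ^ j) := by gcongr; norm_num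
      _ = _ := by ring

lemma IsZeroList.far_bound (h : IsZeroList χ ρ) (hq : 1 ≤ Real.log q)
    (hz : ∀ σ : ℝ, 1 < σ → σ ≤ 17 / 16 → psiZeta 0 σ ≤ 1 / (σ - 1) + Real.log q)
    {σ : ℝ} (h1 : 1 < σ) (h2 : σ ≤ 1 + 1 / (2400 * Real.log q)) (j : ℕ) :
    ‖psiSum χ (j + 1) σ + (j + 1).factorial *
      ∑ i ∈ (farZeros q ρ)ᶜ, (((σ : ℂ) - ρ i) ^ (j + 2))⁻¹‖ ≤
      6 * (j + 1).factorial * (2400 * Real.log q) ^ (j + 2) := by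
  have h3 := h.sum_far_le hq hz h1 h2
  set D := 2400 * Real.log q with hD
  have hD1 : 2400 ≤ D := by linarith
  have hD0 : 0 < D := by linarith
  have hDi : 1 / D ≤ 1 / 2400 := by gcongr
  have h4 := h.explicit σ h1 (by linarith) (j + 1)
  rw [← Finset.sum_add_sum_compl (farZeros q ρ)] at h4
  have h5 : ‖∑ i ∈ farZeros q ρ, (((σ : ℂ) - ρ i) ^ (j + 2))⁻¹‖ ≤ 5 * D ^ (j + 2) := by
    calc _ ≤ ∑ i ∈ farZeros q ρ, D ^ j * (‖(σ : ℂ) - ρ i‖ ^ 2)⁻¹ := by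
          refine norm_sum_le_of_le _ fun i hi ↦ ?_
          have hi : 1 / D < ‖1 - ρ i‖ := (Finset.mem_filter.1 hi).2
          have a1 : 1 / D < ‖(σ : ℂ) - ρ i‖ := hi.trans_le (norm_one_sub_le h1 (h.re_lt i))
          rw [norm_inv, norm_pow, pow_add, mul_inv]
          gcongr
          rw [← inv_pow]
          gcongr
          rw [inv_le_comm₀ (lt_trans (by positivity) a1) hD0, ← one_div]
          exact a1.le
      _ = D ^ j * ∑ i ∈ farZeros q ρ, (‖(σ : ℂ) - ρ i‖ ^ 2)⁻¹ := by rw [Finset.mul_sum]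
      _ ≤ D ^ j * (5 * D ^ 2) := by gcongr
      _ = _ := by ring
  have h6 : ((j + 1 + 1).factorial : ℝ) * (25 * Real.log q) * 8 ^ (j + 1) ≤
      (j + 1).factorial * D ^ (j + 2) := by
    rw [Nat.factorial_succ (j + 1), hD, mul_pow, Nat.cast_mul]
    have e1 := add_two_mul_eight_pow_le j
    have e2 : Real.log q ≤ Real.log q ^ (j + 2) := le_self_pow₀ hq (by omega)
    calc ((j + 1 + 1 : ℕ) : ℝ) * (j + 1).factorial * (25 * Real.log q) * 8 ^ (j + 1) =
          (j + 1).factorial * (25 * (((j + 2 : ℕ) : ℝ) * 8 ^ (j + 1)) * Real.log q) := by ring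
      _ ≤ (j + 1).factorial * (25 * (16 * 2400 ^ j) * Real.log q ^ (j + 2)) := by gcongr
      _ ≤ (j + 1).factorial * (2400 ^ 2 * (2400 ^ j) * Real.log q ^ (j + 2)) := by
          rw [← mul_assoc 25]
          gcongr
          norm_num
      _ = _ := by ring
  have h7 : psiSum χ (j + 1) σ + (j + 1).factorial *
      ∑ i ∈ (farZeros q ρ)ᶜ, (((σ : ℂ) - ρ i) ^ (j + 2))⁻¹ =
      (psiSum χ (j + 1) σ + (j + 1).factorial *
        (∑ i ∈ farZeros q ρ, (((σ : ℂ) - ρ i) ^ (j + 1 + 1))⁻¹ +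
          ∑ i ∈ (farZeros q ρ)ᶜ, (((σ : ℂ) - ρ i) ^ (j + 1 + 1))⁻¹)) -
      (j + 1).factorial * ∑ i ∈ farZeros q ρ, (((σ : ℂ) - ρ i) ^ (j + 2))⁻¹ := by ring
  rw [h7]
  refine (norm_sub_le _ _).trans ?_
  rw [norm_mul, norm_natCast]
  calc _ ≤ (j + 1).factorial * D ^ (j + 2) + (j + 1).factorial * (5 * D ^ (j + 2)) := by
        gcongr
        exact h4.trans h6
    _ = _ := by ring

/-- Each nonprincipal character has at most one zero very close to `1`. -/
lemma IsZeroList.near_unique (h : IsZeroList χ ρ) (hq : 1 ≤ Real.log q)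
    (hz : ∀ σ : ℝ, 1 < σ → σ ≤ 17 / 16 → psiZeta 0 σ ≤ 1 / (σ - 1) + Real.log q)
    {i k : Fin n} (hi : i ∉ farZeros q ρ) (hk : k ∉ farZeros q ρ) : i = k := by
  by_contra hik
  set σ : ℝ := 1 + 1 / (300 * Real.log q) with hσ
  have hpos : 0 < 1 / (300 * Real.log q) := by positivity
  have hle : 1 / (300 * Real.log q) ≤ 1 / 300 := by gcongr; linarith
  have h1 : 1 < σ := by linarith
  have h2 : σ ≤ 17 / 16 := by linarith
  have h3 := h.re_psiSum_le h1 h2 {i, k}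
  rw [Finset.sum_pair hik] at h3
  simp only [farZeros, Finset.mem_filter, Finset.mem_univ, true_and, not_lt] at hi hk
  have h4 := near_re_inv hq hi
  have h5 := near_re_inv hq hk
  have h6 := hz σ h1 h2
  have h7 := (abs_le.1 ((abs_re_le_norm _).trans (norm_psiSum_le χ 0 h1))).1
  have h8 : 1 / (σ - 1) = 300 * Real.log q := by rw [hσ]; field_simp; ring
  linarith

/-- At most one nonprincipal character has a zero very close to `1`. -/
lemma near_char_unique {m : ℕ} {ψ : DirichletCharacter ℂ q} {τ : Fin m → ℂ}
    {l : ℕ} {υ : Fin l → ℂ} (h : IsZeroList χ ρ) (h' : IsZeroList ψ τ)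
    (h'' : IsZeroList (χ * ψ⁻¹) υ) (hq : 1 ≤ Real.log q)
    (hz : ∀ σ : ℝ, 1 < σ → σ ≤ 17 / 16 → psiZeta 0 σ ≤ 1 / (σ - 1) + Real.log q)
    {i : Fin n} (hi : i ∉ farZeros q ρ) {k : Fin m} (hk : k ∉ farZeros q τ) : False := by
  set σ : ℝ := 1 + 1 / (300 * Real.log q) with hσ
  have hpos : 0 < 1 / (300 * Real.log q) := by positivity
  have hle : 1 / (300 * Real.log q) ≤ 1 / 300 := by gcongr; linarith
  have h1 : 1 < σ := by linarith
  have h2 : σ ≤ 17 / 16 := by linarith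
  have h3 := h.re_psiSum_le h1 h2 {i}
  have h3' := h'.re_psiSum_le h1 h2 {k}
  have h3'' := h''.re_psiSum_le h1 h2 ∅
  rw [Finset.sum_singleton] at h3 h3'
  rw [Finset.sum_empty] at h3''
  simp only [farZeros, Finset.mem_filter, Finset.mem_univ, true_and, not_lt] at hi hk
  have h4 := near_re_inv hq hi
  have h5 := near_re_inv hq hk
  have h6 := hz σ h1 h2
  have h7 := three_char_nonneg χ ψ h1
  have h8 : 1 / (σ - 1) = 300 * Real.log q := by rw [hσ]; field_simp; ring
  linarith

end

end Linnik

namespace Linnik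

open Complex Metric Set

/-- Apart from at most one real character, nonprincipal characters have no zero very close to `1`;
the resulting bounds for the logarithmic derivative and its derivatives. -/
theorem exists_exceptional : ∃ L₀ : ℝ, 1 ≤ L₀ ∧ ∀ (q : ℕ) [NeZero q], L₀ ≤ Real.log q →
    (∀ σ : ℝ, 1 < σ → σ ≤ 17 / 16 → psiZeta 0 σ ≤ 1 / (σ - 1) + Real.log q) ∧
    ∃ (χ₁ : DirichletCharacter ℂ q) (β : ℝ), β < 1 ∧ 1 - 1 / (2400 * Real.log q) ≤ β ∧ χ₁ ^ 2 = 1 ∧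
    (∀ χ : DirichletCharacter ℂ q, χ ≠ 1 → χ ≠ χ₁ → ∀ (j : ℕ) (σ : ℝ), 1 < σ →
      σ ≤ 1 + 1 / (2400 * Real.log q) →
      ‖psiSum χ (j + 1) σ‖ ≤ 6 * (j + 1).factorial * (2400 * Real.log q) ^ (j + 2)) ∧
    (χ₁ ≠ 1 → (∀ (j : ℕ) (σ : ℝ), 1 < σ → σ ≤ 1 + 1 / (2400 * Real.log q) →
      ‖psiSum χ₁ (j + 1) σ + (j + 1).factorial * (((σ : ℂ) - β) ^ (j + 2))⁻¹‖ ≤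
        6 * (j + 1).factorial * (2400 * Real.log q) ^ (j + 2)) ∧
      ∀ σ : ℝ, 1 < σ → σ ≤ 17 / 16 →
        (psiSum χ₁ 0 σ).re ≤ 25 * Real.log q - (σ - β)⁻¹) := by
  obtain ⟨L₀, hL₀, H⟩ := exists_isZeroList
  refine ⟨L₀, hL₀, fun q _ hq ↦ ?_⟩
  obtain ⟨hz, H⟩ := H q hq
  refine ⟨hz, ?_⟩
  have hq1 : 1 ≤ Real.log q := hL₀.trans hq
  by_cases hex : ∃ (χ : DirichletCharacter ℂ q) (n : ℕ) (ρ : Fin n → ℂ) (i : Fin n), χ ≠ 1 ∧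
      IsZeroList χ ρ ∧ i ∉ farZeros q ρ
  · obtain ⟨χ, n, ρ, i, hχ, hρ, hi⟩ := hex
    have key : ∀ (ψ : DirichletCharacter ℂ q) (m : ℕ) (τ : Fin m → ℂ) (k : Fin m), ψ ≠ 1 →
        IsZeroList ψ τ → k ∉ farZeros q τ → ψ = χ := by
      intro ψ m τ k hψ hτ hk
      by_contra hne
      have : ψ * χ⁻¹ ≠ 1 := fun h ↦ hne (by simpa [mul_inv_eq_one] using h)
      obtain ⟨l, υ, hυ⟩ := H _ this
      exact near_char_unique hτ hρ hυ hq1 hz hk hi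
    have hi' : ‖1 - ρ i‖ ≤ 1 / (2400 * Real.log q) := by
      simpa only [farZeros, Finset.mem_filter, Finset.mem_univ, true_and, not_lt] using hi
    have hdi : 1 / (2400 * Real.log q) ≤ 1 / 4 := by gcongr; linarith
    have hn : ‖1 - (starRingEnd ℂ) (ρ i)‖ = ‖1 - ρ i‖ := by
      rw [← norm_conj (1 - ρ i), map_sub, map_one]
    have hn' : ‖(starRingEnd ℂ) (ρ i) - 1‖ ≤ 1 / 4 := by rw [norm_sub_rev, hn]; linarith
    have hχi : χ⁻¹ = χ := by
      have h1 : χ⁻¹ ≠ 1 := by simpa using hχ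
      obtain ⟨m, τ, hτ⟩ := H _ h1
      obtain ⟨k, hk⟩ := hτ.complete ((starRingEnd ℂ) (ρ i)) hn'
        (by rw [LFunction_conj hχ, hρ.zero, map_zero])
      refine key _ _ τ k h1 hτ ?_
      simpa only [farZeros, Finset.mem_filter, Finset.mem_univ, true_and, not_lt, hk, hn] using hi'
    have hreal : (starRingEnd ℂ) (ρ i) = ρ i := by
      obtain ⟨k, hk⟩ := hρ.complete ((starRingEnd ℂ) (ρ i)) hn'
        (by nth_rw 1 [← hχi]; rw [LFunction_conj hχ, hρ.zero, map_zero])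
      have : k ∉ farZeros q ρ := by
        simpa only [farZeros, Finset.mem_filter, Finset.mem_univ, true_and, not_lt, hk, hn] using hi'
      rw [← hk, hρ.near_unique hq1 hz hi this]
    have hre : ((ρ i).re : ℂ) = ρ i := conj_eq_iff_re.1 hreal
    have hcompl : (farZeros q ρ)ᶜ = {i} := by
      ext k
      simp only [Finset.mem_compl, Finset.mem_singleton]
      exact ⟨fun hk ↦ hρ.near_unique hq1 hz hk hi, fun hk ↦ hk ▸ hi⟩
    refine ⟨χ, (ρ i).re, hρ.re_lt i, ?_, ?_, ?_, fun _ ↦ ⟨?_, ?_⟩⟩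
    · have := (abs_re_le_norm _).trans hi'
      rw [sub_re, one_re, abs_le] at this
      linarith
    · rw [sq]; nth_rw 1 [← hχi]; exact inv_mul_cancel χ
    · intro ψ hψ hne j σ h1 h2
      obtain ⟨m, τ, hτ⟩ := H _ hψ
      have h3 := hτ.far_bound hq1 hz h1 h2 j
      have : (farZeros q τ)ᶜ = ∅ := by
        rw [Finset.eq_empty_iff_forall_notMem]
        exact fun k hk ↦ hne (key ψ m τ k hψ hτ (Finset.mem_compl.1 hk))
      simpa [this] using h3
    · intro j σ h1 h2
      have h3 := hρ.far_bound hq1 hz h1 h2 j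
      rwa [hcompl, Finset.sum_singleton, ← hre] at h3
    · intro σ h1 h2
      have h3 := hρ.re_psiSum_le h1 h2 {i}
      rwa [Finset.sum_singleton, ← hre, ← ofReal_sub, ← ofReal_inv, ofReal_re] at h3
  · push Not at hex
    refine ⟨1, 1 - 1 / (2400 * Real.log q), ?_, le_rfl, one_pow 2, ?_, fun h ↦ absurd rfl h⟩
    · have : 0 < 1 / (2400 * Real.log q) := by positivity
      linarith
    · intro ψ hψ _ j σ h1 h2
      obtain ⟨m, τ, hτ⟩ := H _ hψ
      have h3 := hτ.far_bound hq1 hz h1 h2 j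
      have : (farZeros q τ)ᶜ = ∅ := by
        rw [Finset.eq_empty_iff_forall_notMem]
        exact fun k hk ↦ Finset.mem_compl.1 hk (hex ψ m τ k hψ hτ)
      simpa [this] using h3

end Linnik

namespace Linnik

open Finset

/-- Truncated inclusion-exclusion weight: the sign of `T` if `T` has fewer than `k` elements. -/
def truncSign (k : ℕ) (T : Finset ℕ) : ℝ := if T.card < k then (-1) ^ T.card else 0

/-- The indicator function of the sets with `k` elements. -/
def cardInd (k : ℕ) (T : Finset ℕ) : ℝ := if T.card = k then 1 else 0

/-- The sum of `f(T) ∏_{p ∈ T} g(p)` over the subsets `T` of `S`. -/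
noncomputable def subsetSum (f : Finset ℕ → ℝ) (g : ℕ → ℝ) (S : Finset ℕ) : ℝ :=
  ∑ T ∈ S.powerset, f T * ∏ p ∈ T, g p

lemma subsetSum_insert (f : Finset ℕ → ℝ) (g : ℕ → ℝ) {S : Finset ℕ} {x : ℕ} (hx : x ∉ S) :
    subsetSum f g (insert x S) =
      subsetSum f g S + g x * ∑ T ∈ S.powerset, f (insert x T) * ∏ p ∈ T, g p := by
  rw [subsetSum, sum_powerset_insert hx, subsetSum, mul_sum]
  congr 1
  refine sum_congr rfl fun T hT ↦ ?_
  rw [prod_insert fun h ↦ hx (mem_powerset.1 hT h)]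
  ring

lemma subsetSum_truncSign_insert (k : ℕ) (g : ℕ → ℝ) {S : Finset ℕ} {x : ℕ} (hx : x ∉ S) :
    subsetSum (truncSign (k + 1)) g (insert x S) =
      subsetSum (truncSign (k + 1)) g S - g x * subsetSum (truncSign k) g S := by
  rw [subsetSum_insert _ _ hx, sub_eq_add_neg, ← mul_neg, subsetSum, subsetSum, ← sum_neg_distrib]
  congr 2
  refine sum_congr rfl fun T hT ↦ ?_
  rw [truncSign, truncSign, card_insert_of_notMem fun h ↦ hx (mem_powerset.1 hT h)]
  simp only [add_lt_add_iff_right]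
  split_ifs <;> ring

lemma subsetSum_cardInd_insert (k : ℕ) (g : ℕ → ℝ) {S : Finset ℕ} {x : ℕ} (hx : x ∉ S) :
    subsetSum (cardInd (k + 1)) g (insert x S) =
      subsetSum (cardInd (k + 1)) g S + g x * subsetSum (cardInd k) g S := by
  rw [subsetSum_insert _ _ hx]
  simp only [subsetSum]
  congr 2
  refine sum_congr rfl fun T hT ↦ ?_
  rw [cardInd, cardInd, card_insert_of_notMem fun h ↦ hx (mem_powerset.1 hT h)]
  simp only [add_left_inj]

lemma subsetSum_cardInd_zero (g : ℕ → ℝ) (S : Finset ℕ) : subsetSum (cardInd 0) g S = 1 := by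
  rw [subsetSum, sum_eq_single ∅]
  · simp [cardInd]
  · intro T _ hT
    simp [cardInd, hT]
  · simp

lemma subsetSum_truncSign_zero (g : ℕ → ℝ) (S : Finset ℕ) : subsetSum (truncSign 0) g S = 0 := by
  simp [subsetSum, truncSign]

/-- The Bonferroni inequalities. -/
lemma bonferroni {g : ℕ → ℝ} {S : Finset ℕ} (hg : ∀ p ∈ S, 0 ≤ g p ∧ g p ≤ 1) (k : ℕ) :
    0 ≤ (-1) ^ k * (∏ p ∈ S, (1 - g p) - subsetSum (truncSign k) g S) ∧
    (-1) ^ k * (∏ p ∈ S, (1 - g p) - subsetSum (truncSign k) g S) ≤ subsetSum (cardInd k) g S := by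
  induction S using Finset.induction_on generalizing k with
  | empty =>
    rcases k with _ | k
    · simp [subsetSum, truncSign, cardInd]
    · simp [subsetSum, truncSign, cardInd]
  | insert x S hx ih =>
    have ih := ih fun p hp ↦ hg p (mem_insert_of_mem hp)
    have hgx := hg x (mem_insert_self x S)
    rcases k with _ | k
    · rw [subsetSum_truncSign_zero, subsetSum_cardInd_zero]
      simp only [pow_zero, sub_zero, one_mul]
      exact ⟨prod_nonneg fun p hp ↦ by linarith [(hg p hp).2],
        prod_le_one (fun p hp ↦ by linarith [(hg p hp).2]) fun p hp ↦ by linarith [(hg p hp).1]⟩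
    · rw [subsetSum_truncSign_insert _ _ hx, subsetSum_cardInd_insert _ _ hx, prod_insert hx]
      obtain ⟨h1, h2⟩ := ih (k + 1)
      obtain ⟨h3, h4⟩ := ih k
      have e : (-1 : ℝ) ^ (k + 1) * ((1 - g x) * ∏ p ∈ S, (1 - g p) -
          (subsetSum (truncSign (k + 1)) g S - g x * subsetSum (truncSign k) g S)) =
          (-1) ^ (k + 1) * (∏ p ∈ S, (1 - g p) - subsetSum (truncSign (k + 1)) g S) +
          g x * ((-1) ^ k * (∏ p ∈ S, (1 - g p) - subsetSum (truncSign k) g S)) := by ring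
      rw [e]
      exact ⟨add_nonneg h1 (mul_nonneg hgx.1 h3), add_le_add h2 (mul_le_mul_of_nonneg_left h4 hgx.1)⟩

lemma pow_add_mul_le_add_pow {a x : ℝ} (ha : 0 ≤ a) (hx : 0 ≤ x) (k : ℕ) :
    a ^ (k + 1) + (k + 1) * x * a ^ k ≤ (a + x) ^ (k + 1) := by
  induction k with
  | zero => simp
  | succ k ih =>
    have h1 : 0 ≤ x * x * a ^ k * (k + 1) := by positivity
    calc a ^ (k + 1 + 1) + ((k + 1 : ℕ) + 1) * x * a ^ (k + 1)
        ≤ (a ^ (k + 1) + (k + 1) * x * a ^ k) * (a + x) := by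
          have e : (a ^ (k + 1) + (k + 1) * x * a ^ k) * (a + x) = a ^ (k + 1 + 1) +
              ((k + 1 : ℕ) + 1) * x * a ^ (k + 1) + x * x * a ^ k * (k + 1) := by push_cast; ring
          linarith
      _ ≤ (a + x) ^ (k + 1) * (a + x) := by gcongr
      _ = _ := by ring

lemma subsetSum_cardInd_le {g : ℕ → ℝ} {S : Finset ℕ} (hg : ∀ p ∈ S, 0 ≤ g p) (k : ℕ) :
    subsetSum (cardInd k) g S ≤ (∑ p ∈ S, g p) ^ k / k.factorial := by
  induction S using Finset.induction_on generalizing k with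
  | empty =>
    rcases k with _ | k
    · simp [subsetSum, cardInd]
    · simp [subsetSum, cardInd]
  | insert x S hx ih =>
    have ih := ih fun p hp ↦ hg p (mem_insert_of_mem hp)
    have hgx := hg x (mem_insert_self x S)
    have hS : 0 ≤ ∑ p ∈ S, g p := sum_nonneg fun p hp ↦ hg p (mem_insert_of_mem hp)
    rcases k with _ | k
    · simp [subsetSum_cardInd_zero]
    · rw [subsetSum_cardInd_insert _ _ hx, sum_insert hx]
      calc _ ≤ (∑ p ∈ S, g p) ^ (k + 1) / (k + 1).factorial +
            g x * ((∑ p ∈ S, g p) ^ k / k.factorial) := by gcongr <;> apply ih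
        _ = ((∑ p ∈ S, g p) ^ (k + 1) + (k + 1) * g x * (∑ p ∈ S, g p) ^ k) /
            (k + 1).factorial := by
            rw [Nat.factorial_succ]; push_cast; field_simp
        _ ≤ _ := by
            gcongr
            rw [add_comm (g x)]
            exact pow_add_mul_le_add_pow hS hgx k

lemma subsetSum_cardInd_nonneg {g : ℕ → ℝ} {S : Finset ℕ} (hg : ∀ p ∈ S, 0 ≤ g p) (k : ℕ) :
    0 ≤ subsetSum (cardInd k) g S := by
  refine sum_nonneg fun T hT ↦ mul_nonneg ?_ (prod_nonneg fun p hp ↦ hg p (mem_powerset.1 hT hp))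
  rw [cardInd]; split_ifs <;> norm_num

/-- Upper and lower bound sieve weights `lp`, `lm` of level `D` for the set of primes `P`
with density function `g`, with relative error `E`. -/
structure SievePair (P : Finset ℕ) (g : ℕ → ℝ) (D E : ℝ) (lp lm : Finset ℕ → ℝ) : Prop where
  abs_lp : ∀ T, |lp T| ≤ 1
  abs_lm : ∀ T, |lm T| ≤ 1
  supp_lp : ∀ T ⊆ P, lp T ≠ 0 → ∏ p ∈ T, (p : ℝ) ≤ D
  supp_lm : ∀ T ⊆ P, lm T ≠ 0 → ∏ p ∈ T, (p : ℝ) ≤ D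
  upper : ∀ S ⊆ P, (if S = ∅ then 1 else 0) ≤ ∑ T ∈ S.powerset, lp T
  lower : ∀ S ⊆ P, ∑ T ∈ S.powerset, lm T ≤ (if S = ∅ then 1 else 0)
  sum_lp : subsetSum lp g P ≤ (1 + E) * ∏ p ∈ P, (1 - g p)
  sum_lm : (1 - E) * ∏ p ∈ P, (1 - g p) ≤ subsetSum lm g P

lemma subsetSum_one (f : Finset ℕ → ℝ) (S : Finset ℕ) :
    subsetSum f (fun _ ↦ 1) S = ∑ T ∈ S.powerset, f T := by
  simp [subsetSum]

lemma prod_one_sub_one (S : Finset ℕ) :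
    ∏ _p ∈ S, (1 - 1 : ℝ) = if S = ∅ then 1 else 0 := by
  rcases S.eq_empty_or_nonempty with rfl | h
  · simp
  · rw [if_neg h.ne_empty]; simp [h.ne_empty]

/-- Full inclusion-exclusion. -/
lemma sievePair_base {P : Finset ℕ} {g : ℕ → ℝ} {D : ℝ} (hP : ∀ p ∈ P, 1 ≤ p)
    (hD : ∏ p ∈ P, (p : ℝ) ≤ D) :
    SievePair P g D 0 (fun T ↦ (-1) ^ T.card) (fun T ↦ (-1) ^ T.card) := by
  have h1 : ∀ T ⊆ P, ∏ p ∈ T, (p : ℝ) ≤ D := by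
    intro T hT
    refine le_trans ?_ hD
    rw [← Nat.cast_prod, ← Nat.cast_prod, Nat.cast_le]
    exact prod_le_prod_of_subset_of_one_le' hT fun p hp _ ↦ hP p hp
  have h2 : ∀ (g : ℕ → ℝ) (S : Finset ℕ),
      subsetSum (fun T ↦ (-1) ^ T.card) g S = ∏ p ∈ S, (1 - g p) := by
    intro g S
    simp [prod_sub, subsetSum]
  have h3 : ∀ S : Finset ℕ, ∑ T ∈ S.powerset, (-1 : ℝ) ^ T.card = if S = ∅ then 1 else 0 := by
    intro S
    rw [← subsetSum_one, h2, prod_one_sub_one]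
  exact ⟨by simp, by simp, fun T hT _ ↦ h1 T hT, fun T hT _ ↦ h1 T hT, fun S _ ↦ (h3 S).ge,
    fun S _ ↦ (h3 S).le, by rw [h2]; simp, by rw [h2]; simp⟩

lemma sum_powerset_union {P Q : Finset ℕ} (h : Disjoint P Q) (f : Finset ℕ → Finset ℕ → ℝ) :
    ∑ T ∈ (P ∪ Q).powerset, f (T ∩ P) (T ∩ Q) =
      ∑ T₁ ∈ P.powerset, ∑ T₂ ∈ Q.powerset, f T₁ T₂ := by
  rw [← sum_product']
  refine sum_nbij' (fun T ↦ (T ∩ P, T ∩ Q)) (fun T ↦ T.1 ∪ T.2) ?_ ?_ ?_ ?_ ?_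
  · intro T _
    simp [inter_subset_right]
  · intro T hT
    simp only [mem_product, mem_powerset] at hT ⊢
    exact union_subset_union hT.1 hT.2
  · intro T hT
    simp only [mem_powerset] at hT
    rw [← inter_union_distrib_left, inter_eq_left.2 hT]
  · rintro ⟨T₁, T₂⟩ hT
    simp only [mem_product, mem_powerset] at hT
    have a1 : T₁ ∩ Q = ∅ := disjoint_iff_inter_eq_empty.1 (h.mono_left hT.1)
    have a2 : T₂ ∩ P = ∅ := disjoint_iff_inter_eq_empty.1 (h.symm.mono_left hT.2)
    simp [union_inter_distrib_right, a1, a2, inter_eq_left.2 hT.1, inter_eq_left.2 hT.2]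
  · intro T _
    rfl

lemma subsetSum_union {P Q : Finset ℕ} (h : Disjoint P Q) (f₁ f₂ : Finset ℕ → ℝ) (g : ℕ → ℝ) :
    subsetSum (fun T ↦ f₁ (T ∩ P) * f₂ (T ∩ Q)) g (P ∪ Q) = subsetSum f₁ g P * subsetSum f₂ g Q := by
  rw [subsetSum, subsetSum, subsetSum, sum_mul_sum,
    ← sum_powerset_union h fun T₁ T₂ ↦ (f₁ T₁ * ∏ p ∈ T₁, g p) * (f₂ T₂ * ∏ p ∈ T₂, g p)]
  refine sum_congr rfl fun T hT ↦ ?_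
  have : T = T ∩ P ∪ T ∩ Q := by
    rw [← inter_union_distrib_left, inter_eq_left.2 (mem_powerset.1 hT)]
  conv_lhs => rw [this, prod_union (h.mono inter_subset_right inter_subset_right)]
  rw [← this]
  ring

end Linnik

namespace Linnik

open Finset

lemma exp_neg_two_mul_le {g : ℝ} (h0 : 0 ≤ g) (h1 : g ≤ 1 / 2) : Real.exp (-(2 * g)) ≤ 1 - g := by
  rw [Real.exp_neg, inv_le_comm₀ (Real.exp_pos _) (by linarith)]
  refine le_trans ?_ (Real.add_one_le_exp (2 * g))
  rw [inv_le_iff_one_le_mul₀ (by linarith)]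
  nlinarith

/-- The relative error caused by truncating inclusion-exclusion after `b` terms. -/
noncomputable def truncErr (s : ℝ) (b : ℕ) : ℝ := Real.exp (2 * s) * s ^ (b + 1) / (b + 1).factorial

lemma cardInd_le_truncErr {g : ℕ → ℝ} {Q : Finset ℕ} {s : ℝ}
    (hg : ∀ p ∈ Q, 0 ≤ g p ∧ g p ≤ 1 / 2) (hs : ∑ p ∈ Q, g p ≤ s) (b : ℕ) :
    subsetSum (cardInd (b + 1)) g Q ≤ truncErr s b * ∏ p ∈ Q, (1 - g p) := by
  have h0 : 0 ≤ ∑ p ∈ Q, g p := sum_nonneg fun p hp ↦ (hg p hp).1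
  have h1 : Real.exp (-(2 * s)) ≤ ∏ p ∈ Q, (1 - g p) := by
    calc _ ≤ Real.exp (∑ p ∈ Q, -(2 * g p)) := by
          rw [sum_neg_distrib, ← mul_sum]; gcongr
      _ = ∏ p ∈ Q, Real.exp (-(2 * g p)) := Real.exp_sum _ _
      _ ≤ _ := prod_le_prod (fun _ _ ↦ (Real.exp_pos _).le)
          fun p hp ↦ exp_neg_two_mul_le (hg p hp).1 (hg p hp).2
  have hs0 : 0 ≤ s := h0.trans hs
  calc _ ≤ (∑ p ∈ Q, g p) ^ (b + 1) / (b + 1).factorial :=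
        subsetSum_cardInd_le (fun p hp ↦ (hg p hp).1) _
    _ ≤ s ^ (b + 1) / (b + 1).factorial := by gcongr
    _ = truncErr s b * Real.exp (-(2 * s)) := by
        rw [truncErr, Real.exp_neg]
        have := (Real.exp_pos (2 * s)).ne'
        field_simp
    _ ≤ _ := by
        have : 0 ≤ truncErr s b := by unfold truncErr; positivity
        gcongr

lemma abs_truncSign_le (k : ℕ) (T : Finset ℕ) : |truncSign k T| ≤ 1 := by
  rw [truncSign]; split_ifs <;> simp

lemma prod_inter_le {P Q T : Finset ℕ} (h : Disjoint P Q) (hT : T ⊆ P ∪ Q) {D Y : ℝ} {k : ℕ}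
    (hD : 0 ≤ D) (hY : 1 ≤ Y)
    (hQ : ∀ p ∈ Q, (p : ℝ) ≤ Y) (h1 : ∏ p ∈ T ∩ P, (p : ℝ) ≤ D) (h2 : (T ∩ Q).card ≤ k) :
    ∏ p ∈ T, (p : ℝ) ≤ D * Y ^ k := by
  have : T = T ∩ P ∪ T ∩ Q := by
    rw [← inter_union_distrib_left, inter_eq_left.2 hT]
  rw [this, prod_union (h.mono inter_subset_right inter_subset_right)]
  gcongr
  calc ∏ p ∈ T ∩ Q, (p : ℝ) ≤ ∏ p ∈ T ∩ Q, Y :=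
        prod_le_prod (fun _ _ ↦ by positivity) fun p hp ↦ hQ p (mem_inter.1 hp).2
    _ = Y ^ (T ∩ Q).card := prod_const _
    _ ≤ Y ^ k := by gcongr

lemma sum_powerset_split {P Q S : Finset ℕ} (h : Disjoint P Q) (hS : S ⊆ P ∪ Q)
    (f₁ f₂ : Finset ℕ → ℝ) :
    ∑ T ∈ S.powerset, f₁ (T ∩ P) * f₂ (T ∩ Q) =
      (∑ T ∈ (S ∩ P).powerset, f₁ T) * ∑ T ∈ (S ∩ Q).powerset, f₂ T := by
  have h1 := subsetSum_union (h.mono (inter_subset_right (s₁ := S)) (inter_subset_right (s₁ := S)))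
    f₁ f₂ fun _ ↦ 1
  rw [← inter_union_distrib_left, inter_eq_left.2 hS, subsetSum_one, subsetSum_one,
    subsetSum_one] at h1
  rw [← h1]
  refine sum_congr rfl fun T hT ↦ ?_
  rw [← inter_assoc, ← inter_assoc, inter_eq_left.2 (mem_powerset.1 hT)]

/-- Adding a block of primes to a pair of sieve weights. -/
lemma SievePair.step {P Q : Finset ℕ} {g : ℕ → ℝ} {D E s Y : ℝ} {lp lm : Finset ℕ → ℝ} {b : ℕ}
    (H : SievePair P g D E lp lm) (h : Disjoint P Q) (hb : Even b) (hD : 0 ≤ D)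
    (hE0 : 0 ≤ E) (hE : E ≤ 1)
    (hP : ∀ p ∈ P, 0 ≤ g p ∧ g p ≤ 1) (hQ : ∀ p ∈ Q, 0 ≤ g p ∧ g p ≤ 1 / 2)
    (hs : ∑ p ∈ Q, g p ≤ s) (hY : 1 ≤ Y) (hQY : ∀ p ∈ Q, (p : ℝ) ≤ Y) :
    SievePair (P ∪ Q) g (D * Y ^ (b + 1)) ((1 + E) * (1 + truncErr s b) - 1)
      (fun T ↦ lp (T ∩ P) * truncSign (b + 1) (T ∩ Q))
      (fun T ↦ lm (T ∩ P) * truncSign (b + 1) (T ∩ Q) - lp (T ∩ P) * cardInd (b + 1) (T ∩ Q)) := by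
  have hodd : (-1 : ℝ) ^ (b + 1) = -1 := (Even.add_one hb).neg_one_pow
  have hQ1 : ∀ p ∈ Q, 0 ≤ g p ∧ g p ≤ 1 := fun p hp ↦ ⟨(hQ p hp).1, by linarith [(hQ p hp).2]⟩
  have hV1 : 0 ≤ ∏ p ∈ P, (1 - g p) := prod_nonneg fun p hp ↦ by linarith [(hP p hp).2]
  have hV2 : 0 ≤ ∏ p ∈ Q, (1 - g p) := prod_nonneg fun p hp ↦ by linarith [(hQ p hp).2]
  have hbon := bonferroni hQ1 (b + 1)
  have hηe := cardInd_le_truncErr hQ hs b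
  have hηe0 := subsetSum_cardInd_nonneg (fun p hp ↦ (hQ p hp).1) (b + 1)
  have hη : 0 ≤ truncErr s b := by
    have : 0 ≤ s := (sum_nonneg fun p hp ↦ (hQ p hp).1).trans hs
    unfold truncErr; positivity
  rw [hodd] at hbon
  have hu : ∀ S : Finset ℕ,
      ((if S = ∅ then 1 else 0) ≤ ∑ T ∈ S.powerset, truncSign (b + 1) T) ∧
      (∑ T ∈ S.powerset, truncSign (b + 1) T - ∑ T ∈ S.powerset, cardInd (b + 1) T ≤
        if S = ∅ then 1 else 0) ∧ 0 ≤ ∑ T ∈ S.powerset, cardInd (b + 1) T := by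
    intro S
    have := bonferroni (g := fun _ ↦ 1) (S := S) (by simp) (b + 1)
    have h0 := subsetSum_cardInd_nonneg (g := fun _ ↦ 1) (S := S) (by simp) (b + 1)
    rw [hodd, prod_one_sub_one, subsetSum_one, subsetSum_one] at this
    rw [subsetSum_one] at h0
    refine ⟨by linarith, by linarith, h0⟩
  have hempty : ∀ S ⊆ P ∪ Q, (if S = ∅ then (1 : ℝ) else 0) =
      (if S ∩ P = ∅ then 1 else 0) * (if S ∩ Q = ∅ then 1 else 0) := by
    intro S hS
    have : S = ∅ ↔ S ∩ P = ∅ ∧ S ∩ Q = ∅ := by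
      rw [← union_eq_empty, ← inter_union_distrib_left, inter_eq_left.2 hS]
    simp only [this, ite_and]
    split_ifs <;> simp
  refine ⟨fun T ↦ ?_, fun T ↦ ?_, fun T hT h0 ↦ ?_, fun T hT h0 ↦ ?_, fun S hS ↦ ?_, fun S hS ↦ ?_,
    ?_, ?_⟩
  · rw [abs_mul]
    exact mul_le_one₀ (H.abs_lp _) (abs_nonneg _) (abs_truncSign_le _ _)
  · rw [truncSign, cardInd]
    have h1 := H.abs_lp (T ∩ P)
    have h2 := H.abs_lm (T ∩ P)
    split_ifs with h3 h4
    · omega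
    · rw [mul_zero, sub_zero, abs_mul]
      simpa using h2
    · simpa using h1
    · simp
  · refine prod_inter_le h hT hD hY hQY (H.supp_lp _ inter_subset_right (left_ne_zero_of_mul h0)) ?_
    have := right_ne_zero_of_mul h0
    rw [truncSign] at this
    split_ifs at this with h1
    · omega
    · exact absurd rfl this
  · simp only [truncSign, cardInd] at h0
    split_ifs at h0 with h1 h2 h2
    · omega
    · rw [mul_zero, sub_zero] at h0
      exact prod_inter_le h hT hD hY hQY (H.supp_lm _ inter_subset_right (left_ne_zero_of_mul h0))
        h1.le
    · rw [mul_zero, zero_sub, neg_ne_zero] at h0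
      exact prod_inter_le h hT hD hY hQY (H.supp_lp _ inter_subset_right (left_ne_zero_of_mul h0))
        h2.le
    · simp at h0
  · rw [hempty S hS, sum_powerset_split h hS]
    have h1 := H.upper (S ∩ P) inter_subset_right
    have h2 := (hu (S ∩ Q)).1
    have h3 : (0 : ℝ) ≤ if S ∩ Q = ∅ then 1 else 0 := by split_ifs <;> norm_num
    have h4 : (0 : ℝ) ≤ if S ∩ P = ∅ then 1 else 0 := by split_ifs <;> norm_num
    exact mul_le_mul h1 h2 h3 (h4.trans h1)
  · rw [hempty S hS, sum_sub_distrib, sum_powerset_split h hS, sum_powerset_split h hS]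
    have h1 := H.upper (S ∩ P) inter_subset_right
    have h1' := H.lower (S ∩ P) inter_subset_right
    obtain ⟨h2, h2', h2''⟩ := hu (S ∩ Q)
    have h3 : (0 : ℝ) ≤ if S ∩ Q = ∅ then 1 else 0 := by split_ifs <;> norm_num
    split_ifs at h1 h1' with hc
    · rw [if_pos hc, one_mul]
      nlinarith
    · rw [if_neg hc, zero_mul]
      nlinarith
  · rw [subsetSum_union h, prod_union h]
    have h1 : 0 ≤ subsetSum (truncSign (b + 1)) g Q := by linarith
    calc _ ≤ ((1 + E) * ∏ p ∈ P, (1 - g p)) * ((1 + truncErr s b) * ∏ p ∈ Q, (1 - g p)) := by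
          gcongr
          · exact H.sum_lp
          · linarith
      _ = _ := by ring
  · have h1 : subsetSum (fun T ↦ lm (T ∩ P) * truncSign (b + 1) (T ∩ Q) -
        lp (T ∩ P) * cardInd (b + 1) (T ∩ Q)) g (P ∪ Q) =
        subsetSum lm g P * subsetSum (truncSign (b + 1)) g Q -
        subsetSum lp g P * subsetSum (cardInd (b + 1)) g Q := by
      rw [← subsetSum_union h, ← subsetSum_union h]
      simp only [subsetSum, ← sum_sub_distrib, sub_mul]
    rw [h1, prod_union h]
    have h2 : ∏ p ∈ Q, (1 - g p) ≤ subsetSum (truncSign (b + 1)) g Q := by linarith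
    have h3 : ((1 - E) * ∏ p ∈ P, (1 - g p)) * ∏ p ∈ Q, (1 - g p) ≤
        subsetSum lm g P * subsetSum (truncSign (b + 1)) g Q := by
      have h5 : 0 ≤ (1 - E) * ∏ p ∈ P, (1 - g p) := mul_nonneg (by linarith) hV1
      exact mul_le_mul H.sum_lm h2 hV2 (h5.trans H.sum_lm)
    have h4 : subsetSum lp g P * subsetSum (cardInd (b + 1)) g Q ≤
        ((1 + E) * ∏ p ∈ P, (1 - g p)) * (truncErr s b * ∏ p ∈ Q, (1 - g p)) := by
      have h5 : 0 ≤ (1 + E) * ∏ p ∈ P, (1 - g p) := mul_nonneg (by linarith) hV1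
      calc _ ≤ ((1 + E) * ∏ p ∈ P, (1 - g p)) * subsetSum (cardInd (b + 1)) g Q := by
            gcongr; exact H.sum_lp
        _ ≤ _ := by gcongr
    linarith

/-- The sieve estimate for a summable sequence `w`. -/
lemma SievePair.bound {P : Finset ℕ} {g : ℕ → ℝ} {D E : ℝ} {lp lm : Finset ℕ → ℝ}
    (H : SievePair P g D E lp lm) (hP : ∀ p ∈ P, p.Prime) (hD : 0 ≤ D)
    {w : ℕ → ℝ} (hw0 : ∀ n, 0 ≤ w n) (hw : Summable w) {M R : ℝ} (hM : 0 ≤ M) (hR : 0 ≤ R)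
    (hA : ∀ T ⊆ P, ∏ p ∈ T, (p : ℝ) ≤ D →
      |(∑' n, if ∀ p ∈ T, p ∣ n then w n else 0) - M * ∏ p ∈ T, g p| ≤ R) :
    |(∑' n, if ∀ p ∈ P, ¬ p ∣ n then w n else 0) - M * ∏ p ∈ P, (1 - g p)| ≤
      E * M * ∏ p ∈ P, (1 - g p) + D * R := by
  have hsum : ∀ (Q : ℕ → Prop) [DecidablePred Q],
      Summable fun n ↦ if Q n then w n else 0 := fun Q _ ↦
    Summable.of_nonneg_of_le (fun n ↦ by split_ifs <;> simp [hw0]) (fun n ↦ by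
      split_ifs; exacts [le_rfl, hw0 n]) hw
  have hcard : ∀ l : Finset ℕ → ℝ, (∀ T ⊆ P, l T ≠ 0 → ∏ p ∈ T, (p : ℝ) ≤ D) →
      ((P.powerset.filter fun T ↦ l T ≠ 0).card : ℝ) ≤ D := by
    intro l hl
    have : (P.powerset.filter fun T ↦ l T ≠ 0).card ≤ (Finset.Icc 1 ⌊D⌋₊).card := by
      refine card_le_card_of_injOn (fun T ↦ ∏ p ∈ T, p) ?_ ?_
      · intro T hT
        simp only [coe_filter, mem_powerset, Set.mem_ofPred_eq] at hT
        simp only [coe_Icc, Set.mem_Icc]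
        refine ⟨Nat.one_le_iff_ne_zero.2 (prod_ne_zero_iff.2 fun p hp ↦ (hP p (hT.1 hp)).ne_zero),
          Nat.le_floor ?_⟩
        push_cast
        exact hl T hT.1 hT.2
      · intro T₁ h₁ T₂ h₂ h12
        simp only [coe_filter, mem_powerset, Set.mem_ofPred_eq] at h₁ h₂ h12
        have key : ∀ T ⊆ P, (∏ p ∈ T, p).primeFactors = T := fun T hT ↦
          Nat.primeFactors_prod fun p hp ↦ hP p (hT hp)
        rw [← key T₁ h₁.1, h12, key T₂ h₂.1]
    rw [Nat.card_Icc] at this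
    refine le_trans ?_ (Nat.floor_le hD)
    exact_mod_cast this
  have hmain : ∀ l : Finset ℕ → ℝ, (∀ T, |l T| ≤ 1) →
      (∀ T ⊆ P, l T ≠ 0 → ∏ p ∈ T, (p : ℝ) ≤ D) →
      |(∑' n, w n * ∑ T ∈ (P.filter (· ∣ n)).powerset, l T) - M * subsetSum l g P| ≤ D * R ∧
      Summable fun n ↦ w n * ∑ T ∈ (P.filter (· ∣ n)).powerset, l T := by
    intro l hl1 hl2
    have e1 : ∀ n, w n * ∑ T ∈ (P.filter (· ∣ n)).powerset, l T =
        ∑ T ∈ P.powerset, l T * if ∀ p ∈ T, p ∣ n then w n else 0 := by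
      intro n
      have : (P.filter (· ∣ n)).powerset = P.powerset.filter fun T ↦ ∀ p ∈ T, p ∣ n := by
        ext T
        simp only [mem_powerset, mem_filter, subset_iff]
        exact ⟨fun h ↦ ⟨fun p hp ↦ (h hp).1, fun p hp ↦ (h hp).2⟩,
          fun h p hp ↦ ⟨h.1 hp, h.2 p hp⟩⟩
      rw [this, sum_filter, mul_sum]
      refine sum_congr rfl fun T _ ↦ ?_
      split_ifs <;> ring
    have hs' : ∀ T ∈ P.powerset, Summable fun n ↦ l T * if ∀ p ∈ T, p ∣ n then w n else 0 :=
      fun T _ ↦ (hsum _).mul_left _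
    simp only [e1]
    refine ⟨?_, summable_sum hs'⟩
    rw [Summable.tsum_finsetSum hs', subsetSum, mul_sum, ← sum_sub_distrib]
    have e2 : ∀ T ∈ P.powerset,
        |(∑' n, l T * if ∀ p ∈ T, p ∣ n then w n else 0) - M * (l T * ∏ p ∈ T, g p)| ≤
        if l T ≠ 0 then R else 0 := by
      intro T hT
      rw [tsum_mul_left, show ∀ a b c d : ℝ, a * b - c * (a * d) = a * (b - c * d) by intros; ring,
        abs_mul]
      split_ifs with h
      · calc _ ≤ 1 * R := by
              gcongr
              · exact hl1 T
              · exact hA T (mem_powerset.1 hT) (hl2 T (mem_powerset.1 hT) h)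
          _ = R := one_mul R
      · rw [not_not.1 h]; simp
    calc _ ≤ ∑ T ∈ P.powerset, (if l T ≠ 0 then R else 0) :=
          (abs_sum_le_sum_abs _ _).trans (sum_le_sum e2)
      _ = (P.powerset.filter fun T ↦ l T ≠ 0).card * R := by
          rw [← sum_filter, sum_const, nsmul_eq_mul]
      _ ≤ D * R := by gcongr; exact hcard l hl2
  have hind : ∀ n, (if ∀ p ∈ P, ¬ p ∣ n then w n else 0) =
      w n * if P.filter (· ∣ n) = ∅ then 1 else 0 := by
    intro n
    simp only [filter_eq_empty_iff]
    split_ifs <;> simp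
  obtain ⟨u1, u2⟩ := hmain lp H.abs_lp H.supp_lp
  obtain ⟨v1, v2⟩ := hmain lm H.abs_lm H.supp_lm
  have hup : (∑' n, if ∀ p ∈ P, ¬ p ∣ n then w n else 0) ≤
      ∑' n, w n * ∑ T ∈ (P.filter (· ∣ n)).powerset, lp T := by
    refine Summable.tsum_le_tsum (fun n ↦ ?_) (hsum _) u2
    rw [hind]
    exact mul_le_mul_of_nonneg_left (H.upper _ (filter_subset _ _)) (hw0 n)
  have hlow : ∑' n, w n * ∑ T ∈ (P.filter (· ∣ n)).powerset, lm T ≤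
      ∑' n, if ∀ p ∈ P, ¬ p ∣ n then w n else 0 := by
    refine Summable.tsum_le_tsum (fun n ↦ ?_) v2 (hsum _)
    rw [hind]
    exact mul_le_mul_of_nonneg_left (H.lower _ (filter_subset _ _)) (hw0 n)
  have h1 := mul_le_mul_of_nonneg_left H.sum_lp hM
  have h2 := mul_le_mul_of_nonneg_left H.sum_lm hM
  rw [abs_le] at u1 v1 ⊢
  constructor <;> linarith

end Linnik

namespace Linnik

open Finset
open scoped ArithmeticFunction.vonMangoldt

lemma log_four_add_four_le : Real.log 4 + 4 ≤ 5.4 := by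
  have : Real.log 4 = 2 * Real.log 2 := by
    rw [show (4 : ℝ) = 2 ^ 2 by norm_num, Real.log_pow]; norm_num
  linarith [Real.log_two_lt_d9]

/-- An upper bound of Mertens type. -/
lemma sum_vonMangoldt_div_le {N : ℕ} (hN : 1 ≤ N) :
    ∑ n ∈ Ioc 0 N, Λ n / n ≤ Real.log N + 5.4 := by
  have hN' : (0 : ℝ) < N := by exact_mod_cast hN
  have h1 := ArithmeticFunction.sum_Ioc_mul_zeta_eq_sum Λ N
  rw [ArithmeticFunction.vonMangoldt_mul_zeta] at h1
  have h2 : ∑ n ∈ Ioc 0 N, ArithmeticFunction.log n ≤ N * Real.log N := by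
    calc _ ≤ ∑ n ∈ Ioc 0 N, Real.log N := by
          refine sum_le_sum fun n hn ↦ ?_
          rw [mem_Ioc] at hn
          rw [ArithmeticFunction.log_apply]
          exact Real.log_le_log (by exact_mod_cast hn.1) (by exact_mod_cast hn.2)
      _ = _ := by simp
  have h3 : Chebyshev.psi N = ∑ n ∈ Ioc 0 N, Λ n := by simp [Chebyshev.psi]
  have h4 := Chebyshev.psi_le_const_mul_self (x := N) hN'.le
  have h5 : ∑ n ∈ Ioc 0 N, (N * (Λ n / n) - Λ n) ≤ ∑ n ∈ Ioc 0 N, Λ n * ((N / n : ℕ) : ℝ) := by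
    refine sum_le_sum fun n hn ↦ ?_
    rw [mem_Ioc] at hn
    have h6 : (N : ℝ) / n - 1 ≤ ((N / n : ℕ) : ℝ) := by
      have := Nat.lt_floor_add_one ((N : ℝ) / n)
      rw [Nat.floor_div_eq_div] at this
      linarith
    have := ArithmeticFunction.vonMangoldt_nonneg (n := n)
    calc _ = Λ n * ((N : ℝ) / n - 1) := by ring
      _ ≤ _ := by gcongr
  rw [sum_sub_distrib, ← mul_sum] at h5
  have h6 := log_four_add_four_le
  have h7 : N * ∑ n ∈ Ioc 0 N, Λ n / n ≤ N * (Real.log N + 5.4) := by nlinarith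
  exact le_of_mul_le_mul_left h7 hN'

lemma sum_inv_prime_block_le {w : ℕ} (hw : 54 ≤ Real.log w) {Q : Finset ℕ}
    (hQ : ∀ p ∈ Q, p.Prime ∧ w < p ∧ p ≤ w ^ 2) : ∑ p ∈ Q, 1 / (p : ℝ) ≤ 2.1 := by
  have hw1 : 1 ≤ w := by
    by_contra! h
    have : w = 0 := by omega
    rw [this] at hw; simp at hw; linarith
  have h1 := sum_vonMangoldt_div_le (N := w ^ 2) (Nat.one_le_pow _ _ hw1)
  have h2 : ∑ p ∈ Q, Λ p / p ≤ ∑ n ∈ Ioc 0 (w ^ 2), Λ n / n := by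
    refine sum_le_sum_of_subset_of_nonneg (fun p hp ↦ ?_) fun n _ _ ↦ ?_
    · exact mem_Ioc.2 ⟨(hQ p hp).1.pos, (hQ p hp).2.2⟩
    · have := ArithmeticFunction.vonMangoldt_nonneg (n := n)
      positivity
  have h3 : Real.log w * ∑ p ∈ Q, 1 / (p : ℝ) ≤ ∑ p ∈ Q, Λ p / p := by
    rw [mul_sum]
    refine sum_le_sum fun p hp ↦ ?_
    obtain ⟨a1, a2, a3⟩ := hQ p hp
    rw [ArithmeticFunction.vonMangoldt_apply_prime a1, mul_one_div]
    gcongr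
  push_cast at h1
  rw [Real.log_pow] at h1
  push_cast at h1
  nlinarith

/-- The primes up to `N` satisfying `good`. -/
noncomputable def sievePrimes (good : ℕ → Prop) (N : ℕ) : Finset ℕ :=
  open Classical in (range (N + 1)).filter fun p ↦ p.Prime ∧ good p

lemma mem_sievePrimes {good : ℕ → Prop} {N p : ℕ} :
    p ∈ sievePrimes good N ↔ p ≤ N ∧ p.Prime ∧ good p := by
  simp [sievePrimes]

lemma prod_sievePrimes_le (good : ℕ → Prop) (N : ℕ) :
    ∏ p ∈ sievePrimes good N, (p : ℝ) ≤ 4 ^ N := by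
  refine le_trans ?_ (show ((primorial N : ℕ) : ℝ) ≤ 4 ^ N by exact_mod_cast primorial_le_four_pow N)
  rw [primorial, ← Nat.cast_prod, Nat.cast_le]
  refine prod_le_prod_of_subset_of_one_le' (fun p hp ↦ ?_) fun p hp _ ↦ ?_
  · rw [mem_sievePrimes] at hp
    simp only [mem_filter, mem_range]
    exact ⟨by omega, hp.2.1⟩
  · exact (mem_filter.1 hp).2.one_le

lemma SievePair.mono {P : Finset ℕ} {g : ℕ → ℝ} {D E D' E' : ℝ} {lp lm : Finset ℕ → ℝ}
    (H : SievePair P g D E lp lm) (hP : ∀ p ∈ P, g p ≤ 1) (hD : D ≤ D') (hE : E ≤ E') :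
    SievePair P g D' E' lp lm := by
  have hV : 0 ≤ ∏ p ∈ P, (1 - g p) := prod_nonneg fun p hp ↦ by linarith [hP p hp]
  exact ⟨H.abs_lp, H.abs_lm, fun T hT h ↦ (H.supp_lp T hT h).trans hD,
    fun T hT h ↦ (H.supp_lm T hT h).trans hD, H.upper, H.lower,
    H.sum_lp.trans (by gcongr), le_trans (by gcongr) H.sum_lm⟩

lemma truncErr_add_two_le {b : ℕ} (hb : 12 ≤ b) : truncErr 4.2 (b + 2) ≤ truncErr 4.2 b / 8 := by
  have h1 : ((b + 2 + 1).factorial : ℝ) = (b + 3) * (b + 2) * (b + 1).factorial := by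
    rw [Nat.factorial_succ, Nat.factorial_succ]; push_cast; ring
  have h2 : (12 : ℝ) ≤ b := by exact_mod_cast hb
  rw [truncErr, truncErr, h1, div_div, div_le_div_iff₀ (by positivity) (by positivity)]
  have h3 : (4.2 : ℝ) ^ (b + 2 + 1) = 17.64 * 4.2 ^ (b + 1) := by ring
  rw [h3]
  have h4 : 17.64 * 8 ≤ ((b : ℝ) + 3) * (b + 2) := by nlinarith
  calc _ = (17.64 * 8) * (Real.exp (2 * 4.2) * 4.2 ^ (b + 1) * (b + 1).factorial) := by ring
    _ ≤ (((b : ℝ) + 3) * (b + 2)) * (Real.exp (2 * 4.2) * 4.2 ^ (b + 1) * (b + 1).factorial) := by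
      gcongr
    _ = _ := by ring

/-- The fundamental lemma of the sieve, for sieves of dimension at most two. -/
lemma exists_sievePair {y : ℕ} (hy : 54 ≤ Real.log y) {good : ℕ → Prop} {g : ℕ → ℝ}
    (hg : ∀ p : ℕ, p.Prime → good p → 0 ≤ g p ∧ g p ≤ 1 ∧ g p ≤ 2 / p) (t : ℕ) {b : ℕ}
    (hb : Even b) (hb' : 12 ≤ b) (hη : truncErr 4.2 b ≤ 1 / 2) :
    ∃ lp lm, SievePair (sievePrimes good (y ^ 2 ^ t)) g (4 ^ y * ((y : ℝ) ^ 2 ^ t) ^ (2 * b + 6))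
      (2 * truncErr 4.2 b) lp lm := by
  have hy4 : (4 : ℝ) ≤ y := by
    by_contra! h
    rcases Nat.eq_zero_or_pos y with rfl | h0
    · simp at hy; linarith
    · have := Real.log_le_sub_one_of_pos (x := y) (by exact_mod_cast h0)
      linarith
  have hpow : ∀ t : ℕ, 1 ≤ (y : ℝ) ^ 2 ^ t := fun t ↦ one_le_pow₀ (by linarith)
  have hη0 : ∀ b, 0 ≤ truncErr 4.2 b := fun b ↦ by unfold truncErr; positivity
  have hP : ∀ N, ∀ p ∈ sievePrimes good N, 0 ≤ g p ∧ g p ≤ 1 := fun N p hp ↦ by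
    have := mem_sievePrimes.1 hp
    exact ⟨(hg p this.2.1 this.2.2).1, (hg p this.2.1 this.2.2).2.1⟩
  induction t generalizing b with
  | zero =>
    refine ⟨_, _, (sievePair_base (P := sievePrimes good (y ^ 2 ^ 0)) (g := g)
      (D := 4 ^ y) (fun p hp ↦ (mem_sievePrimes.1 hp).2.1.one_le) ?_).mono
      (fun p hp ↦ (hP _ p hp).2) ?_ (by linarith [hη0 b])⟩
    · simpa using prod_sievePrimes_le good y
    · exact le_mul_of_one_le_right (by positivity) (one_le_pow₀ (hpow 0))
  | succ t ih =>
    have h8 := truncErr_add_two_le hb'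
    obtain ⟨lp, lm, H⟩ := ih (b := b + 2) (hb.add even_two) (by omega) (by linarith [hη0 b])
    set w := y ^ 2 ^ t with hw
    have hww : y ^ 2 ^ (t + 1) = w ^ 2 := by rw [hw, ← pow_mul, pow_succ]
    have hwR : (y : ℝ) ^ 2 ^ t = w := by rw [hw]; push_cast; rfl
    have hwR' : (y : ℝ) ^ 2 ^ (t + 1) = (w : ℝ) ^ 2 := by rw [← hwR, ← pow_mul, pow_succ]
    have hw1 : (1 : ℝ) ≤ w := by rw [← hwR]; exact hpow t
    have hyw : y ≤ w := Nat.le_self_pow (by positivity) y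
    have hlog : 54 ≤ Real.log w := hy.trans
      (Real.log_le_log (by linarith) (by exact_mod_cast hyw))
    have hle : w ≤ w ^ 2 := Nat.le_self_pow (by norm_num) w
    set Q := sievePrimes (fun p ↦ good p ∧ w < p) (w ^ 2) with hQ
    have hunion : sievePrimes good (w ^ 2) = sievePrimes good w ∪ Q := by
      ext p
      simp only [mem_union, mem_sievePrimes, hQ]
      constructor
      · rintro ⟨h1, h2, h3⟩
        rcases le_or_gt p w with h | h
        · exact Or.inl ⟨h, h2, h3⟩
        · exact Or.inr ⟨h1, h2, h3, h⟩
      · rintro (⟨h1, h2, h3⟩ | ⟨h1, h2, h3, h4⟩)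
        · exact ⟨h1.trans hle, h2, h3⟩
        · exact ⟨h1, h2, h3⟩
    have hdisj : Disjoint (sievePrimes good w) Q := by
      rw [disjoint_left]
      intro p h1 h2
      have := (mem_sievePrimes.1 h1).1
      have := (mem_sievePrimes.1 h2).2.2.2
      omega
    have hgQ : ∀ p ∈ Q, 0 ≤ g p ∧ g p ≤ 1 / 2 ∧ g p ≤ 2 * (1 / p) := by
      intro p hp
      obtain ⟨h1, h2, h3, h4⟩ := mem_sievePrimes.1 hp
      obtain ⟨h5, h6, h7⟩ := hg p h2 h3
      have h9 : (4 : ℝ) ≤ p := by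
        have : (y : ℝ) ≤ p := by exact_mod_cast hyw.trans h4.le
        linarith
      refine ⟨h5, h7.trans ?_, by rwa [mul_one_div]⟩
      rw [div_le_div_iff₀ (by linarith) (by norm_num)]
      linarith
    have hs : ∑ p ∈ Q, g p ≤ 4.2 := by
      have h1 := sum_inv_prime_block_le hlog (Q := Q) fun p hp ↦ by
        obtain ⟨h1, h2, h3, h4⟩ := mem_sievePrimes.1 hp
        exact ⟨h2, h4, h1⟩
      calc _ ≤ ∑ p ∈ Q, 2 * (1 / (p : ℝ)) := sum_le_sum fun p hp ↦ (hgQ p hp).2.2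
        _ = 2 * ∑ p ∈ Q, 1 / (p : ℝ) := by rw [mul_sum]
        _ ≤ _ := by linarith
    have H2 := H.step (b := b) (Y := (w : ℝ) ^ 2) hdisj hb (by positivity)
      (by linarith [hη0 (b + 2)]) (by linarith [hη0 b]) (hP w)
      (fun p hp ↦ ⟨(hgQ p hp).1, (hgQ p hp).2.1⟩) hs (one_le_pow₀ hw1)
      (fun p hp ↦ by exact_mod_cast (mem_sievePrimes.1 hp).1)
    rw [← hunion] at H2
    rw [hww, hwR']
    refine ⟨_, _, H2.mono (fun p hp ↦ (hP _ p hp).2) (le_of_eq ?_) ?_⟩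
    · rw [hwR, mul_assoc, ← pow_mul, ← pow_mul, ← pow_add]
      congr 2
      ring
    · nlinarith [hη0 b, hη0 (b + 2)]

end Linnik

namespace Linnik

open Finset Filter Topology

/-- The sum of a decreasing function along an arithmetic progression, compared with a primitive. -/
lemma hasSum_progression {f F : ℝ → ℝ} {N₀ : ℝ} (hf : ∀ t, N₀ ≤ t → 0 ≤ f t)
    (anti : AntitoneOn f (Set.Ici N₀)) (hF : ∀ t, N₀ ≤ t → HasDerivAt F (-f t) t)
    (hlim : Tendsto F atTop (𝓝 0)) {m : ℕ} (hm : 0 < m) {t : ℝ} (ht : N₀ ≤ t)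
    (ht' : t ≤ N₀ + m) :
    Summable (fun k : ℕ ↦ f (t + k * m)) ∧
      |∑' k : ℕ, f (t + k * m) - F N₀ / m| ≤ f N₀ := by
  have hm' : (0 : ℝ) < m := by exact_mod_cast hm
  have mvt : ∀ a b, N₀ ≤ a → a < b → (b - a) * f b ≤ F a - F b ∧ F a - F b ≤ (b - a) * f a := by
    intro a b ha hab
    obtain ⟨c, hc, hc'⟩ := exists_hasDerivAt_eq_slope F (fun t ↦ -f t) hab
      (fun x hx ↦ (hF x (ha.trans hx.1)).continuousAt.continuousWithinAt)
      (fun x hx ↦ hF x (ha.trans hx.1.le))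
    have h0 : F a - F b = (b - a) * f c := by
      have : b - a ≠ 0 := by linarith
      field_simp at hc'
      linarith
    have hca : N₀ ≤ c := ha.trans hc.1.le
    have h1 := anti (show c ∈ Set.Ici N₀ from hca)
      (show b ∈ Set.Ici N₀ from hca.trans hc.2.le) hc.2.le
    have h2 := anti (show a ∈ Set.Ici N₀ from ha) (show c ∈ Set.Ici N₀ from hca) hc.1.le
    rw [h0]
    have : 0 ≤ b - a := by linarith
    exact ⟨mul_le_mul_of_nonneg_left h1 this, mul_le_mul_of_nonneg_left h2 this⟩
  have hk : ∀ k : ℕ, N₀ ≤ t + k * m := fun k ↦ ht.trans (le_add_of_nonneg_right (by positivity))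
  have hstep : ∀ k : ℕ, m * f (t + (k + 1 : ℕ) * m) ≤ F (t + k * m) - F (t + (k + 1 : ℕ) * m) ∧
      F (t + k * m) - F (t + (k + 1 : ℕ) * m) ≤ m * f (t + k * m) := by
    intro k
    have h := mvt (t + k * m) (t + (k + 1 : ℕ) * m) (hk k) (by push_cast; nlinarith)
    have e : t + (k + 1 : ℕ) * (m : ℝ) - (t + k * m) = m := by push_cast; ring
    rwa [e] at h
  have hsum : HasSum (fun k : ℕ ↦ F (t + k * m) - F (t + (k + 1 : ℕ) * m)) (F t) := by
    rw [hasSum_iff_tendsto_nat_of_nonneg]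
    · have h1 : ∀ K : ℕ, ∑ k ∈ range K, (F (t + k * m) - F (t + (k + 1 : ℕ) * m))
          = F t - F (t + K * m) := by
        intro K
        rw [sum_range_sub' (fun k : ℕ ↦ F (t + k * m))]
        simp
      simp_rw [h1]
      have h2 : Tendsto (fun K : ℕ ↦ t + (K : ℝ) * m) atTop atTop :=
        tendsto_atTop_add_const_left _ _ (tendsto_natCast_atTop_atTop.atTop_mul_const hm')
      simpa using (hlim.comp h2).const_sub (F t)
    · intro k
      exact (mul_nonneg hm'.le (hf _ (hk (k + 1)))).trans (hstep k).1
  have hs1 : Summable (fun k : ℕ ↦ f (t + (k + 1 : ℕ) * m)) := by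
    refine Summable.of_nonneg_of_le (fun k ↦ hf _ (hk _)) (fun k ↦ ?_) (hsum.summable.div_const m)
    rw [le_div_iff₀ hm', mul_comm]
    exact (hstep k).1
  have hs : Summable (fun k : ℕ ↦ f (t + k * m)) := (summable_nat_add_iff 1).1 hs1
  refine ⟨hs, ?_⟩
  have hd : ∑' k : ℕ, (F (t + k * m) - F (t + (k + 1 : ℕ) * m)) / m = F t / m :=
    (hsum.div_const _).tsum_eq
  have lower : F t / m ≤ ∑' k : ℕ, f (t + k * m) := by
    rw [← hd]
    refine (hsum.summable.div_const _).tsum_le_tsum (fun k ↦ ?_) hs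
    rw [div_le_iff₀' hm']
    exact (hstep k).2
  have upper : ∑' k : ℕ, f (t + (k + 1 : ℕ) * m) ≤ F t / m := by
    rw [← hd]
    refine hs1.tsum_le_tsum (fun k ↦ ?_) (hsum.summable.div_const _)
    rw [le_div_iff₀ hm', mul_comm]
    exact (hstep k).1
  have split := hs.tsum_eq_zero_add
  simp only [Nat.cast_zero, zero_mul, add_zero] at split
  have h3 : 0 ≤ F N₀ - F t ∧ F N₀ - F t ≤ m * f N₀ := by
    rcases ht.eq_or_lt with rfl | h
    · simpa using mul_nonneg hm'.le (hf _ le_rfl)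
    · obtain ⟨h4, h5⟩ := mvt N₀ t le_rfl h
      refine ⟨(mul_nonneg (by linarith) (hf _ ht)).trans h4, h5.trans ?_⟩
      exact mul_le_mul_of_nonneg_right (by linarith) (hf _ le_rfl)
  have h6 : f t ≤ f N₀ := anti (Set.mem_Ici.2 le_rfl) (Set.mem_Ici.2 ht) ht
  have h7 : 0 ≤ (F N₀ - F t) / m ∧ (F N₀ - F t) / m ≤ f N₀ := by
    refine ⟨div_nonneg h3.1 hm'.le, ?_⟩
    rw [div_le_iff₀ hm', mul_comm]
    exact h3.2
  rw [sub_div] at h7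
  rw [abs_le]
  constructor <;> linarith [h7.1, h7.2]

/-- The sum of a decreasing function over a residue class. -/
lemma hasSum_residueClass {f F : ℝ → ℝ} {N₀ : ℕ} (hf : ∀ t : ℝ, N₀ ≤ t → 0 ≤ f t)
    (anti : AntitoneOn f (Set.Ici (N₀ : ℝ))) (hF : ∀ t : ℝ, N₀ ≤ t → HasDerivAt F (-f t) t)
    (hlim : Tendsto F atTop (𝓝 0)) {m : ℕ} (hm : 0 < m) (c : ℕ) :
    Summable (fun n : ℕ ↦ if N₀ < n ∧ n ≡ c [MOD m] then f n else 0) ∧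
      |∑' n : ℕ, (if N₀ < n ∧ n ≡ c [MOD m] then f n else 0) - F N₀ / m| ≤ f N₀ := by
  obtain ⟨n₀, h1, h2, h3⟩ : ∃ n₀, N₀ < n₀ ∧ n₀ ≤ N₀ + m ∧ n₀ ≡ c [MOD m] := by
    refine ⟨N₀ + 1 + (c + (m - 1) * (N₀ + 1)) % m, by omega, ?_, ?_⟩
    · have := Nat.mod_lt (c + (m - 1) * (N₀ + 1)) hm
      omega
    · have h4 : N₀ + 1 + (c + (m - 1) * (N₀ + 1)) = c + m * (N₀ + 1) := by
        obtain ⟨m', rfl⟩ : ∃ m', m = m' + 1 := ⟨m - 1, by omega⟩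
        simp only [Nat.add_sub_cancel]
        ring
      have h5 : N₀ + 1 + (c + (m - 1) * (N₀ + 1)) % m ≡ c + m * (N₀ + 1) [MOD m] := by
        rw [← h4]
        exact (Nat.mod_modEq _ _).add_left _
      exact h5.trans (by simp [Nat.ModEq])
  have hinj : Function.Injective (fun k : ℕ ↦ n₀ + k * m) := by
    intro a b hab
    simpa [hm.ne'] using hab
  have hsupp : ∀ n, n ∉ Set.range (fun k : ℕ ↦ n₀ + k * m) →
      (if N₀ < n ∧ n ≡ c [MOD m] then f n else 0) = 0 := by
    intro n hn
    rw [if_neg]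
    rintro ⟨h4, h5⟩
    apply hn
    have h6 : n₀ ≡ n [MOD m] := h3.trans h5.symm
    have h7 : n₀ ≤ n := by
      by_contra h8
      have := (Nat.modEq_iff_dvd' (by omega)).1 h6.symm
      exact absurd (Nat.le_of_dvd (by omega) this) (by omega)
    obtain ⟨k, hk⟩ := (Nat.modEq_iff_dvd' h7).1 h6
    exact ⟨k, by simp only; rw [mul_comm]; omega⟩
  have hval : (fun n : ℕ ↦ if N₀ < n ∧ n ≡ c [MOD m] then f n else 0) ∘ (fun k : ℕ ↦ n₀ + k * m)
      = fun k : ℕ ↦ f ((n₀ : ℝ) + k * m) := by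
    funext k
    have h4 : n₀ + k * m ≡ c [MOD m] := by simpa [Nat.ModEq] using h3
    have h5 : N₀ < n₀ + k * m := by omega
    simp [h4, h5]
  have h8 := hasSum_progression hf anti hF hlim hm (t := n₀) (by exact_mod_cast h1.le)
    (by exact_mod_cast h2)
  rw [← hinj.summable_iff hsupp, hval]
  rw [← hinj.tsum_eq (f := fun n : ℕ ↦ if N₀ < n ∧ n ≡ c [MOD m] then f n else 0)
    (fun n hn ↦ by by_contra h; exact hn (hsupp n h))]
  refine ⟨h8.1, ?_⟩
  have h9 : (∑' k : ℕ, (if N₀ < n₀ + k * m ∧ n₀ + k * m ≡ c [MOD m] then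
      f ((n₀ + k * m : ℕ) : ℝ) else 0)) = ∑' k : ℕ, f ((n₀ : ℝ) + k * m) := tsum_congr (congrFun hval)
  rw [h9]
  exact h8.2

lemma prod_dvd_iff {T : Finset ℕ} (hT : ∀ p ∈ T, p.Prime) (n : ℕ) :
    (∀ p ∈ T, p ∣ n) ↔ ∏ p ∈ T, p ∣ n := by
  refine ⟨fun h ↦ Finset.prod_primes_dvd n (fun p hp ↦ (hT p hp).prime) h, fun h p hp ↦ ?_⟩
  exact (Finset.dvd_prod_of_mem _ hp).trans h

/-- Sifting a residue class modulo `q`, with decreasing weights. -/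
lemma sifted_residueClass {f F : ℝ → ℝ} {N₀ : ℕ} (hf : ∀ t : ℝ, N₀ ≤ t → 0 ≤ f t)
    (anti : AntitoneOn f (Set.Ici (N₀ : ℝ))) (hF : ∀ t : ℝ, N₀ ≤ t → HasDerivAt F (-f t) t)
    (hlim : Tendsto F atTop (𝓝 0)) (hF0 : 0 ≤ F N₀) {q : ℕ} (hq : 0 < q) (a : ℕ)
    {D E : ℝ} {lp lm : Finset ℕ → ℝ} {N : ℕ} (hD : 0 ≤ D)
    (H : SievePair (sievePrimes (fun p ↦ ¬ p ∣ q) N) (fun p ↦ (p : ℝ)⁻¹) D E lp lm) :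
    |(∑' n : ℕ, if ∀ p ∈ sievePrimes (fun p ↦ ¬ p ∣ q) N, ¬ p ∣ n then
        (if N₀ < n ∧ n ≡ a [MOD q] then f n else 0) else 0)
        - F N₀ / q * ∏ p ∈ sievePrimes (fun p ↦ ¬ p ∣ q) N, (1 - (p : ℝ)⁻¹)|
      ≤ E * (F N₀ / q) * ∏ p ∈ sievePrimes (fun p ↦ ¬ p ∣ q) N, (1 - (p : ℝ)⁻¹) + D * f N₀ := by
  have hP : ∀ p ∈ sievePrimes (fun p ↦ ¬ p ∣ q) N, p.Prime := fun p hp ↦ (mem_sievePrimes.1 hp).2.1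
  refine H.bound hP hD (fun n ↦ ?_)
    (hasSum_residueClass hf anti hF hlim hq a).1 (by positivity) (hf _ le_rfl) ?_
  · split_ifs with h
    · exact hf _ (by exact_mod_cast h.1.le)
    · exact le_rfl
  · intro T hT _
    have hT' : ∀ p ∈ T, p.Prime := fun p hp ↦ hP p (hT hp)
    have hcop : Nat.Coprime q (∏ p ∈ T, p) := by
      refine Nat.Coprime.prod_right fun p hp ↦ ?_
      exact ((hT' p hp).coprime_iff_not_dvd.2 (mem_sievePrimes.1 (hT hp)).2.2).symm
    have hpos : 0 < ∏ p ∈ T, p := prod_pos fun p hp ↦ (hT' p hp).pos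
    obtain ⟨c, hc1, hc2⟩ := Nat.chineseRemainder hcop a 0
    have key := (hasSum_residueClass hf anti hF hlim (Nat.mul_pos hq hpos) c).2
    have h1 : ∀ n : ℕ, (if ∀ p ∈ T, p ∣ n then (if N₀ < n ∧ n ≡ a [MOD q] then f n else 0) else 0)
        = if N₀ < n ∧ n ≡ c [MOD q * ∏ p ∈ T, p] then f n else 0 := by
      intro n
      rw [← ite_and]
      refine if_congr ?_ rfl rfl
      rw [prod_dvd_iff hT', ← Nat.modEq_and_modEq_iff_modEq_mul hcop]
      have h2 : (∏ p ∈ T, p ∣ n) ↔ n ≡ c [MOD ∏ p ∈ T, p] := by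
        rw [← Nat.modEq_zero_iff_dvd]
        exact ⟨fun h ↦ h.trans hc2.symm, fun h ↦ h.trans hc2⟩
      have h3 : (n ≡ a [MOD q]) ↔ n ≡ c [MOD q] :=
        ⟨fun h ↦ h.trans hc1.symm, fun h ↦ h.trans hc1⟩
      rw [h2, h3]
      tauto
    have h4 : F N₀ / q * ∏ p ∈ T, (p : ℝ)⁻¹ = F N₀ / ((q * ∏ p ∈ T, p : ℕ) : ℝ) := by
      rw [prod_inv_distrib]
      push_cast
      rw [div_mul_eq_div_div, div_eq_mul_inv (F N₀ / q)]
    rw [tsum_congr h1, h4]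
    exact key

end Linnik

namespace Linnik

open Finset Filter Topology

/-- The weight `u ^ j e⁻ᵘ / (j! t)` with `u = log t / X`. -/
noncomputable def wt (X : ℝ) (j : ℕ) (t : ℝ) : ℝ :=
  (Real.log t / X) ^ j / j.factorial * Real.exp (-(Real.log t / X)) / t

/-- A primitive of `-wt X j`. -/
noncomputable def wtInt (X : ℝ) (j : ℕ) (t : ℝ) : ℝ :=
  X * (Real.exp (-(Real.log t / X)) *
    ∑ i ∈ range (j + 1), (Real.log t / X) ^ i / i.factorial)

variable {X : ℝ} {t : ℝ}

lemma wt_nonneg (hX : 0 < X) (ht : 1 ≤ t) (j : ℕ) : 0 ≤ wt X j t := by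
  have := Real.log_nonneg ht
  unfold wt
  positivity

lemma wt_le_inv (hX : 0 < X) (ht : 1 ≤ t) (j : ℕ) : wt X j t ≤ t⁻¹ := by
  have h0 : 0 ≤ Real.log t / X := div_nonneg (Real.log_nonneg ht) hX.le
  have h := Real.pow_div_factorial_le_exp _ h0 j
  unfold wt
  rw [div_eq_mul_inv _ t]
  refine mul_le_of_le_one_left (by positivity) ?_
  rw [Real.exp_neg, ← div_eq_mul_inv]
  exact div_le_one_of_le₀ h (Real.exp_pos _).le

lemma pow_mul_exp_neg_antitone {j : ℕ} {v w : ℝ} (hv : j ≤ v) (hvw : v ≤ w) :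
    w ^ j * Real.exp (-w) ≤ v ^ j * Real.exp (-v) := by
  rcases Nat.eq_zero_or_pos j with rfl | hj
  · simpa using hvw
  have hj' : (0 : ℝ) < j := by exact_mod_cast hj
  have hv0 : 0 < v := hj'.trans_le hv
  have h1 : (w / v) ^ j ≤ Real.exp (w - v) := by
    have h2 : w / v ≤ Real.exp ((w - v) / v) := by
      have := Real.add_one_le_exp ((w - v) / v)
      have e : (w - v) / v + 1 = w / v := by field_simp; ring
      rwa [e] at this
    calc (w / v) ^ j ≤ Real.exp ((w - v) / v) ^ j :=
          pow_le_pow_left₀ (div_nonneg (hv0.le.trans hvw) hv0.le) h2 j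
      _ = Real.exp (j * ((w - v) / v)) := (Real.exp_nat_mul _ _).symm
      _ ≤ Real.exp (w - v) := by
          apply Real.exp_le_exp.2
          rw [mul_div_assoc', div_le_iff₀ hv0, mul_comm]
          exact mul_le_mul_of_nonneg_left hv (by linarith)
  rw [div_pow, div_le_iff₀ (by positivity)] at h1
  calc w ^ j * Real.exp (-w) ≤ Real.exp (w - v) * v ^ j * Real.exp (-w) := by gcongr
    _ = v ^ j * (Real.exp (w - v) * Real.exp (-w)) := by ring
    _ = _ := by rw [← Real.exp_add]; ring_nf

lemma wt_antitoneOn (hX : 0 < X) {j : ℕ} {N₀ : ℝ} (hN : Real.exp j ≤ N₀) :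
    AntitoneOn (wt X j) (Set.Ici N₀) := by
  intro s hs t ht hst
  have hs0 : 0 < s := (Real.exp_pos _).trans_le (hN.trans hs)
  have hlog : Real.log s ≤ Real.log t := Real.log_le_log hs0 hst
  have hj : (j : ℝ) ≤ Real.log s := (Real.le_log_iff_exp_le hs0).2 (hN.trans hs)
  have key := pow_mul_exp_neg_antitone hj hlog
  have h0 : (0 : ℝ) ≤ j := j.cast_nonneg
  have e : ∀ x : ℝ, 0 < x → wt X j x = (Real.log x ^ j * Real.exp (-Real.log x)) *
      (Real.exp (-(Real.log x / X)) / (X ^ j * j.factorial)) := by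
    intro x hx
    rw [Real.exp_neg (Real.log x), Real.exp_log hx, wt, div_pow]
    field_simp
  rw [e s hs0, e t (hs0.trans_le hst)]
  refine mul_le_mul key ?_ (by positivity) ?_
  · gcongr
  · exact mul_nonneg (pow_nonneg (h0.trans hj) _) (Real.exp_pos _).le

lemma hasDerivAt_wtInt (hX : 0 < X) (ht : 0 < t) (j : ℕ) :
    HasDerivAt (wtInt X j) (-wt X j t) t := by
  have hu : HasDerivAt (fun t ↦ Real.log t / X) (t⁻¹ / X) t := (Real.hasDerivAt_log ht.ne').div_const X
  have hg : ∀ u : ℝ, HasDerivAt (fun u ↦ Real.exp (-u) * ∑ i ∈ range (j + 1), u ^ i / i.factorial)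
      (-(u ^ j / j.factorial * Real.exp (-u))) u := by
    intro u
    have h1 : HasDerivAt (fun u : ℝ ↦ Real.exp (-u)) (-Real.exp (-u)) u := by
      simpa using (hasDerivAt_neg u).exp
    induction j with
    | zero => simpa using h1
    | succ j ih =>
      have h2 : HasDerivAt (fun u : ℝ ↦ Real.exp (-u) * (u ^ (j + 1) / (j + 1).factorial))
          (-Real.exp (-u) * (u ^ (j + 1) / (j + 1).factorial) +
            Real.exp (-u) * (((j + 1 : ℕ) : ℝ) * u ^ j / (j + 1).factorial)) u := by
        refine h1.mul ?_
        simpa using (hasDerivAt_pow (j + 1) u).div_const ((j + 1).factorial : ℝ)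
      have h3 := ih.add h2
      have h4 : ((j + 1).factorial : ℝ) = (j + 1) * j.factorial := by
        rw [Nat.factorial_succ]; push_cast; ring
      have e1 : (fun u : ℝ ↦ Real.exp (-u) * ∑ i ∈ range (j + 1 + 1), u ^ i / i.factorial) =
          (fun u ↦ Real.exp (-u) * ∑ i ∈ range (j + 1), u ^ i / i.factorial) +
            fun u ↦ Real.exp (-u) * (u ^ (j + 1) / (j + 1).factorial) := by
        funext u
        simp only [Pi.add_apply]
        rw [sum_range_succ _ (j + 1)]
        ring
      rw [e1]
      refine h3.congr_deriv ?_
      rw [h4]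
      have := Nat.factorial_ne_zero j
      push_cast
      field_simp
      ring
  have h5 := ((hg (Real.log t / X)).comp t hu).const_mul X
  refine HasDerivAt.congr_deriv (f := wtInt X j) h5 ?_
  rw [wt]
  field_simp

lemma wtInt_nonneg (hX : 0 < X) (ht : 1 ≤ t) (j : ℕ) : 0 ≤ wtInt X j t := by
  have h0 : 0 ≤ Real.log t / X := div_nonneg (Real.log_nonneg ht) hX.le
  unfold wtInt
  positivity

lemma wtInt_le (hX : 0 < X) (ht : 1 ≤ t) (j : ℕ) : wtInt X j t ≤ X := by
  have h0 : 0 ≤ Real.log t / X := div_nonneg (Real.log_nonneg ht) hX.le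
  unfold wtInt
  refine mul_le_of_le_one_right hX.le ?_
  calc _ ≤ Real.exp (-(Real.log t / X)) * Real.exp (Real.log t / X) := by
        gcongr
        exact Real.sum_le_exp_of_nonneg h0 _
    _ = 1 := by rw [← Real.exp_add]; simp

lemma wtInt_le_tail (hX : 0 < X) (ht : 1 ≤ t) (j : ℕ) :
    wtInt X j t ≤ X * (2 ^ j * Real.exp (-(Real.log t / X / 2))) := by
  have h0 : 0 ≤ Real.log t / X := div_nonneg (Real.log_nonneg ht) hX.le
  unfold wtInt
  generalize Real.log t / X = u at h0 ⊢
  refine mul_le_mul_of_nonneg_left ?_ hX.le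
  calc _ ≤ Real.exp (-u) * ∑ i ∈ range (j + 1), 2 ^ j * ((u / 2) ^ i / i.factorial) := by
        refine mul_le_mul_of_nonneg_left (sum_le_sum fun i hi ↦ ?_) (Real.exp_pos _).le
        rw [mul_div_assoc']
        refine div_le_div_of_nonneg_right ?_ (by positivity)
        rw [div_pow, mul_div_assoc', le_div_iff₀ (by positivity), mul_comm]
        gcongr
        · norm_num
        · exact Nat.lt_succ_iff.1 (mem_range.1 hi)
    _ ≤ Real.exp (-u) * (2 ^ j * Real.exp (u / 2)) := by
        rw [← mul_sum]
        gcongr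
        exact Real.sum_le_exp_of_nonneg (by positivity) _
    _ = 2 ^ j * (Real.exp (-u) * Real.exp (u / 2)) := by ring
    _ = _ := by rw [← Real.exp_add, show -u + u / 2 = -(u / 2) by ring]

lemma tendsto_wtInt (hX : 0 < X) (j : ℕ) : Tendsto (wtInt X j) atTop (𝓝 0) := by
  have h1 : Tendsto (fun t ↦ X * (2 ^ j * Real.exp (-(Real.log t / X / 2)))) atTop
      (𝓝 (X * (2 ^ j * 0))) := by
    refine (Tendsto.const_mul _ ?_).const_mul _
    refine Real.tendsto_exp_neg_atTop_nhds_zero.comp ?_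
    exact (Real.tendsto_log_atTop.atTop_div_const hX).atTop_div_const two_pos
  rw [mul_zero, mul_zero] at h1
  refine squeeze_zero' ?_ ?_ h1
  · filter_upwards [eventually_ge_atTop 1] with t ht using wtInt_nonneg hX ht j
  · filter_upwards [eventually_ge_atTop 1] with t ht using wtInt_le_tail hX ht j

/-- The product in Mertens' theorem is at most `1 / log N`. -/
lemma prod_one_sub_inv_primesBelow_le {N : ℕ} (hN : 2 ≤ N) :
    ∏ p ∈ sievePrimes (fun _ ↦ True) N, (1 - (p : ℝ)⁻¹) ≤ (Real.log N)⁻¹ := by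
  have hlog : 0 < Real.log N := Real.log_pos (by exact_mod_cast hN)
  have hP : sievePrimes (fun _ ↦ True) N = (N + 1).primesBelow := by
    ext p
    simp [mem_sievePrimes, Nat.mem_primesBelow]
  let f : ℕ →* ℝ :=
    { toFun := fun n ↦ (n : ℝ)⁻¹
      map_one' := by simp
      map_mul' := fun a b ↦ by simp [mul_comm] }
  have hf : ∀ {p : ℕ}, p.Prime → ‖f p‖ < 1 := by
    intro p hp
    have : (1 : ℝ) < p := by exact_mod_cast hp.one_lt
    change ‖(p : ℝ)⁻¹‖ < 1
    rw [norm_inv, Real.norm_natCast]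
    exact inv_lt_one_of_one_lt₀ this
  obtain ⟨-, h2⟩ := EulerProduct.summable_and_hasSum_smoothNumbers_prod_primesBelow_geometric
    (fun {p} hp ↦ hf (p := p) hp) (N + 1)
  have hmem : ∀ n ∈ Icc 1 N, n ∈ Nat.smoothNumbers (N + 1) := by
    intro n hn
    rw [mem_Icc] at hn
    exact Nat.mem_smoothNumbers_of_lt (by omega) (by omega)
  have h4 : ∑ n ∈ Icc 1 N, (n : ℝ)⁻¹ ≤ ∏ p ∈ (N + 1).primesBelow, (1 - (p : ℝ)⁻¹)⁻¹ := by
    have h5 := sum_le_hasSum ((Icc 1 N).attach.map ⟨fun n ↦ (⟨n.1, hmem n.1 n.2⟩ :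
      Nat.smoothNumbers (N + 1)), fun a b h ↦ Subtype.ext (Subtype.mk.inj h)⟩)
      (fun n _ ↦ inv_nonneg.2 (Nat.cast_nonneg (n : ℕ))) h2
    rw [sum_map] at h5
    exact (sum_attach (Icc 1 N) (fun n ↦ (n : ℝ)⁻¹)).symm.le.trans h5
  have h6 : Real.log N ≤ ∑ n ∈ Icc 1 N, (n : ℝ)⁻¹ := by
    have h7 := log_add_one_le_harmonic N
    rw [harmonic_eq_sum_Icc] at h7
    push_cast at h7
    refine le_trans (Real.log_le_log (by positivity) ?_) h7
    linarith
  rw [hP, le_inv_comm₀ _ hlog, ← prod_inv_distrib]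
  · exact h6.trans h4
  · refine prod_pos fun p hp ↦ ?_
    have : (1 : ℝ) < p := by exact_mod_cast (Nat.mem_primesBelow.1 hp).2.one_lt
    exact sub_pos.2 (inv_lt_one_of_one_lt₀ this)

/-- The density of the integers sifted by the primes up to `N` not dividing `q`. -/
noncomputable def siftDensity (q N : ℕ) : ℝ :=
  ∏ p ∈ sievePrimes (fun p ↦ ¬ p ∣ q) N, (1 - (p : ℝ)⁻¹)

lemma one_sub_inv_nonneg {p : ℕ} (hp : p.Prime) : 0 ≤ 1 - (p : ℝ)⁻¹ := by
  have : (1 : ℝ) < p := by exact_mod_cast hp.one_lt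
  exact (sub_pos.2 (inv_lt_one_of_one_lt₀ this)).le

lemma siftDensity_nonneg (q N : ℕ) : 0 ≤ siftDensity q N :=
  prod_nonneg fun _ hp ↦ one_sub_inv_nonneg (mem_sievePrimes.1 hp).2.1

lemma siftDensity_div_le {q N : ℕ} (hq : 0 < q) (hN : 2 ≤ N) :
    siftDensity q N / q ≤ 1 / (q.totient * Real.log N) := by
  have hlog : 0 < Real.log N := Real.log_pos (by exact_mod_cast hN)
  have hφ : (0 : ℝ) < q.totient := by exact_mod_cast Nat.totient_pos.2 hq
  have hq' : (0 : ℝ) < q := by exact_mod_cast hq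
  have h1 : (q.totient : ℝ) = q * ∏ p ∈ q.primeFactors, (1 - (p : ℝ)⁻¹) := by
    have := Nat.totient_eq_mul_prod_factors q
    have h := congrArg (fun x : ℚ ↦ (x : ℝ)) this
    push_cast at h
    exact h
  have hdisj : Disjoint (sievePrimes (fun p ↦ ¬ p ∣ q) N) q.primeFactors := by
    rw [Finset.disjoint_left]
    intro p hp hp'
    exact (mem_sievePrimes.1 hp).2.2 (Nat.dvd_of_mem_primeFactors hp')
  have h2 : siftDensity q N * ∏ p ∈ q.primeFactors, (1 - (p : ℝ)⁻¹) ≤ (Real.log N)⁻¹ := by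
    rw [siftDensity, ← prod_union hdisj]
    refine le_trans ?_ (prod_one_sub_inv_primesBelow_le hN)
    have hsub : sievePrimes (fun _ ↦ True) N ⊆ sievePrimes (fun p ↦ ¬ p ∣ q) N ∪ q.primeFactors := by
      intro p hp
      obtain ⟨h3, h4, -⟩ := mem_sievePrimes.1 hp
      rw [mem_union, mem_sievePrimes, Nat.mem_primeFactors]
      by_cases h5 : p ∣ q
      · exact Or.inr ⟨h4, h5, hq.ne'⟩
      · exact Or.inl ⟨h3, h4, h5⟩
    have hprime : ∀ p ∈ sievePrimes (fun p ↦ ¬ p ∣ q) N ∪ q.primeFactors, p.Prime := by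
      intro p hp
      rcases mem_union.1 hp with h | h
      · exact (mem_sievePrimes.1 h).2.1
      · exact Nat.prime_of_mem_primeFactors h
    rw [← prod_sdiff hsub]
    refine mul_le_of_le_one_left (prod_nonneg fun p hp ↦ one_sub_inv_nonneg
      (hprime p (hsub hp))) (prod_le_one (fun p hp ↦ one_sub_inv_nonneg
      (hprime p (mem_sdiff.1 hp).1)) fun p _ ↦ ?_)
    have : (0 : ℝ) ≤ (p : ℝ)⁻¹ := by positivity
    linarith
  rw [div_le_div_iff₀ hq' (by positivity), h1]
  calc _ = q * Real.log N * (siftDensity q N * ∏ p ∈ q.primeFactors, (1 - (p : ℝ)⁻¹)) := by ring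
    _ ≤ q * Real.log N * (Real.log N)⁻¹ := by gcongr
    _ = 1 * q := by field_simp

end Linnik

namespace Linnik

open Finset Filter Topology

/-- All prime factors of `n` exceed `z`. -/
def IsRough (z n : ℕ) : Prop := n ≠ 0 ∧ ∀ p, p.Prime → p ∣ n → z < p

open Classical in
/-- The indicator function of the integers all of whose prime factors exceed `z`. -/
noncomputable def rho (z n : ℕ) : ℝ := if IsRough z n then 1 else 0

lemma rho_of_isRough {z n : ℕ} (h : IsRough z n) : rho z n = 1 := if_pos h

lemma rho_of_not {z n : ℕ} (h : ¬ IsRough z n) : rho z n = 0 := if_neg h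

lemma rho_eq_zero_or_one (z n : ℕ) : rho z n = 0 ∨ rho z n = 1 := by
  by_cases h : IsRough z n
  exacts [Or.inr (rho_of_isRough h), Or.inl (rho_of_not h)]

lemma rho_nonneg (z n : ℕ) : 0 ≤ rho z n := by
  rcases rho_eq_zero_or_one z n with h | h <;> simp [h]

lemma rho_le_one (z n : ℕ) : rho z n ≤ 1 := by
  rcases rho_eq_zero_or_one z n with h | h <;> simp [h]

lemma rho_zero (z : ℕ) : rho z 0 = 0 := rho_of_not fun h ↦ h.1 rfl

lemma rho_one (z : ℕ) : rho z 1 = 1 :=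
  rho_of_isRough ⟨one_ne_zero, fun _ hp h ↦ absurd (Nat.dvd_one.1 h) hp.one_lt.ne'⟩

lemma isRough_mul {z m n : ℕ} : IsRough z (m * n) ↔ IsRough z m ∧ IsRough z n := by
  constructor
  · rintro ⟨h0, h⟩
    exact ⟨⟨left_ne_zero_of_mul h0, fun p hp hd ↦ h p hp (hd.mul_right n)⟩,
      ⟨right_ne_zero_of_mul h0, fun p hp hd ↦ h p hp (hd.mul_left m)⟩⟩
  · rintro ⟨⟨h1, h2⟩, h3, h4⟩
    refine ⟨mul_ne_zero h1 h3, fun p hp hd ↦ ?_⟩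
    rcases hp.dvd_mul.1 hd with h | h
    exacts [h2 p hp h, h4 p hp h]

lemma rho_mul (z m n : ℕ) : rho z (m * n) = rho z m * rho z n := by
  by_cases h1 : IsRough z m <;> by_cases h2 : IsRough z n <;>
    simp [rho, isRough_mul, h1, h2]

lemma rho_antitone {w z : ℕ} (h : w ≤ z) (n : ℕ) : rho z n ≤ rho w n := by
  by_cases h1 : IsRough z n
  · rw [rho_of_isRough h1, rho_of_isRough ⟨h1.1, fun p hp hd ↦ h.trans_lt (h1.2 p hp hd)⟩]
  · rw [rho_of_not h1]
    exact rho_nonneg w n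

lemma rho_eq_zero {z n : ℕ} (h1 : 1 < n) (h2 : n ≤ z) : rho z n = 0 := by
  refine rho_of_not ?_
  rintro ⟨-, h⟩
  obtain ⟨p, hp, hd⟩ := Nat.exists_prime_and_dvd h1.ne'
  exact absurd (h p hp hd) (not_lt.2 ((Nat.le_of_dvd (by omega) hd).trans h2))

/-- A weighted sum over the `z`-rough integers beyond `N₀` in a residue class. -/
noncomputable def roughSum (q : ℕ) (X : ℝ) (z N₀ j : ℕ) (a : ZMod q) : ℝ :=
  ∑' n : ℕ, if N₀ < n ∧ (n : ZMod q) = a then rho z n * wt X j n else 0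

variable {q : ℕ} {X : ℝ}

lemma summable_wt_class [NeZero q] (hX : 0 < X) {N₀ j : ℕ} (hN : Real.exp j ≤ N₀) (a : ZMod q) :
    Summable (fun n : ℕ ↦ if N₀ < n ∧ (n : ZMod q) = a then wt X j n else 0) := by
  have hN1 : (1 : ℝ) ≤ N₀ := (Real.one_le_exp (Nat.cast_nonneg j)).trans hN
  have h := (hasSum_residueClass (fun t ht ↦ wt_nonneg hX (hN1.trans ht) j) (wt_antitoneOn hX hN)
    (fun t ht ↦ hasDerivAt_wtInt hX (by linarith) j) (tendsto_wtInt hX j)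
    (Nat.pos_of_neZero q) a.val).1
  refine h.congr fun n ↦ if_congr ?_ rfl rfl
  rw [← ZMod.natCast_eq_natCast_iff, ZMod.natCast_zmod_val]

lemma rho_mul_wt_nonneg (hX : 0 < X) (z j n : ℕ) : 0 ≤ rho z n * wt X j n := by
  rcases Nat.eq_zero_or_pos n with rfl | h
  · simp [rho_zero]
  · exact mul_nonneg (rho_nonneg _ _) (wt_nonneg hX (by exact_mod_cast h) j)

lemma summable_rough [NeZero q] (hX : 0 < X) {N₀ j : ℕ} (hN : Real.exp j ≤ N₀) (z : ℕ)
    (a : ZMod q) :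
    Summable (fun n : ℕ ↦ if N₀ < n ∧ (n : ZMod q) = a then rho z n * wt X j n else 0) := by
  refine (summable_wt_class hX hN a).of_nonneg_of_le (fun n ↦ ?_) fun n ↦ ?_
  · split_ifs
    exacts [rho_mul_wt_nonneg hX z j n, le_rfl]
  · split_ifs with h
    · exact mul_le_of_le_one_left (wt_nonneg hX (by exact_mod_cast Nat.one_le_of_lt h.1) j)
        (rho_le_one z n)
    · exact le_rfl

lemma roughSum_nonneg (hX : 0 < X) (z N₀ j : ℕ) (a : ZMod q) : 0 ≤ roughSum q X z N₀ j a := by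
  refine tsum_nonneg fun n ↦ ?_
  split_ifs
  exacts [rho_mul_wt_nonneg hX z j n, le_rfl]

lemma roughSum_antitone [NeZero q] (hX : 0 < X) {w z N₀ j : ℕ} (h : w ≤ z)
    (hN : Real.exp j ≤ N₀) (a : ZMod q) : roughSum q X z N₀ j a ≤ roughSum q X w N₀ j a := by
  refine (summable_rough hX hN z a).tsum_le_tsum (fun n ↦ ?_) (summable_rough hX hN w a)
  split_ifs with h1
  · exact mul_le_mul_of_nonneg_right (rho_antitone h n)
      (wt_nonneg hX (by exact_mod_cast Nat.one_le_of_lt h1.1) j)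
  · exact le_rfl

lemma isRough_iff_of_isUnit [NeZero q] {a : ZMod q} (ha : IsUnit a) {z n : ℕ} (hn0 : n ≠ 0)
    (hn : (n : ZMod q) = a) :
    IsRough z n ↔ ∀ p ∈ sievePrimes (fun p ↦ ¬ p ∣ q) z, ¬ p ∣ n := by
  have hcop : Nat.Coprime n q := (ZMod.isUnit_iff_coprime n q).1 (hn ▸ ha)
  constructor
  · rintro ⟨-, h⟩ p hp hd
    obtain ⟨h1, h2, -⟩ := mem_sievePrimes.1 hp
    exact absurd (h p h2 hd) (not_lt.2 h1)
  · intro h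
    refine ⟨hn0, fun p hp hd ↦ ?_⟩
    by_contra hpz
    refine h p (mem_sievePrimes.2 ⟨not_lt.1 hpz, hp, fun hq ↦ ?_⟩) hd
    exact hp.one_lt.ne' (Nat.dvd_one.1 (hcop ▸ Nat.dvd_gcd hd hq))

lemma roughSum_approx [NeZero q] (hX : 0 < X) {N₀ j z : ℕ} (hN : Real.exp j ≤ N₀)
    {a : ZMod q} (ha : IsUnit a) {D E : ℝ} {lp lm : Finset ℕ → ℝ} (hD : 0 ≤ D)
    (H : SievePair (sievePrimes (fun p ↦ ¬ p ∣ q) z) (fun p ↦ (p : ℝ)⁻¹) D E lp lm) :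
    |roughSum q X z N₀ j a - wtInt X j N₀ * (siftDensity q z / q)|
      ≤ E * (wtInt X j N₀ * (siftDensity q z / q)) + D * wt X j N₀ := by
  have hN1 : (1 : ℝ) ≤ N₀ := (Real.one_le_exp (Nat.cast_nonneg j)).trans hN
  have h := sifted_residueClass (fun t ht ↦ wt_nonneg hX (hN1.trans ht) j) (wt_antitoneOn hX hN)
    (fun t ht ↦ hasDerivAt_wtInt hX (by linarith) j) (tendsto_wtInt hX j)
    (wtInt_nonneg hX hN1 j) (Nat.pos_of_neZero q) a.val hD H
  have e : roughSum q X z N₀ j a = ∑' n : ℕ, if ∀ p ∈ sievePrimes (fun p ↦ ¬ p ∣ q) z, ¬ p ∣ n then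
        (if N₀ < n ∧ n ≡ a.val [MOD q] then wt X j n else 0) else 0 := by
    refine tsum_congr fun n ↦ ?_
    have hiff : n ≡ a.val [MOD q] ↔ (n : ZMod q) = a := by
      rw [← ZMod.natCast_eq_natCast_iff, ZMod.natCast_zmod_val]
    simp only [hiff]
    by_cases hn : N₀ < n ∧ (n : ZMod q) = a
    · rw [if_pos hn, if_pos hn]
      have h1 := isRough_iff_of_isUnit (z := z) ha (Nat.ne_zero_of_lt hn.1) hn.2
      by_cases h2 : IsRough z n
      · rw [rho_of_isRough h2, if_pos (h1.1 h2), one_mul]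
      · rw [rho_of_not h2, if_neg (h1.not.1 h2), zero_mul]
    · rw [if_neg hn, if_neg hn, ite_self]
  rw [e]
  have e2 : wtInt X j N₀ * (siftDensity q z / q) = wtInt X j N₀ / q *
      ∏ p ∈ sievePrimes (fun p ↦ ¬ p ∣ q) z, (1 - (p : ℝ)⁻¹) := by
    rw [siftDensity]; ring
  rw [e2]
  refine h.trans (le_of_eq ?_)
  ring

lemma roughSum_eq_of_le {z : ℕ} (hz : 1 ≤ z) (j : ℕ) (a : ZMod q) :
    roughSum q X z 1 j a = roughSum q X z z j a := by
  refine tsum_congr fun n ↦ ?_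
  by_cases h : z < n
  · simp [h, hz.trans_lt h]
  · by_cases h1 : 1 < n
    · simp [h1, h, rho_eq_zero h1 (not_lt.1 h)]
    · simp [h1, h]

lemma truncErr_forty_four_le : 2 * truncErr 4.2 44 ≤ 1 / 10 ^ 23 := by
  have h1 : Real.exp (2 * 4.2) ≤ 3 ^ 9 := by
    calc Real.exp (2 * 4.2) ≤ Real.exp ((9 : ℕ) * 1) := Real.exp_le_exp.2 (by norm_num)
      _ = Real.exp 1 ^ 9 := Real.exp_nat_mul _ _
      _ ≤ 3 ^ 9 := by gcongr; exact Real.exp_one_lt_three.le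
  unfold truncErr
  calc _ ≤ 2 * (3 ^ 9 * (4.2 : ℝ) ^ (44 + 1) / (44 + 1).factorial) := by gcongr
    _ ≤ _ := by
      norm_num [Nat.factorial]

/-- The admissible choices of the sieve parameters for the modulus `q`. -/
structure Params (q y t : ℕ) : Prop where
  log_y : 54 ≤ Real.log y
  four_pow_le : 4 ^ y ≤ q
  seven_le : 7 ≤ t
  pow_le : q ^ 50 ≤ y ^ 2 ^ t
  le_pow : y ^ 2 ^ t ≤ q ^ 100

end Linnik

namespace Linnik

open Finset Filter Topology

namespace Params

variable {q y t : ℕ}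

lemma y_ge (H : Params q y t) : 55 ≤ y := by
  have h0 : (0 : ℝ) < y := by
    rcases Nat.eq_zero_or_pos y with h | h
    · have := H.log_y
      rw [h] at this
      norm_num at this
    · exact_mod_cast h
  have h1 := Real.log_le_sub_one_of_pos h0
  have h2 := H.log_y
  have : (55 : ℝ) ≤ y := by linarith
  exact_mod_cast this

lemma q_ge (H : Params q y t) : 10 ^ 30 ≤ q :=
  (show 10 ^ 30 ≤ 4 ^ 55 by norm_num).trans ((Nat.pow_le_pow_right (by norm_num) H.y_ge).trans
    H.four_pow_le)

lemma q_pos (H : Params q y t) : 0 < q := lt_of_lt_of_le (by norm_num) H.q_ge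

lemma q_le_z (H : Params q y t) : q ≤ y ^ 2 ^ t :=
  (Nat.le_self_pow (by norm_num) q).trans H.pow_le

lemma exp_le (H : Params q y t) {j : ℕ} (hj : j ≤ 61) : Real.exp j ≤ q := by
  have h1 : Real.exp j ≤ 3 ^ 61 := by
    calc Real.exp j ≤ Real.exp ((61 : ℕ) * 1) := Real.exp_le_exp.2 (by rw [mul_one]; exact_mod_cast hj)
      _ = Real.exp 1 ^ 61 := Real.exp_nat_mul _ _
      _ ≤ 3 ^ 61 := by gcongr; exact Real.exp_one_lt_three.le
  have h2 : ((10 ^ 30 : ℕ) : ℝ) ≤ q := by exact_mod_cast H.q_ge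
  push_cast at h2
  exact h1.trans (le_trans (by norm_num) h2)

lemma log_q_pos (H : Params q y t) : 0 < Real.log q :=
  Real.log_pos (by exact_mod_cast lt_of_lt_of_le (by norm_num) H.q_ge)

lemma log_z_ge (H : Params q y t) : 50 * Real.log q ≤ Real.log (y ^ 2 ^ t : ℕ) := by
  have h : ((q ^ 50 : ℕ) : ℝ) ≤ (y ^ 2 ^ t : ℕ) := by exact_mod_cast H.pow_le
  have h0 : (0 : ℝ) < q := by exact_mod_cast H.q_pos
  calc _ = Real.log ((q ^ 50 : ℕ) : ℝ) := by push_cast; rw [Real.log_pow]; norm_num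
    _ ≤ _ := Real.log_le_log (by push_cast; positivity) h

lemma log_z_le (H : Params q y t) : Real.log (y ^ 2 ^ t : ℕ) ≤ 100 * Real.log q := by
  have h : ((y ^ 2 ^ t : ℕ) : ℝ) ≤ (q ^ 100 : ℕ) := by exact_mod_cast H.le_pow
  have h0 : (0 : ℝ) < (y ^ 2 ^ t : ℕ) := by exact_mod_cast H.q_pos.trans_le H.q_le_z
  calc _ ≤ Real.log ((q ^ 100 : ℕ) : ℝ) := Real.log_le_log h0 h
    _ = _ := by push_cast; rw [Real.log_pow]; norm_num

lemma log_z_pos (H : Params q y t) : 0 < Real.log (y ^ 2 ^ t : ℕ) :=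
  lt_of_lt_of_le (by have := H.log_q_pos; positivity) H.log_z_ge

lemma z_eq (H : Params q y t) : (y ^ 2 ^ (t - 7)) ^ 128 = y ^ 2 ^ t := by
  have h : 2 ^ t = 2 ^ (t - 7) * 128 := by
    rw [show (128 : ℕ) = 2 ^ 7 by norm_num, ← pow_add, Nat.sub_add_cancel H.seven_le]
  rw [h, pow_mul]

lemma q_le_pow_three (H : Params q y t) : q ≤ (y ^ 2 ^ (t - 7)) ^ 3 := by
  have h1 : q ^ 128 ≤ ((y ^ 2 ^ (t - 7)) ^ 3) ^ 128 := by
    rw [← pow_mul, mul_comm 3, pow_mul, H.z_eq]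
    calc q ^ 128 ≤ q ^ 150 := Nat.pow_le_pow_right H.q_pos (by norm_num)
      _ = (q ^ 50) ^ 3 := by rw [← pow_mul]
      _ ≤ _ := Nat.pow_le_pow_left H.pow_le 3
  exact (Nat.pow_le_pow_iff_left (by norm_num)).1 h1

/-- The scale attached to the parameters. -/
noncomputable def scale (y t : ℕ) : ℝ := 1024 * Real.log (y ^ 2 ^ t : ℕ)

lemma scale_pos (H : Params q y t) : 0 < scale y t := mul_pos (by norm_num) H.log_z_pos

lemma hg (p : ℕ) (hp : p.Prime) (_ : ¬ p ∣ q) :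
    0 ≤ (p : ℝ)⁻¹ ∧ (p : ℝ)⁻¹ ≤ 1 ∧ (p : ℝ)⁻¹ ≤ 2 / p := by
  have h : (1 : ℝ) ≤ p := by exact_mod_cast hp.one_lt.le
  refine ⟨by positivity, inv_le_one_of_one_le₀ h, ?_⟩
  rw [div_eq_mul_inv]
  have : (0 : ℝ) ≤ (p : ℝ)⁻¹ := by positivity
  linarith

lemma exists_pair (H : Params q y t) (s : ℕ) :
    ∃ lp lm, SievePair (sievePrimes (fun p ↦ ¬ p ∣ q) (y ^ 2 ^ s)) (fun p ↦ (p : ℝ)⁻¹)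
      (4 ^ y * ((y : ℝ) ^ 2 ^ s) ^ 94) (2 * truncErr 4.2 44) lp lm :=
  exists_sievePair H.log_y hg s (b := 44) (by decide) (by norm_num)
    (by linarith [truncErr_forty_four_le, show (1 : ℝ) / 10 ^ 23 ≤ 1 by norm_num])

/-- An upper bound for sums over rough numbers. -/
lemma roughSum_le (H : Params q y t) [NeZero q] {N₀ j : ℕ} (hN : y ^ 2 ^ t ≤ N₀) (hj : j ≤ 61)
    {a : ZMod q} (ha : IsUnit a) :
    roughSum q (scale y t) (y ^ 2 ^ t) N₀ j a ≤
      131073 * (wtInt (scale y t) j N₀ / scale y t) / q.totient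
        + ((y ^ 2 ^ t : ℕ) : ℝ) / N₀ / q ^ 10 := by
  set w := y ^ 2 ^ (t - 7) with hw
  set X := scale y t with hXdef
  have hX : 0 < X := H.scale_pos
  have hy0 : 0 < y := lt_of_lt_of_le (by norm_num) H.y_ge
  have hqN : (q : ℝ) ≤ N₀ := by exact_mod_cast H.q_le_z.trans hN
  have hexp : Real.exp j ≤ N₀ := (H.exp_le hj).trans hqN
  have hN1 : (1 : ℝ) ≤ N₀ := (Real.one_le_exp (Nat.cast_nonneg j)).trans hexp
  have hw2 : 2 ≤ w := by
    have h1 : y ≤ w := Nat.le_self_pow (by positivity) y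
    exact le_trans (by norm_num) (H.y_ge.trans h1)
  have hwz : w ≤ y ^ 2 ^ t := by rw [← H.z_eq]; exact Nat.le_self_pow (by norm_num) w
  obtain ⟨lp, lm, hpair⟩ := H.exists_pair (t - 7)
  have h1 := roughSum_approx hX hexp ha (by positivity) hpair
  have h2 := roughSum_antitone (q := q) hX hwz hexp a
  have hφ : (0 : ℝ) < q.totient := by exact_mod_cast Nat.totient_pos.2 H.q_pos
  have hlogw : Real.log (y ^ 2 ^ t : ℕ) = 128 * Real.log w := by
    rw [show y ^ 2 ^ t = w ^ 128 from H.z_eq.symm, Nat.cast_pow w 128, Real.log_pow, Nat.cast_ofNat]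
  have hlw : 0 < Real.log w := Real.log_pos (by exact_mod_cast hw2)
  have hV : siftDensity q w / q ≤ 131072 / (X * q.totient) := by
    refine (siftDensity_div_le H.q_pos hw2).trans (le_of_eq ?_)
    rw [hXdef, scale, hlogw]
    field_simp
    norm_num
  have hW := wtInt_nonneg hX hN1 j
  have hE := truncErr_forty_four_le
  have h3 : 4 ^ y * ((y : ℝ) ^ 2 ^ (t - 7)) ^ 94 * wt X j N₀ ≤ ((y ^ 2 ^ t : ℕ) : ℝ) / N₀ / q ^ 10 := by
    have hnat : 4 ^ y * w ^ 94 * q ^ 10 ≤ y ^ 2 ^ t := by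
      calc 4 ^ y * w ^ 94 * q ^ 10 ≤ q * w ^ 94 * q ^ 10 := by gcongr; exact H.four_pow_le
        _ = q ^ 11 * w ^ 94 := by ring
        _ ≤ (w ^ 3) ^ 11 * w ^ 94 := by gcongr; exact H.q_le_pow_three
        _ = w ^ 127 := by ring
        _ ≤ w ^ 128 := Nat.pow_le_pow_right (by omega) (by norm_num)
        _ = _ := H.z_eq
    have hnat' : (4 : ℝ) ^ y * ((y : ℝ) ^ 2 ^ (t - 7)) ^ 94 * q ^ 10 ≤ (y ^ 2 ^ t : ℕ) := by
      exact_mod_cast hnat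
    have hq0 : (0 : ℝ) < q := by exact_mod_cast H.q_pos
    calc _ ≤ 4 ^ y * ((y : ℝ) ^ 2 ^ (t - 7)) ^ 94 * (N₀ : ℝ)⁻¹ := by
          gcongr
          exact wt_le_inv hX hN1 j
      _ ≤ _ := by
          rw [le_div_iff₀ (by positivity), le_div_iff₀ (by positivity)]
          calc _ = (4 : ℝ) ^ y * ((y : ℝ) ^ 2 ^ (t - 7)) ^ 94 * q ^ 10 := by field_simp
            _ ≤ _ := hnat'
  have h4 : wtInt X j N₀ * (siftDensity q w / q) ≤ 131072 * (wtInt X j N₀ / X) / q.totient := by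
    calc _ ≤ wtInt X j N₀ * (131072 / (X * q.totient)) := by gcongr
      _ = _ := by field_simp
  have h5 : 0 ≤ wtInt X j N₀ / X / q.totient := by positivity
  have h6 : 2 * truncErr 4.2 44 * (wtInt X j N₀ * (siftDensity q w / q)) ≤
      1 / 10 ^ 23 * (131072 * (wtInt X j N₀ / X) / q.totient) := by
    refine mul_le_mul hE h4 (mul_nonneg hW (div_nonneg (siftDensity_nonneg _ _) (by positivity)))
      (by positivity)
  have h7 := (abs_le.1 h1).2
  have e1 : 131072 * (wtInt X j N₀ / X) / q.totient = 131072 * (wtInt X j N₀ / X / q.totient) := by ring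
  have e2 : 131073 * (wtInt X j N₀ / X) / q.totient = 131073 * (wtInt X j N₀ / X / q.totient) := by ring
  rw [e1] at h4 h6
  rw [e2]
  generalize wtInt X j N₀ / X / q.totient = A at *
  linarith

lemma inv_pow_le (H : Params q y t) : (1 : ℝ) / q ^ 10 ≤ 1 / 10 ^ 30 / q.totient := by
  have hφ : (0 : ℝ) < q.totient := by exact_mod_cast Nat.totient_pos.2 H.q_pos
  have hφq : (q.totient : ℝ) ≤ q := by exact_mod_cast Nat.totient_le q
  have hq : (10 : ℝ) ^ 30 ≤ q := by exact_mod_cast H.q_ge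
  have hq1 : (1 : ℝ) ≤ q := le_trans (by norm_num) hq
  rw [div_div]
  refine one_div_le_one_div_of_le (by positivity) ?_
  calc (10 : ℝ) ^ 30 * q.totient ≤ q * q := by gcongr
    _ = q ^ 2 := by ring
    _ ≤ q ^ 10 := pow_le_pow_right₀ hq1 (by norm_num)

/-- The total mass of the rough numbers in a residue class. -/
lemma roughSum_one_le (H : Params q y t) [NeZero q] {j : ℕ} (hj : j ≤ 61)
    {a : ZMod q} (ha : IsUnit a) :
    roughSum q (scale y t) (y ^ 2 ^ t) 1 j a ≤ 131074 / q.totient := by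
  have hz1 : 1 ≤ y ^ 2 ^ t := H.q_pos.trans_le H.q_le_z
  have hz1' : (1 : ℝ) ≤ (y ^ 2 ^ t : ℕ) := by exact_mod_cast hz1
  have hφ : (0 : ℝ) < q.totient := by exact_mod_cast Nat.totient_pos.2 H.q_pos
  rw [roughSum_eq_of_le hz1]
  refine (H.roughSum_le le_rfl hj ha).trans ?_
  rw [div_self (by positivity)]
  have h1 : wtInt (scale y t) j (y ^ 2 ^ t : ℕ) / scale y t ≤ 1 :=
    div_le_one_of_le₀ (wtInt_le H.scale_pos hz1' j) H.scale_pos.le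
  have h2 := H.inv_pow_le
  calc _ ≤ 131073 * 1 / (q.totient : ℝ) + 1 / 10 ^ 30 / q.totient := by gcongr
    _ = (131073 + 1 / 10 ^ 30) / q.totient := by ring
    _ ≤ _ := by gcongr; norm_num

/-- The contribution of the small rough numbers. -/
lemma roughSum_head_le (H : Params q y t) [NeZero q] {j N₀ : ℕ} (hj : j ≤ 61)
    (hN : y ^ 2 ^ t ≤ N₀) {κ : ℝ} (hκ : Real.log N₀ / scale y t ≤ κ)
    {a : ZMod q} (ha : IsUnit a) :
    roughSum q (scale y t) (y ^ 2 ^ t) 1 j a - roughSum q (scale y t) (y ^ 2 ^ t) N₀ j a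
      ≤ κ ^ j / j.factorial * (131074 / q.totient) ∧
    roughSum q (scale y t) (y ^ 2 ^ t) N₀ j a ≤ roughSum q (scale y t) (y ^ 2 ^ t) 1 j a := by
  have hX := H.scale_pos
  have hz1 : 1 ≤ y ^ 2 ^ t := H.q_pos.trans_le H.q_le_z
  have hexpz : ∀ {i : ℕ}, i ≤ 61 → Real.exp i ≤ (y ^ 2 ^ t : ℕ) := fun hi ↦
    (H.exp_le hi).trans (by exact_mod_cast H.q_le_z)
  have hexpN : Real.exp j ≤ N₀ := (hexpz hj).trans (by exact_mod_cast hN)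
  have h0 := H.roughSum_one_le (Nat.zero_le 61) ha
  rw [roughSum_eq_of_le hz1] at h0 ⊢
  have s1 := summable_rough (q := q) hX (hexpz hj) (y ^ 2 ^ t) a
  have s2 := summable_rough (q := q) hX hexpN (y ^ 2 ^ t) a
  have s3 := summable_rough (q := q) (j := 0) hX (hexpz (Nat.zero_le 61)) (y ^ 2 ^ t) a
  have hκ0 : 0 ≤ κ := (div_nonneg (Real.log_natCast_nonneg N₀) hX.le).trans hκ
  constructor
  · rw [roughSum, roughSum, ← s1.tsum_sub s2]
    refine le_trans ?_ (mul_le_mul_of_nonneg_left h0 (by positivity))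
    rw [roughSum, ← tsum_mul_left]
    refine (s1.sub s2).tsum_le_tsum (fun n ↦ ?_) (s3.mul_left _)
    by_cases hn : y ^ 2 ^ t < n ∧ (n : ZMod q) = a
    · have hn1 : (1 : ℝ) ≤ n := by exact_mod_cast Nat.one_le_of_lt hn.1
      by_cases hn2 : N₀ < n
      · rw [if_pos hn, if_pos ⟨hn2, hn.2⟩, sub_self, if_pos hn]
        exact mul_nonneg (by positivity) (rho_mul_wt_nonneg hX _ _ _)
      · rw [if_pos hn, if_neg (fun h ↦ hn2 h.1), sub_zero, if_pos hn, mul_left_comm]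
        refine mul_le_mul_of_nonneg_left ?_ (rho_nonneg _ _)
        have h1 : Real.log n / scale y t ≤ κ := by
          refine le_trans ?_ hκ
          gcongr
          exact not_lt.1 hn2
        have h2 : 0 ≤ Real.log n / scale y t := div_nonneg (Real.log_nonneg hn1) hX.le
        simp only [wt, pow_zero, Nat.factorial_zero, Nat.cast_one, div_one, one_mul]
        rw [mul_div_assoc]
        gcongr
    · rw [if_neg hn, if_neg (fun h ↦ hn ⟨hN.trans_lt h.1, h.2⟩), if_neg hn]
      simp
  · refine s2.tsum_le_tsum (fun n ↦ ?_) s1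
    by_cases hn : N₀ < n ∧ (n : ZMod q) = a
    · rw [if_pos hn, if_pos ⟨hN.trans_lt hn.1, hn.2⟩]
    · rw [if_neg hn]
      split_ifs
      exacts [rho_mul_wt_nonneg hX _ _ _, le_rfl]

/-- The weighted sums over rough numbers are equidistributed in residue classes. -/
lemma roughSum_asymptotic (H : Params q y t) [NeZero q] {j : ℕ} (hj : 20 ≤ j) (hj' : j ≤ 61) :
    ∃ m : ℝ, ∀ a : ZMod q, IsUnit a →
      |roughSum q (scale y t) (y ^ 2 ^ t) 1 j a - m| ≤ 1 / 10 ^ 19 / q.totient := by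
  set X := scale y t with hXdef
  set z := y ^ 2 ^ t with hz
  have hX : 0 < X := H.scale_pos
  have hy0 : 0 < y := lt_of_lt_of_le (by norm_num) H.y_ge
  have hz2 : 2 ≤ z := le_trans (by norm_num) (H.q_ge.trans H.q_le_z)
  have hzN : z ≤ z ^ 96 := Nat.le_self_pow (by norm_num) z
  have hexp : Real.exp j ≤ (z ^ 96 : ℕ) :=
    (H.exp_le hj').trans (by exact_mod_cast H.q_le_z.trans hzN)
  have hN1 : (1 : ℝ) ≤ (z ^ 96 : ℕ) := by exact_mod_cast (by omega : 1 ≤ z).trans hzN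
  have hφ : (0 : ℝ) < q.totient := by exact_mod_cast Nat.totient_pos.2 H.q_pos
  have hlz : 0 < Real.log z := H.log_z_pos
  refine ⟨wtInt X j (z ^ 96 : ℕ) * (siftDensity q z / q), fun a ha ↦ ?_⟩
  obtain ⟨lp, lm, hpair⟩ := H.exists_pair t
  have h1 := roughSum_approx hX hexp ha (by positivity) hpair
  obtain ⟨h2, h3⟩ := H.roughSum_head_le hj' hzN (κ := 3 / 32) (le_of_eq (by
    rw [Nat.cast_pow, Real.log_pow, scale, ← hz]
    field_simp
    norm_num)) ha
  have h4 : ((3 : ℝ) / 32) ^ j / j.factorial ≤ 1 / 10 ^ 30 := by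
    calc ((3 : ℝ) / 32) ^ j / j.factorial ≤ (3 / 32) ^ 20 / (Nat.factorial 20 : ℕ) := by
          gcongr (?_ : ℝ) / (?_ : ℝ)
          · exact pow_le_pow_of_le_one (by norm_num) (by norm_num) hj
          · exact_mod_cast Nat.factorial_le hj
      _ ≤ _ := by norm_num [Nat.factorial]
  have h5 : wtInt X j (z ^ 96 : ℕ) * (siftDensity q z / q) ≤ 1024 / q.totient := by
    calc _ ≤ X * (1 / (q.totient * Real.log z)) := mul_le_mul (wtInt_le hX hN1 j)
          (siftDensity_div_le H.q_pos hz2) (div_nonneg (siftDensity_nonneg _ _) (by positivity)) hX.le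
      _ = _ := by rw [hXdef, scale, ← hz]; field_simp
  have h6 : 2 * truncErr 4.2 44 * (wtInt X j (z ^ 96 : ℕ) * (siftDensity q z / q)) ≤
      1 / 10 ^ 23 * (1024 / q.totient) :=
    mul_le_mul truncErr_forty_four_le h5 (mul_nonneg (wtInt_nonneg hX hN1 j)
      (div_nonneg (siftDensity_nonneg _ _) (by positivity))) (by positivity)
  have h7 : 4 ^ y * ((y : ℝ) ^ 2 ^ t) ^ 94 * wt X j (z ^ 96 : ℕ) ≤ 1 / 10 ^ 30 / q.totient := by
    refine le_trans ?_ H.inv_pow_le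
    have hnat : 4 ^ y * z ^ 94 * q ^ 10 ≤ z ^ 96 := by
      calc 4 ^ y * z ^ 94 * q ^ 10 ≤ q * z ^ 94 * q ^ 10 := by gcongr; exact H.four_pow_le
        _ = q ^ 11 * z ^ 94 := by ring
        _ ≤ q ^ 50 * z ^ 94 := by gcongr; exacts [H.q_pos, by norm_num]
        _ ≤ z * z ^ 94 := by gcongr; exact H.pow_le
        _ = z ^ 95 := by ring
        _ ≤ z ^ 96 := Nat.pow_le_pow_right (by omega) (by norm_num)
    have hnat' : (4 : ℝ) ^ y * ((y : ℝ) ^ 2 ^ t) ^ 94 * q ^ 10 ≤ (z ^ 96 : ℕ) := by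
      exact_mod_cast hnat
    have hq0 : (0 : ℝ) < q := by exact_mod_cast H.q_pos
    calc _ ≤ 4 ^ y * ((y : ℝ) ^ 2 ^ t) ^ 94 * ((z ^ 96 : ℕ) : ℝ)⁻¹ :=
          mul_le_mul_of_nonneg_left (wt_le_inv hX hN1 j) (by positivity)
      _ ≤ _ := by
          rw [le_div_iff₀ (by positivity), ← div_eq_mul_inv, div_mul_eq_mul_div,
            div_le_one (by positivity)]
          exact hnat'
  have h8 : (3 / 32 : ℝ) ^ j / j.factorial * (131074 / q.totient) ≤
      1 / 10 ^ 30 * (131074 / q.totient) := by gcongr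
  have e : (1 : ℝ) / 10 ^ 19 / q.totient = 1 / 10 ^ 23 * (1024 / q.totient) +
      1 / 10 ^ 30 / q.totient + 1 / 10 ^ 30 * (131074 / q.totient) +
      (1 / 10 ^ 19 - 1024 / 10 ^ 23 - 131075 / 10 ^ 30) / q.totient := by ring
  have h9 : 0 ≤ ((1 : ℝ) / 10 ^ 19 - 1024 / 10 ^ 23 - 131075 / 10 ^ 30) / q.totient :=
    div_nonneg (by norm_num) hφ.le
  rw [e]
  obtain ⟨h10, h11⟩ := abs_le.1 h1
  have h12 : (0 : ℝ) ≤ 1 / 10 ^ 30 * (131074 / q.totient) := by positivity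
  rw [abs_le]
  constructor <;> linarith

/-- The tail of the weighted sum over rough numbers. -/
lemma roughSum_tail_le (H : Params q y t) [NeZero q] {a : ZMod q} (ha : IsUnit a) :
    roughSum q (scale y t) (y ^ 2 ^ t) ((y ^ 2 ^ t) ^ 204800) 61 a ≤ 1 / 10 ^ 18 / q.totient := by
  set X := scale y t with hXdef
  set z := y ^ 2 ^ t with hz
  have hX : 0 < X := H.scale_pos
  have hz1 : 1 ≤ z := H.q_pos.trans_le H.q_le_z
  have hz1' : (1 : ℝ) ≤ (z : ℕ) := by exact_mod_cast hz1
  have hzN : z ≤ z ^ 204800 := Nat.le_self_pow (by norm_num) z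
  have hN1 : (1 : ℝ) ≤ (z ^ 204800 : ℕ) := by exact Nat.one_le_cast.2 (hz1.trans hzN)
  have hφ : (0 : ℝ) < q.totient := by exact_mod_cast Nat.totient_pos.2 H.q_pos
  have hlz : 0 < Real.log z := H.log_z_pos
  refine (H.roughSum_le hzN le_rfl ha).trans ?_
  have h1 := wtInt_le_tail hX hN1 61
  have h2 : Real.log (z ^ 204800 : ℕ) / X / 2 = 100 := by
    rw [Nat.cast_pow, Real.log_pow, hXdef, scale, ← hz]
    field_simp
    norm_num
  have h3 : Real.exp (-100) ≤ 1 / 10 ^ 42 := by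
    rw [Real.exp_neg, ← one_div]
    refine one_div_le_one_div_of_le (by positivity) ?_
    calc (10 : ℝ) ^ 42 ≤ 2.7 ^ 100 := by norm_num
      _ ≤ Real.exp 1 ^ 100 := by gcongr; linarith [Real.exp_one_gt_d9]
      _ = Real.exp 100 := by rw [← Real.exp_nat_mul]; norm_num
  rw [h2] at h1
  have h4 : wtInt X 61 (z ^ 204800 : ℕ) / X ≤ 2 ^ 61 * (1 / 10 ^ 42) := by
    rw [div_le_iff₀' hX]
    refine h1.trans ?_
    gcongr
  have h5 : (z : ℝ) / (z ^ 204800 : ℕ) ≤ 1 :=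
    div_le_one_of_le₀ (Nat.cast_le.2 hzN) (Nat.cast_nonneg _)
  calc _ ≤ 131073 * (2 ^ 61 * (1 / 10 ^ 42)) / (q.totient : ℝ) + 1 / 10 ^ 30 / q.totient := by
        refine add_le_add (by gcongr) ?_
        refine le_trans ?_ H.inv_pow_le
        gcongr
    _ = (131073 * (2 ^ 61 * (1 / 10 ^ 42)) + 1 / 10 ^ 30) / q.totient := by ring
    _ ≤ _ := by gcongr; norm_num

end Params

end Linnik

namespace Linnik

open Finset ComplexConjugate

variable {q : ℕ}

/-- A partial inverse transform. -/
noncomputable def partialInv (S : Finset (DirichletCharacter ℂ q)) (G : DirichletCharacter ℂ q → ℂ)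
    (a : ZMod q) : ℂ := ∑ χ ∈ S, χ a⁻¹ * G χ

variable {S B : Finset (DirichletCharacter ℂ q)}

lemma partialInv_sub (G₁ G₂ : DirichletCharacter ℂ q → ℂ) (a : ZMod q) :
    partialInv S (fun χ ↦ G₁ χ - G₂ χ) a = partialInv S G₁ a - partialInv S G₂ a := by
  simp [partialInv, mul_sub]

lemma partialInv_sum {ι : Type*} (s : Finset ι) (G : ι → DirichletCharacter ℂ q → ℂ) (a : ZMod q) :
    partialInv S (fun χ ↦ ∑ i ∈ s, G i χ) a = ∑ i ∈ s, partialInv S (G i) a := by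
  simp only [partialInv, mul_sum]
  exact sum_comm

lemma partialInv_const_mul (c : ℂ) (G : DirichletCharacter ℂ q → ℂ) (a : ZMod q) :
    partialInv S (fun χ ↦ c * G χ) a = c * partialInv S G a := by
  simp only [partialInv, mul_sum]
  exact sum_congr rfl fun χ _ ↦ by ring

lemma char_inv_apply (χ : DirichletCharacter ℂ q) {a : ZMod q} (ha : IsUnit a) :
    χ⁻¹ a = χ a⁻¹ := by
  rw [MulChar.inv_apply_eq_inv']
  exact inv_eq_of_mul_eq_one_right (by rw [← map_mul, ZMod.mul_inv_of_unit a ha, map_one])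

lemma isUnit_inv {a : ZMod q} (ha : IsUnit a) : IsUnit a⁻¹ :=
  IsUnit.of_mul_eq_one _ (ZMod.inv_mul_of_unit a ha)

variable [NeZero q]

/-- The transform of a function on residues with respect to the characters modulo `q`. -/
noncomputable def charHat (A : ZMod q → ℝ) (χ : DirichletCharacter ℂ q) : ℂ :=
  ∑ a, χ a * (A a : ℂ)

open Classical in
lemma card_filter_isUnit : (univ.filter fun a : ZMod q ↦ IsUnit a).card = q.totient := by
  rw [← ZMod.card_units_eq_totient, ← Fintype.card_subtype]
  refine (Fintype.card_congr (Equiv.ofBijective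
    (fun u : (ZMod q)ˣ ↦ (⟨u, u.isUnit⟩ : {a : ZMod q // IsUnit a})) ⟨fun u v h ↦ ?_, ?_⟩)).symm
  · exact Units.ext (Subtype.mk.inj h)
  · rintro ⟨a, u, rfl⟩
    exact ⟨u, rfl⟩

lemma norm_charHat_le (A : ZMod q → ℝ) (χ : DirichletCharacter ℂ q) {M : ℝ}
    (hM : ∀ a, IsUnit a → |A a| ≤ M / q.totient) : ‖charHat A χ‖ ≤ M := by
  have hφ : (0 : ℝ) < q.totient := by exact_mod_cast Nat.totient_pos.2 (Nat.pos_of_neZero q)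
  classical
  have h : ∀ a : ZMod q, ‖χ a * (A a : ℂ)‖ ≤ if IsUnit a then M / q.totient else 0 := by
    intro a
    split_ifs with ha
    · rw [norm_mul, Complex.norm_real, Real.norm_eq_abs]
      exact (mul_le_of_le_one_left (abs_nonneg _) (χ.norm_le_one a)).trans (hM a ha)
    · simp [χ.map_nonunit ha]
  refine (norm_sum_le_of_le _ fun a _ ↦ h a).trans (le_of_eq ?_)
  rw [← sum_filter, sum_const, card_filter_isUnit, nsmul_eq_mul]
  field_simp

lemma sum_inv_mul_charHat (A : ZMod q → ℝ) {a : ZMod q} (ha : IsUnit a) :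
    ∑ χ : DirichletCharacter ℂ q, χ a⁻¹ * charHat A χ = q.totient * A a := by
  simp_rw [charHat, mul_sum]
  rw [sum_comm]
  have h : ∀ b : ZMod q, ∑ χ : DirichletCharacter ℂ q, χ a⁻¹ * (χ b * (A b : ℂ)) =
      if a = b then q.totient * (A b : ℂ) else 0 := by
    intro b
    simp_rw [← mul_assoc, ← sum_mul, DirichletCharacter.sum_char_inv_mul_char_eq ℂ ha]
    rw [ite_mul, zero_mul]
  simp_rw [h]
  simp

lemma sum_norm_sq_charHat_le (A : ZMod q → ℝ) {M : ℝ}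
    (hM : ∀ a, IsUnit a → |A a| ≤ M / q.totient) :
    ∑ χ : DirichletCharacter ℂ q, ‖charHat A χ‖ ^ 2 ≤ M ^ 2 := by
  have hφ : (0 : ℝ) < q.totient := by exact_mod_cast Nat.totient_pos.2 (Nat.pos_of_neZero q)
  have h1 : ∀ χ : DirichletCharacter ℂ q, ((‖charHat A χ‖ ^ 2 : ℝ) : ℂ) =
      ∑ a, (A a : ℂ) * (χ⁻¹ a * charHat A χ) := by
    intro χ
    rw [← Complex.normSq_eq_norm_sq, Complex.normSq_eq_conj_mul_self]
    nth_rw 1 [charHat]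
    rw [map_sum, sum_mul]
    refine sum_congr rfl fun a _ ↦ ?_
    rw [map_mul, Complex.conj_ofReal, show χ⁻¹ a = conj (χ a) from MulChar.star_apply' χ a ▸ rfl]
    ring
  have h2 : ((∑ χ : DirichletCharacter ℂ q, ‖charHat A χ‖ ^ 2 : ℝ) : ℂ) =
      ∑ a, (A a : ℂ) * ∑ χ : DirichletCharacter ℂ q, χ⁻¹ a * charHat A χ := by
    rw [Complex.ofReal_sum]
    simp_rw [h1, mul_sum]
    exact sum_comm
  classical
  have h3 : ∀ a : ZMod q, ‖(A a : ℂ) * ∑ χ : DirichletCharacter ℂ q, χ⁻¹ a * charHat A χ‖ ≤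
      if IsUnit a then M ^ 2 / q.totient else 0 := by
    intro a
    split_ifs with ha
    · have e : ∑ χ : DirichletCharacter ℂ q, χ⁻¹ a * charHat A χ = q.totient * A a := by
        rw [← sum_inv_mul_charHat A ha]
        refine sum_congr rfl fun χ _ ↦ ?_
        rw [char_inv_apply χ ha]
      rw [e, norm_mul, norm_mul, Complex.norm_real, Real.norm_eq_abs, Complex.norm_natCast]
      have h4 := hM a ha
      have h5 : |A a| * |A a| ≤ (M / q.totient) * (M / q.totient) :=
        mul_self_le_mul_self (abs_nonneg _) h4
      calc |A a| * (q.totient * |A a|) = q.totient * (|A a| * |A a|) := by ring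
        _ ≤ q.totient * ((M / q.totient) * (M / q.totient)) := by gcongr
        _ = _ := by field_simp
    · have : ∀ χ : DirichletCharacter ℂ q, χ⁻¹ a = 0 := fun χ ↦ χ⁻¹.map_nonunit ha
      simp [this]
  have h6 : ‖((∑ χ : DirichletCharacter ℂ q, ‖charHat A χ‖ ^ 2 : ℝ) : ℂ)‖ ≤ M ^ 2 := by
    rw [h2]
    refine (norm_sum_le_of_le _ fun a _ ↦ h3 a).trans (le_of_eq ?_)
    rw [← sum_filter, sum_const, card_filter_isUnit, nsmul_eq_mul]
    field_simp
  rw [Complex.norm_real, Real.norm_eq_abs] at h6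
  exact (le_abs_self _).trans h6

lemma norm_partialInv_mul_charHat_le {G : DirichletCharacter ℂ q → ℂ} {K L : ℝ} (hK : 0 ≤ K)
    (hG : ∀ a, IsUnit a → ‖partialInv S G a‖ ≤ K) {A : ZMod q → ℝ}
    (hA : ∀ b, 0 ≤ A b) (hL : ‖charHat A 1‖ ≤ L) {a : ZMod q} (ha : IsUnit a) :
    ‖partialInv S (fun χ ↦ G χ * charHat A χ) a‖ ≤ K * L := by
  have h1 : partialInv S (fun χ ↦ G χ * charHat A χ) a =
      ∑ b, (∑ χ ∈ S, χ b * χ a⁻¹ * G χ) * (A b : ℂ) := by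
    simp_rw [sum_mul]
    rw [partialInv, sum_comm]
    refine sum_congr rfl fun χ _ ↦ ?_
    rw [charHat, mul_sum, mul_sum]
    exact sum_congr rfl fun b _ ↦ by ring
  have h2 : ∀ b : ZMod q, ‖(∑ χ ∈ S, χ b * χ a⁻¹ * G χ) * (A b : ℂ)‖ ≤
      K * ‖(1 : DirichletCharacter ℂ q) b * (A b : ℂ)‖ := by
    intro b
    by_cases hb : IsUnit b
    · have h3 : ∑ χ ∈ S, χ b * χ a⁻¹ * G χ = partialInv S G (a * b⁻¹) := by
        refine sum_congr rfl fun χ _ ↦ ?_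
        rw [← char_inv_apply χ (ha.mul (isUnit_inv hb)), map_mul, char_inv_apply χ ha,
          ← char_inv_apply χ⁻¹ hb, inv_inv, mul_comm (χ b)]
      rw [h3, norm_mul, MulChar.one_apply hb, one_mul]
      exact mul_le_mul_of_nonneg_right (hG _ (ha.mul (isUnit_inv hb))) (norm_nonneg _)
    · have h4 : ∀ χ : DirichletCharacter ℂ q, χ b = 0 := fun χ ↦ χ.map_nonunit hb
      simp [h4]
  rw [h1]
  refine (norm_sum_le_of_le _ fun b _ ↦ h2 b).trans ?_
  rw [← mul_sum]
  refine mul_le_mul_of_nonneg_left (le_trans (le_of_eq ?_) hL) hK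
  have h5 : ∀ b, (1 : DirichletCharacter ℂ q) b * (A b : ℂ) =
      ((if IsUnit b then A b else 0 : ℝ) : ℂ) := by
    intro b
    by_cases hb : IsUnit b
    · rw [MulChar.one_apply hb, if_pos hb, one_mul]
    · rw [MulChar.map_nonunit _ hb, if_neg hb]
      simp
  have h6 : ∀ b, 0 ≤ if IsUnit b then A b else 0 := fun b ↦ by
    split_ifs
    exacts [hA b, le_rfl]
  simp_rw [charHat, h5]
  rw [← Complex.ofReal_sum, Complex.norm_real, Real.norm_eq_abs,
    abs_of_nonneg (sum_nonneg fun b _ ↦ h6 b)]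
  refine sum_congr rfl fun b _ ↦ ?_
  rw [Complex.norm_real, Real.norm_eq_abs, abs_of_nonneg (h6 b)]

lemma norm_partialInv_charHat_le (hSB : ∀ f : DirichletCharacter ℂ q → ℂ,
    ∑ χ, f χ = ∑ χ ∈ S, f χ + ∑ χ ∈ B, f χ) (hB : B.card ≤ 2) (h1 : 1 ∉ S)
    {A : ZMod q → ℝ} {m ε : ℝ} (hA : ∀ a, IsUnit a → |A a - m| ≤ ε / q.totient) {a : ZMod q}
    (ha : IsUnit a) : ‖partialInv S (charHat A) a‖ ≤ 3 * ε := by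
  have hφ : (0 : ℝ) < q.totient := by exact_mod_cast Nat.totient_pos.2 (Nat.pos_of_neZero q)
  have hε : 0 ≤ ε := by
    have := (abs_nonneg _).trans (hA a ha)
    by_contra h
    exact absurd this (not_le.2 (div_neg_of_neg_of_pos (not_le.1 h) hφ))
  have h2 : partialInv S (charHat A) a = partialInv S (charHat fun a ↦ A a - m) a := by
    refine sum_congr rfl fun χ hχ ↦ ?_
    have hχ1 : χ ≠ 1 := fun h ↦ h1 (h ▸ hχ)
    have h3 : ∑ a, χ a * (m : ℂ) = 0 := by
      rw [← sum_mul, MulChar.sum_eq_zero_of_ne_one hχ1, zero_mul]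
    congr 1
    simp_rw [charHat, Complex.ofReal_sub, mul_sub]
    rw [sum_sub_distrib, h3, sub_zero]
  have h4 := sum_inv_mul_charHat (fun a ↦ A a - m) ha
  rw [hSB] at h4
  have h5 : partialInv S (charHat A) a = q.totient * ((A a - m : ℝ) : ℂ) -
      ∑ χ ∈ B, χ a⁻¹ * charHat (fun a ↦ A a - m) χ := by
    rw [h2, ← h4, add_sub_cancel_right]
    rfl
  have h6 : ‖∑ χ ∈ B, χ a⁻¹ * charHat (fun a ↦ A a - m) χ‖ ≤ 2 * ε := by
    calc _ ≤ ∑ χ ∈ B, ε := norm_sum_le_of_le _ fun χ _ ↦ by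
          rw [norm_mul]
          exact (mul_le_of_le_one_left (norm_nonneg _) (χ.norm_le_one _)).trans
            (norm_charHat_le _ χ hA)
      _ = B.card * ε := by simp
      _ ≤ 2 * ε := by gcongr; exact_mod_cast hB
  have h7 : ‖(q.totient : ℂ) * ((A a - m : ℝ) : ℂ)‖ ≤ ε := by
    rw [norm_mul, Complex.norm_natCast, Complex.norm_real, Real.norm_eq_abs]
    calc _ ≤ q.totient * (ε / q.totient) := by gcongr; exact hA a ha
      _ = ε := by field_simp
  rw [h5]
  linarith [norm_sub_le ((q.totient : ℂ) * ((A a - m : ℝ) : ℂ))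
    (∑ χ ∈ B, χ a⁻¹ * charHat (fun a ↦ A a - m) χ)]

lemma norm_partialInv_mul_mul_le {A₁ A₂ : ZMod q → ℝ} {G : DirichletCharacter ℂ q → ℂ} {δ C : ℝ}
    (hδ : 0 ≤ δ) (hG : ∀ χ ∈ S, ‖G χ‖ ≤ δ) (h₁ : ∀ a, IsUnit a → |A₁ a| ≤ C / q.totient)
    (h₂ : ∀ a, IsUnit a → |A₂ a| ≤ C / q.totient) (a : ZMod q) :
    ‖partialInv S (fun χ ↦ G χ * charHat A₁ χ * charHat A₂ χ) a‖ ≤ δ * C ^ 2 := by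
  have h3 : ∀ χ ∈ S, ‖χ a⁻¹ * (G χ * charHat A₁ χ * charHat A₂ χ)‖ ≤
      δ * ((‖charHat A₁ χ‖ ^ 2 + ‖charHat A₂ χ‖ ^ 2) / 2) := by
    intro χ hχ
    rw [norm_mul, norm_mul, norm_mul, mul_assoc]
    refine (mul_le_of_le_one_left (by positivity) (χ.norm_le_one _)).trans ?_
    refine mul_le_mul (hG χ hχ) ?_ (by positivity) hδ
    nlinarith [sq_nonneg (‖charHat A₁ χ‖ - ‖charHat A₂ χ‖)]
  refine (norm_sum_le_of_le _ h3).trans ?_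
  rw [← mul_sum]
  refine mul_le_mul_of_nonneg_left ?_ hδ
  rw [← sum_div, sum_add_distrib]
  have h4 : ∀ A : ZMod q → ℝ, ∑ χ ∈ S, ‖charHat A χ‖ ^ 2 ≤
      ∑ χ : DirichletCharacter ℂ q, ‖charHat A χ‖ ^ 2 := fun A ↦
    sum_le_univ_sum_of_nonneg fun χ ↦ by positivity
  linarith [h4 A₁, h4 A₂, sum_norm_sq_charHat_le A₁ h₁, sum_norm_sq_charHat_le A₂ h₂]

/-- Equidistribution of the weighted prime sums, apart from the characters in `B`. -/
lemma norm_partialInv_prime_le (hSB : ∀ f : DirichletCharacter ℂ q → ℂ,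
    ∑ χ, f χ = ∑ χ ∈ S, f χ + ∑ χ ∈ B, f χ) (hB : B.card ≤ 2) (h1 : 1 ∉ S)
    {P Q : ℕ → ZMod q → ℝ} {ε C δ : ℝ} (hP0 : ∀ j a, 0 ≤ P j a) (hQ0 : ∀ j a, 0 ≤ Q j a)
    (hε : 0 ≤ ε) (hδ : 0 ≤ δ) (hC : 0 ≤ C)
    (hPC : ∀ j ≤ 61, ∀ a, IsUnit a → P j a ≤ C / q.totient)
    (hPε : ∀ j, 20 ≤ j → j ≤ 61 → ∃ m : ℝ, ∀ a, IsUnit a → |P j a - m| ≤ ε / q.totient)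
    (hQ2 : ∀ j ≤ 60, ‖charHat (Q j) 1‖ ≤ 2)
    (hQδ : ∀ j, 20 ≤ j → ∀ χ ∈ S, ‖charHat (Q j) χ‖ ≤ δ)
    (hrel : ∀ χ : DirichletCharacter ℂ q, ∀ h : ℕ, charHat (Q h) χ =
      ((h + 1 : ℕ) : ℂ) * charHat (P (h + 1)) χ -
        ∑ x ∈ antidiagonal h, charHat (Q x.1) χ * charHat (P x.2) χ)
    {a : ZMod q} (ha : IsUnit a) :
    ‖partialInv S (charHat (Q 60)) a‖ ≤
      61 * (3 * ε) + 61 * (61 * (3 * ε * C) + 61 * (3 * ε * C * 2 + δ * C ^ 2)) := by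
  have hPabs : ∀ j ≤ 61, ∀ a, IsUnit a → |P j a| ≤ C / q.totient := fun j hj a ha ↦ by
    rw [abs_of_nonneg (hP0 j a)]
    exact hPC j hj a ha
  have hP1 : ∀ j ≤ 61, ‖charHat (P j) 1‖ ≤ C := fun j hj ↦ norm_charHat_le _ _ (hPabs j hj)
  have hflat : ∀ j, 20 ≤ j → j ≤ 61 → ∀ a, IsUnit a → ‖partialInv S (charHat (P j)) a‖ ≤ 3 * ε := by
    intro j hj hj' a ha
    obtain ⟨m, hm⟩ := hPε j hj hj'
    exact norm_partialInv_charHat_le hSB hB h1 hm ha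
  have hPP : ∀ i j, i ≤ 61 → j ≤ 61 → (20 ≤ i ∨ 20 ≤ j) → ∀ a, IsUnit a →
      ‖partialInv S (fun χ ↦ charHat (P i) χ * charHat (P j) χ) a‖ ≤ 3 * ε * C := by
    intro i j hi hj hij a ha
    rcases hij with h | h
    · exact norm_partialInv_mul_charHat_le (by positivity) (hflat i h hi) (hP0 j) (hP1 j hj) ha
    · simp_rw [mul_comm (charHat (P i) _)]
      exact norm_partialInv_mul_charHat_le (by positivity) (hflat j h hj) (hP0 i) (hP1 i hi) ha
  have hQPP : ∀ i k j, i + k + j = 60 →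
      ‖partialInv S (fun χ ↦ charHat (Q i) χ * charHat (P k) χ * charHat (P j) χ) a‖ ≤
        3 * ε * C * 2 + δ * C ^ 2 := by
    intro i k j hsum
    by_cases hkj : 20 ≤ k ∨ 20 ≤ j
    · have h2 := norm_partialInv_mul_charHat_le (by positivity)
        (hPP k j (by omega) (by omega) hkj) (hQ0 i) (hQ2 i (by omega)) ha
      have e : (fun χ ↦ charHat (Q i) χ * charHat (P k) χ * charHat (P j) χ) =
          fun χ ↦ charHat (P k) χ * charHat (P j) χ * charHat (Q i) χ := by
        funext χ; ring
      rw [e]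
      exact h2.trans (le_add_of_nonneg_right (by positivity))
    · exact (norm_partialInv_mul_mul_le hδ (hQδ i (by omega)) (hPabs k (by omega))
        (hPabs j (by omega)) a).trans (le_add_of_nonneg_left (by positivity))
  have hQP : ∀ i j, i + j = 60 →
      ‖partialInv S (fun χ ↦ charHat (Q i) χ * charHat (P j) χ) a‖ ≤
        61 * (3 * ε * C) + 61 * (3 * ε * C * 2 + δ * C ^ 2) := by
    intro i j hij
    have e : (fun χ ↦ charHat (Q i) χ * charHat (P j) χ) =
        fun χ ↦ ((i + 1 : ℕ) : ℂ) * (charHat (P (i + 1)) χ * charHat (P j) χ) -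
          ∑ x ∈ antidiagonal i, charHat (Q x.1) χ * charHat (P x.2) χ * charHat (P j) χ := by
      funext χ
      rw [hrel χ i, sub_mul, sum_mul, mul_assoc]
    rw [e, partialInv_sub, partialInv_const_mul, partialInv_sum]
    refine (norm_sub_le _ _).trans (add_le_add ?_ ?_)
    · rw [norm_mul, Complex.norm_natCast]
      refine mul_le_mul ?_ (hPP _ _ (by omega) (by omega) (by omega) a ha) (norm_nonneg _)
        (by norm_num)
      exact_mod_cast (by omega : i + 1 ≤ 61)
    · refine (norm_sum_le_of_le _ fun x hx ↦ hQPP x.1 x.2 j ?_).trans ?_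
      · rw [mem_antidiagonal.1 hx, hij]
      · rw [sum_const, Nat.card_antidiagonal, nsmul_eq_mul]
        gcongr
        exact_mod_cast (by omega : i + 1 ≤ 61)
  have e : charHat (Q 60) = fun χ ↦ ((60 + 1 : ℕ) : ℂ) * charHat (P (60 + 1)) χ -
        ∑ x ∈ antidiagonal 60, charHat (Q x.1) χ * charHat (P x.2) χ := funext fun χ ↦ hrel χ 60
  rw [e, partialInv_sub, partialInv_const_mul, partialInv_sum]
  refine (norm_sub_le _ _).trans (add_le_add ?_ ?_)
  · rw [norm_mul, Complex.norm_natCast]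
    have := hflat 61 (by norm_num) le_rfl a ha
    norm_num
    exact this
  · refine (norm_sum_le_of_le _ fun x hx ↦ hQP x.1 x.2 (mem_antidiagonal.1 hx)).trans ?_
    rw [sum_const, Nat.card_antidiagonal, nsmul_eq_mul]
    norm_num

end Linnik

namespace Linnik

open Finset
open scoped ArithmeticFunction.vonMangoldt

lemma tsum_convolution {f g : ℕ → ℂ} (hf : Summable f) (hg : Summable g) (hf0 : f 0 = 0)
    (hg0 : g 0 = 0) : HasSum (fun n : ℕ ↦ ∑ p ∈ n.divisorsAntidiagonal, f p.1 * g p.2)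
      ((∑' n, f n) * ∑' n, g n) := by
  have h : ∀ f : ℕ → ℂ, f 0 = 0 → LSeries.term f 0 = f := by
    intro f hf
    funext n
    rcases eq_or_ne n 0 with rfl | hn
    · rw [LSeries.term_zero, hf]
    · rw [LSeries.term_of_ne_zero hn, Complex.cpow_zero, div_one]
  have hf' : LSeriesSummable f 0 := by rwa [LSeriesSummable, h f hf0]
  have hg' : LSeriesSummable g 0 := by rwa [LSeriesSummable, h g hg0]
  have := LSeriesHasSum.convolution hf'.LSeriesHasSum hg'.LSeriesHasSum
  rw [LSeries.convolution_def, LSeriesHasSum, LSeries, LSeries, h f hf0, h g hg0, h _ (by simp)] at this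
  exact this

variable {X : ℝ}

lemma wt_zero_right (j : ℕ) : wt X j 0 = 0 := by simp [wt]

lemma wt_one_right (j : ℕ) : wt X j 1 = if j = 0 then 1 else 0 := by
  rcases eq_or_ne j 0 with rfl | h <;> simp [wt, *]

lemma wt_natCast_nonneg (hX : 0 < X) (j n : ℕ) : 0 ≤ wt X j n := by
  rcases Nat.eq_zero_or_pos n with rfl | h
  · simp [wt_zero_right]
  · exact wt_nonneg hX (by exact_mod_cast h) j

lemma summable_wt (hX : 0 < X) (j : ℕ) : Summable (fun n : ℕ ↦ wt X j n) := by
  obtain ⟨N₀, hN⟩ := exists_nat_ge (Real.exp j)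
  have h := summable_wt_class (q := 1) hX hN 0
  rw [← summable_nat_add_iff (N₀ + 1)] at h ⊢
  refine h.congr fun n ↦ ?_
  rw [if_pos ⟨by omega, Subsingleton.elim _ _⟩]

lemma log_div_mul_wt (hX : X ≠ 0) (j : ℕ) (t : ℝ) :
    Real.log t / X * wt X j t = (j + 1 : ℕ) * wt X (j + 1) t := by
  have h : ((j + 1 : ℕ) : ℝ) ≠ 0 := by positivity
  rw [wt, wt, Nat.factorial_succ, Nat.cast_mul, pow_succ]
  field_simp

/-- The weight attached to the prime powers. -/
noncomputable def primeWt (X : ℝ) (z j n : ℕ) : ℝ := rho z n * (Λ n / X * wt X j n)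

lemma primeWt_nonneg (hX : 0 < X) (z j n : ℕ) : 0 ≤ primeWt X z j n :=
  mul_nonneg (rho_nonneg _ _) (mul_nonneg (div_nonneg ArithmeticFunction.vonMangoldt_nonneg hX.le)
    (wt_natCast_nonneg hX j n))

lemma primeWt_le (hX : 0 < X) (z j n : ℕ) :
    primeWt X z j n ≤ rho z n * ((j + 1 : ℕ) * wt X (j + 1) n) := by
  rw [primeWt, ← log_div_mul_wt hX.ne']
  have := wt_natCast_nonneg hX j n
  have := rho_nonneg z n
  gcongr
  exact ArithmeticFunction.vonMangoldt_le_log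

lemma summable_primeWt (hX : 0 < X) (z j : ℕ) : Summable (primeWt X z j) := by
  refine ((summable_wt hX (j + 1)).mul_left ((j + 1 : ℕ) : ℝ)).of_nonneg_of_le
    (primeWt_nonneg hX z j) fun n ↦ (primeWt_le hX z j n).trans ?_
  exact mul_le_of_le_one_left (mul_nonneg (Nat.cast_nonneg _) (wt_natCast_nonneg hX _ n))
    (rho_le_one _ _)

lemma summable_rho_wt (hX : 0 < X) (z j : ℕ) : Summable (fun n : ℕ ↦ rho z n * wt X j n) :=
  (summable_wt hX j).of_nonneg_of_le (rho_mul_wt_nonneg hX z j) fun n ↦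
    mul_le_of_le_one_left (wt_natCast_nonneg hX _ n) (rho_le_one _ _)

/-- The weighted count of rough prime powers in a residue class. -/
noncomputable def primeSum (q : ℕ) (X : ℝ) (z j : ℕ) (a : ZMod q) : ℝ :=
  ∑' n : ℕ, if (n : ZMod q) = a then primeWt X z j n else 0

variable {q : ℕ}

lemma primeSum_nonneg (hX : 0 < X) (z j : ℕ) (a : ZMod q) : 0 ≤ primeSum q X z j a := by
  refine tsum_nonneg fun n ↦ ?_
  split_ifs
  exacts [primeWt_nonneg hX z j n, le_rfl]

lemma summable_class {w : ℕ → ℝ} (hw : Summable w) (hw0 : ∀ n, 0 ≤ w n) (a : ZMod q) :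
    Summable (fun n : ℕ ↦ if (n : ZMod q) = a then w n else 0) := by
  refine hw.of_nonneg_of_le (fun n ↦ ?_) fun n ↦ ?_ <;> split_ifs
  exacts [hw0 n, le_rfl, le_rfl, hw0 n]

lemma summable_char_mul (χ : DirichletCharacter ℂ q) {w : ℕ → ℝ} (hw : Summable w)
    (hw0 : ∀ n, 0 ≤ w n) : Summable (fun n : ℕ ↦ χ n * (w n : ℂ)) := by
  refine Summable.of_norm_bounded hw fun n ↦ ?_
  rw [norm_mul, Complex.norm_real, Real.norm_of_nonneg (hw0 n)]
  exact mul_le_of_le_one_left (hw0 n) (χ.norm_le_one _)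

variable [NeZero q]

lemma charHat_class {w : ℕ → ℝ} (hw : Summable w) (hw0 : ∀ n, 0 ≤ w n)
    (χ : DirichletCharacter ℂ q) :
    charHat (fun a ↦ ∑' n : ℕ, if (n : ZMod q) = a then w n else 0) χ = ∑' n : ℕ, χ n * (w n : ℂ) := by
  have h : ∀ a : ZMod q, χ a * ((∑' n : ℕ, if (n : ZMod q) = a then w n else 0 : ℝ) : ℂ) =
      ∑' n : ℕ, χ a * ((if (n : ZMod q) = a then w n else 0 : ℝ) : ℂ) := fun a ↦ by
    rw [Complex.ofReal_tsum, tsum_mul_left]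
  simp_rw [charHat, h]
  rw [← Summable.tsum_finsetSum fun a _ ↦ ?_]
  · refine tsum_congr fun n ↦ ?_
    rw [sum_eq_single (n : ZMod q) (fun b _ hb ↦ by simp [hb.symm]) (by simp), if_pos rfl]
  · exact (Complex.summable_ofReal.2 (summable_class hw hw0 a)).mul_left _

lemma charHat_primeSum (hX : 0 < X) (z j : ℕ) (χ : DirichletCharacter ℂ q) :
    charHat (primeSum q X z j) χ = ∑' n : ℕ, χ n * (primeWt X z j n : ℂ) :=
  charHat_class (summable_primeWt hX z j) (primeWt_nonneg hX z j) χ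

lemma charHat_roughSum (hX : 0 < X) (z j : ℕ) (χ : DirichletCharacter ℂ q) :
    ∑' n : ℕ, χ n * ((rho z n * wt X j n : ℝ) : ℂ) =
      charHat (roughSum q X z 1 j) χ + if j = 0 then 1 else 0 := by
  have h0 : ∀ n : ℕ, 0 ≤ if 1 < n then rho z n * wt X j n else 0 := fun n ↦ by
    split_ifs
    exacts [rho_mul_wt_nonneg hX z j n, le_rfl]
  have h1 : Summable fun n : ℕ ↦ if 1 < n then rho z n * wt X j n else 0 := by
    refine (summable_rho_wt hX z j).of_nonneg_of_le h0 fun n ↦ ?_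
    split_ifs
    exacts [le_rfl, rho_mul_wt_nonneg hX z j n]
  have h2 : charHat (roughSum q X z 1 j) χ =
      ∑' n : ℕ, χ n * ((if 1 < n then rho z n * wt X j n else 0 : ℝ) : ℂ) := by
    rw [← charHat_class h1 h0]
    congr 1
    funext a
    refine tsum_congr fun n ↦ ?_
    by_cases h3 : (n : ZMod q) = a <;> by_cases h4 : 1 < n <;> simp [h3, h4]
  rw [h2, (summable_char_mul χ (summable_rho_wt hX z j) (rho_mul_wt_nonneg hX z j)).tsum_eq_add_tsum_ite 1,
    add_comm]
  congr 1
  · refine tsum_congr fun n ↦ ?_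
    rcases lt_trichotomy n 1 with h | rfl | h
    · simp [Nat.lt_one_iff.1 h, rho_zero]
    · simp
    · simp [h, h.ne']
  · rw [rho_one, Nat.cast_one, Nat.cast_one, map_one, wt_one_right]
    split_ifs <;> simp

lemma wt_mul (j : ℕ) {m n : ℕ} (hm : m ≠ 0) (hn : n ≠ 0) :
    ∑ x ∈ antidiagonal j, wt X x.1 m * wt X x.2 n = wt X j ((m * n : ℕ) : ℝ) := by
  have hm' : (m : ℝ) ≠ 0 := by exact_mod_cast hm
  have hn' : (n : ℝ) ≠ 0 := by exact_mod_cast hn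
  have h2 : (Real.log m / X + Real.log n / X) ^ j / j.factorial =
      ∑ x ∈ antidiagonal j, (Real.log m / X) ^ x.1 / x.1.factorial *
        ((Real.log n / X) ^ x.2 / x.2.factorial) := by
    rw [(Commute.all _ _).add_pow', sum_div]
    refine sum_congr rfl fun x hx ↦ ?_
    have h4 := Nat.add_choose_mul_factorial_mul_factorial x.2 x.1
    rw [add_comm, mem_antidiagonal.1 hx, mul_right_comm] at h4
    have h5 : ((j.choose x.1 : ℕ) : ℝ) * x.1.factorial * x.2.factorial = j.factorial := by
      exact_mod_cast h4
    have h6 : ((j.choose x.1 : ℕ) : ℝ) ≠ 0 := fun h0 ↦ by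
      rw [h0, zero_mul, zero_mul] at h5
      exact (Nat.cast_ne_zero.2 j.factorial_ne_zero) h5.symm
    rw [← h5, nsmul_eq_mul]
    field_simp
  have h3 : Real.log ((m * n : ℕ) : ℝ) / X = Real.log m / X + Real.log n / X := by
    rw [Nat.cast_mul, Real.log_mul hm' hn', add_div]
  unfold wt
  rw [h3, h2, neg_add, Real.exp_add, sum_mul, sum_div, Nat.cast_mul]
  refine sum_congr rfl fun x _ ↦ ?_
  field_simp

/-- The logarithmic derivative relation between the rough sums and the prime sums. -/
lemma primeSum_relation (hX : 0 < X) (z : ℕ) (χ : DirichletCharacter ℂ q) (h : ℕ) :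
    charHat (primeSum q X z h) χ = ((h + 1 : ℕ) : ℂ) * charHat (roughSum q X z 1 (h + 1)) χ -
      ∑ x ∈ antidiagonal h, charHat (primeSum q X z x.1) χ * charHat (roughSum q X z 1 x.2) χ := by
  have hF : ∀ j, Summable (fun n : ℕ ↦ χ n * ((rho z n * wt X j n : ℝ) : ℂ)) := fun j ↦
    summable_char_mul χ (summable_rho_wt hX z j) (rho_mul_wt_nonneg hX z j)
  have hQ : ∀ j, Summable (fun n : ℕ ↦ χ n * (primeWt X z j n : ℂ)) := fun j ↦
    summable_char_mul χ (summable_primeWt hX z j) (primeWt_nonneg hX z j)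
  have h1 : ∀ x : ℕ × ℕ, HasSum (fun n : ℕ ↦ ∑ p ∈ n.divisorsAntidiagonal,
      χ p.1 * (primeWt X z x.1 p.1 : ℂ) * (χ p.2 * ((rho z p.2 * wt X x.2 p.2 : ℝ) : ℂ)))
      (charHat (primeSum q X z x.1) χ *
        (charHat (roughSum q X z 1 x.2) χ + if x.2 = 0 then 1 else 0)) := by
    intro x
    rw [charHat_primeSum hX, ← charHat_roughSum hX]
    have h4 : χ (0 : ℕ) * (primeWt X z x.1 0 : ℂ) = 0 := by simp [primeWt, rho_zero]
    have h5 : χ (0 : ℕ) * ((rho z 0 * wt X x.2 (0 : ℕ) : ℝ) : ℂ) = 0 := by simp [rho_zero]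
    have h6 := tsum_convolution (hQ x.1) (hF x.2) h4 h5
    exact h6
  have h2 := hasSum_sum (s := antidiagonal h) fun x _ ↦ h1 x
  have h3 : ∀ n : ℕ, ∑ x ∈ antidiagonal h, ∑ p ∈ n.divisorsAntidiagonal,
      χ p.1 * (primeWt X z x.1 p.1 : ℂ) * (χ p.2 * ((rho z p.2 * wt X x.2 p.2 : ℝ) : ℂ)) =
      ((h + 1 : ℕ) : ℂ) * (χ n * ((rho z n * wt X (h + 1) n : ℝ) : ℂ)) := by
    intro n
    rw [sum_comm]
    have h4 : ∀ p ∈ n.divisorsAntidiagonal, ∑ x ∈ antidiagonal h,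
        χ p.1 * (primeWt X z x.1 p.1 : ℂ) * (χ p.2 * ((rho z p.2 * wt X x.2 p.2 : ℝ) : ℂ)) =
        χ n * ((rho z n * wt X h n * (Λ p.1 / X) : ℝ) : ℂ) := by
      intro p hp
      obtain ⟨hpn, hn⟩ := Nat.mem_divisorsAntidiagonal.1 hp
      have h5 : ∀ x : ℕ × ℕ,
          χ p.1 * (primeWt X z x.1 p.1 : ℂ) * (χ p.2 * ((rho z p.2 * wt X x.2 p.2 : ℝ) : ℂ)) =
          χ n * ((rho z n * (wt X x.1 p.1 * wt X x.2 p.2) * (Λ p.1 / X) : ℝ) : ℂ) := by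
        intro x
        rw [← hpn, Nat.cast_mul, map_mul, rho_mul, primeWt]
        push_cast
        ring
      simp_rw [h5]
      rw [← mul_sum, ← Complex.ofReal_sum, ← sum_mul, ← mul_sum, wt_mul, hpn]
      · rintro h0
        exact hn (by rw [← hpn, h0, zero_mul])
      · rintro h0
        exact hn (by rw [← hpn, h0, mul_zero])
    rw [sum_congr rfl h4, ← mul_sum, ← Complex.ofReal_sum, ← mul_sum, ← sum_div,
      Nat.sum_divisorsAntidiagonal (fun i _ ↦ Λ i), ArithmeticFunction.vonMangoldt_sum,
      mul_assoc, mul_comm (wt X h n), log_div_mul_wt hX.ne']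
    push_cast
    ring
  simp_rw [h3] at h2
  have h6 := (((hF (h + 1)).hasSum).mul_left ((h + 1 : ℕ) : ℂ)).unique h2
  rw [charHat_roughSum hX, if_neg (by omega), add_zero] at h6
  rw [h6]
  simp_rw [mul_add]
  rw [sum_add_distrib, add_sub_cancel_left, sum_eq_single (h, 0)]
  · simp
  · rintro ⟨i, k⟩ hx hne
    rw [if_neg, mul_zero]
    rintro h0
    simp only at h0
    subst h0
    exact hne (by simpa using hx)
  · simp

end Linnik

namespace Linnik

open Finset
open scoped ArithmeticFunction.vonMangoldt

/-- The function `Λ(n) n^{-3/4}` restricted to the non-primes. -/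
noncomputable def nonprimeTerm (n : ℕ) : ℝ := if n.Prime then 0 else Λ n * (n : ℝ) ^ (-(3 / 4) : ℝ)

lemma nonprimeTerm_nonneg (n : ℕ) : 0 ≤ nonprimeTerm n := by
  unfold nonprimeTerm
  split_ifs
  · exact le_rfl
  · exact mul_nonneg ArithmeticFunction.vonMangoldt_nonneg (by positivity)

lemma nonprimeTerm_pow_le (p : Nat.Primes) (k : ℕ) : nonprimeTerm ((p : ℕ) ^ (k + 1 + 1)) ≤
    8 * (p : ℝ) ^ (-(11 / 8) : ℝ) * ((2 : ℝ) ^ (-(3 / 4) : ℝ)) ^ k := by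
  have hp : (0 : ℝ) < p := by exact_mod_cast p.prop.pos
  have hp2 : (2 : ℝ) ≤ p := by exact_mod_cast p.prop.two_le
  rw [nonprimeTerm, if_neg (Nat.Prime.not_prime_pow (by omega)),
    ArithmeticFunction.vonMangoldt_apply_pow (by omega),
    ArithmeticFunction.vonMangoldt_apply_prime p.prop]
  have h1 : Real.log p ≤ 8 * (p : ℝ) ^ (1 / 8 : ℝ) := by
    have := Real.log_le_rpow_div hp.le (show (0 : ℝ) < 1 / 8 by norm_num)
    linarith
  have h2 : (((p : ℕ) ^ (k + 1 + 1) : ℕ) : ℝ) ^ (-(3 / 4) : ℝ) =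
      (p : ℝ) ^ (-(3 / 2) : ℝ) * ((p : ℝ) ^ (-(3 / 4) : ℝ)) ^ k := by
    rw [Nat.cast_pow, ← Real.rpow_natCast, ← Real.rpow_natCast, ← Real.rpow_mul hp.le,
      ← Real.rpow_mul hp.le, ← Real.rpow_add hp]
    congr 1
    push_cast
    ring
  have h3 : (p : ℝ) ^ (-(3 / 4) : ℝ) ≤ (2 : ℝ) ^ (-(3 / 4) : ℝ) :=
    Real.rpow_le_rpow_of_nonpos (by norm_num) hp2 (by norm_num)
  have h4 : (p : ℝ) ^ (-(11 / 8) : ℝ) = (p : ℝ) ^ (1 / 8 : ℝ) * (p : ℝ) ^ (-(3 / 2) : ℝ) := by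
    rw [← Real.rpow_add hp]
    norm_num
  rw [h2, h4]
  calc _ ≤ 8 * (p : ℝ) ^ (1 / 8 : ℝ) *
        ((p : ℝ) ^ (-(3 / 2) : ℝ) * ((2 : ℝ) ^ (-(3 / 4) : ℝ)) ^ k) := by gcongr
    _ = _ := by ring

lemma summable_nonprimeTerm : Summable nonprimeTerm := by
  refine (summable_subtype_iff_indicator (s := {n | IsPrimePow n}).mp ?_).congr
    fun n ↦ Set.indicator_apply_eq_self.mpr fun (hn : ¬ IsPrimePow n) ↦ ?_
  swap
  · rw [nonprimeTerm, ArithmeticFunction.vonMangoldt_eq_zero_iff.2 hn, zero_mul, ite_self]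
  have h : nonprimeTerm ∘ Subtype.val (p := fun n ↦ n ∈ {n | IsPrimePow n}) =
      (fun x : Nat.Primes × ℕ ↦ nonprimeTerm ((x.1 : ℕ) ^ (x.2 + 1))) ∘
        ⇑Nat.Primes.prodNatEquiv.symm := by
    refine (Equiv.eq_comp_symm Nat.Primes.prodNatEquiv _ _).mpr ?_
    ext1 x
    simp only [Function.comp_apply]
    congr
  rw [h]
  refine (Nat.Primes.prodNatEquiv.symm.summable_iff
    (f := fun x : Nat.Primes × ℕ ↦ nonprimeTerm ((x.1 : ℕ) ^ (x.2 + 1)))).mpr ?_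
  have h1 : Summable fun x : Nat.Primes × ℕ ↦ nonprimeTerm ((x.1 : ℕ) ^ (x.2 + 1 + 1)) := by
    refine Summable.of_nonneg_of_le (fun x ↦ nonprimeTerm_nonneg _)
      (fun x ↦ nonprimeTerm_pow_le x.1 x.2) ?_
    refine Summable.mul_of_nonneg (f := fun p : Nat.Primes ↦ 8 * (p : ℝ) ^ (-(11 / 8) : ℝ))
      (g := fun k : ℕ ↦ ((2 : ℝ) ^ (-(3 / 4) : ℝ)) ^ k)
      ((Nat.Primes.summable_rpow.mpr (by norm_num)).mul_left 8)
      (summable_geometric_of_lt_one (by positivity)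
        (Real.rpow_lt_one_of_one_lt_of_neg (by norm_num) (by norm_num)))
      (fun p ↦ by positivity) (fun k ↦ by positivity)
  refine (Function.Injective.summable_iff (g := Prod.map _root_.id (· + 1))
    (f := fun x : Nat.Primes × ℕ ↦ nonprimeTerm ((x.1 : ℕ) ^ (x.2 + 1))) ?_ fun u hu ↦ ?_).mp h1
  · exact Function.Injective.prodMap Function.injective_id (add_left_injective 1)
  · have : u.2 = 0 := by
      by_contra h0
      exact hu ⟨(u.1, u.2 - 1), by ext1 <;> simp; omega⟩
    simp [this, nonprimeTerm, u.1.prop]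

variable {X : ℝ}

lemma vonMangoldt_mul_wt (hX : 0 < X) (j n : ℕ) : Λ n / X * wt X j n =
    (Λ n * Real.log n ^ j * (n : ℝ) ^ (-(1 + 1 / X))) / (j.factorial * X ^ (j + 1)) := by
  rcases Nat.eq_zero_or_pos n with rfl | hn
  · simp
  have hn' : (0 : ℝ) < n := by exact_mod_cast hn
  have h : (n : ℝ) ^ (-(1 + 1 / X)) = Real.exp (-(Real.log n / X)) / n := by
    rw [neg_add, Real.rpow_add hn', Real.rpow_neg_one, Real.rpow_def_of_pos hn', mul_neg, mul_one_div]
    ring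
  rw [h, wt, div_pow, pow_succ]
  field_simp

lemma one_sub_rho_nonneg (z n : ℕ) : 0 ≤ 1 - rho z n := sub_nonneg.2 (rho_le_one z n)

lemma mangoldt_wt_nonneg (hX : 0 < X) (j n : ℕ) : 0 ≤ Λ n / X * wt X j n :=
  mul_nonneg (div_nonneg ArithmeticFunction.vonMangoldt_nonneg hX.le) (wt_natCast_nonneg hX j n)

lemma summable_mangoldt_wt (hX : 0 < X) (j : ℕ) : Summable (fun n : ℕ ↦ Λ n / X * wt X j n) := by
  simp_rw [vonMangoldt_mul_wt hX]
  exact (summable_psi j (by have : 0 < 1 / X := by positivity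
                            linarith)).div_const _

/-- Outside of a small set of integers `n ≤ z`, the rough prime powers contain all the primes. -/
lemma tsum_nonrough_le (hX : 0 < X) {z : ℕ} (hz : 1 ≤ z) {κ : ℝ} (hκ : Real.log z / X ≤ κ) (j : ℕ) :
    ∑' n : ℕ, (1 - rho z n) * (Λ n / X * wt X j n) ≤
      κ ^ j * ((Real.log z + 5.4) / X) + (∑' n, nonprimeTerm n) / X := by
  have hz' : (1 : ℝ) ≤ z := by exact_mod_cast hz
  have hκ0 : 0 ≤ κ := (div_nonneg (Real.log_nonneg hz') hX.le).trans hκ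
  have h1 : ∀ n : ℕ, (1 - rho z n) * (Λ n / X * wt X j n) ≤
      (if n ∈ Ioc 0 z then κ ^ j / X * (Λ n / n) else 0) + nonprimeTerm n / X := by
    intro n
    have hnp := div_nonneg (nonprimeTerm_nonneg n) hX.le
    rcases Nat.eq_zero_or_pos n with rfl | hn
    · simpa using hnp
    have hn' : (1 : ℝ) ≤ n := by exact_mod_cast hn
    have hΛ : 0 ≤ Λ n := ArithmeticFunction.vonMangoldt_nonneg
    split_ifs with h
    · refine le_add_of_le_of_nonneg ?_ hnp
      have h2 : wt X j n ≤ κ ^ j / n := by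
        have hu : 0 ≤ Real.log n / X := div_nonneg (Real.log_nonneg hn') hX.le
        have huk : Real.log n / X ≤ κ := by
          refine le_trans ?_ hκ
          gcongr
          exact_mod_cast (mem_Ioc.1 h).2
        rw [wt]
        gcongr
        calc (Real.log n / X) ^ j / j.factorial * Real.exp (-(Real.log n / X))
            ≤ (Real.log n / X) ^ j / 1 * 1 := by
              gcongr
              · exact_mod_cast j.factorial_pos
              · exact Real.exp_le_one_iff.2 (by linarith)
          _ ≤ κ ^ j := by
              rw [div_one, mul_one]
              gcongr
      calc _ ≤ 1 * (Λ n / X * wt X j n) := by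
            refine mul_le_mul_of_nonneg_right ?_ (mangoldt_wt_nonneg hX j n)
            linarith [rho_nonneg z n]
        _ ≤ 1 * (Λ n / X * (κ ^ j / n)) := by gcongr
        _ = _ := by ring
    · rw [zero_add]
      have hzn : z < n := by
        by_contra h0
        exact h (mem_Ioc.2 ⟨hn, not_lt.1 h0⟩)
      by_cases hp : n.Prime
      · rw [rho_of_isRough, sub_self, zero_mul]
        · exact hnp
        · refine ⟨hn.ne', fun p hp' hd ↦ ?_⟩
          rwa [(Nat.prime_dvd_prime_iff_eq hp' hp).1 hd]
      · rw [nonprimeTerm, if_neg hp]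
        have h3 : wt X j n ≤ (n : ℝ) ^ (-(3 / 4) : ℝ) := by
          refine (wt_le_inv hX hn' j).trans ?_
          rw [← Real.rpow_neg_one]
          exact Real.rpow_le_rpow_of_exponent_le hn' (by norm_num)
        calc _ ≤ 1 * (Λ n / X * wt X j n) := by
              refine mul_le_mul_of_nonneg_right ?_ (mangoldt_wt_nonneg hX j n)
              linarith [rho_nonneg z n]
          _ ≤ 1 * (Λ n / X * (n : ℝ) ^ (-(3 / 4) : ℝ)) := by gcongr
          _ = _ := by ring
  have h4 : HasSum (fun n : ℕ ↦ if n ∈ Ioc 0 z then κ ^ j / X * (Λ n / n) else 0)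
      (∑ n ∈ Ioc 0 z, κ ^ j / X * (Λ n / n)) := by
    have h : HasSum (fun n : ℕ ↦ if n ∈ Ioc 0 z then κ ^ j / X * (Λ n / n) else 0)
        (∑ n ∈ Ioc 0 z, if n ∈ Ioc 0 z then κ ^ j / X * (Λ n / n) else 0) :=
      hasSum_sum_of_ne_finset_zero fun n hn ↦ if_neg hn
    rwa [sum_congr rfl fun n hn ↦ if_pos hn] at h
  have h5 : Summable fun n : ℕ ↦ (1 - rho z n) * (Λ n / X * wt X j n) := by
    refine (summable_mangoldt_wt hX j).of_nonneg_of_le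
      (fun n ↦ mul_nonneg (one_sub_rho_nonneg z n) (mangoldt_wt_nonneg hX j n)) fun n ↦ ?_
    exact mul_le_of_le_one_left (mangoldt_wt_nonneg hX j n) (by linarith [rho_nonneg z n])
  refine (h5.tsum_le_tsum h1 (h4.summable.add (summable_nonprimeTerm.div_const X))).trans ?_
  rw [h4.summable.tsum_add (summable_nonprimeTerm.div_const X), h4.tsum_eq, tsum_div_const, ← mul_sum]
  refine add_le_add ?_ le_rfl
  calc κ ^ j / X * ∑ n ∈ Ioc 0 z, Λ n / n ≤ κ ^ j / X * (Real.log z + 5.4) := by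
        gcongr
        exact sum_vonMangoldt_div_le hz
    _ = _ := by ring

variable {q : ℕ} [NeZero q]

/-- Comparison of the prime sums with the logarithmic derivative of the `L`-function. -/
lemma norm_charHat_primeSum_sub_le (hX : 0 < X) {z : ℕ} (hz : 1 ≤ z) {κ : ℝ}
    (hκ : Real.log z / X ≤ κ) (j : ℕ) (χ : DirichletCharacter ℂ q) :
    ‖charHat (primeSum q X z j) χ - psiSum χ j (1 + 1 / X) / (j.factorial * X ^ (j + 1) : ℝ)‖ ≤
      κ ^ j * ((Real.log z + 5.4) / X) + (∑' n, nonprimeTerm n) / X := by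
  refine le_trans ?_ (tsum_nonrough_le hX hz hκ j)
  have h1 : psiSum χ j (1 + 1 / X) / (j.factorial * X ^ (j + 1) : ℝ) =
      ∑' n : ℕ, χ n * ((Λ n / X * wt X j n : ℝ) : ℂ) := by
    rw [psiSum, ← tsum_div_const]
    refine tsum_congr fun n ↦ ?_
    rw [vonMangoldt_mul_wt hX, Complex.ofReal_div, mul_div_assoc]
  have h5 : Summable fun n : ℕ ↦ (1 - rho z n) * (Λ n / X * wt X j n) := by
    refine (summable_mangoldt_wt hX j).of_nonneg_of_le
      (fun n ↦ mul_nonneg (one_sub_rho_nonneg z n) (mangoldt_wt_nonneg hX j n)) fun n ↦ ?_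
    exact mul_le_of_le_one_left (mangoldt_wt_nonneg hX j n) (by linarith [rho_nonneg z n])
  rw [h1, charHat_primeSum hX,
    ← (summable_char_mul χ (summable_primeWt hX z j) (primeWt_nonneg hX z j)).tsum_sub
      (summable_char_mul χ (summable_mangoldt_wt hX j) (mangoldt_wt_nonneg hX j))]
  refine tsum_of_norm_bounded h5.hasSum fun n ↦ ?_
  rw [← mul_sub, ← Complex.ofReal_sub, norm_mul, Complex.norm_real, Real.norm_eq_abs, abs_sub_comm,
    primeWt, ← one_sub_mul, abs_of_nonneg]
  · refine mul_le_of_le_one_left ?_ (χ.norm_le_one _)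
    exact mul_nonneg (one_sub_rho_nonneg z n) (mangoldt_wt_nonneg hX j n)
  · exact mul_nonneg (one_sub_rho_nonneg z n) (mangoldt_wt_nonneg hX j n)

lemma norm_charHat_primeSum_le (hX : 0 < X) (z j : ℕ) (χ : DirichletCharacter ℂ q) :
    ‖charHat (primeSum q X z j) χ‖ ≤ psiZeta j (1 + 1 / X) / (j.factorial * X ^ (j + 1)) := by
  have h1 : psiZeta j (1 + 1 / X) / (j.factorial * X ^ (j + 1)) =
      ∑' n : ℕ, Λ n / X * wt X j n := by
    rw [psiZeta, ← tsum_div_const]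
    exact tsum_congr fun n ↦ (vonMangoldt_mul_wt hX j n).symm
  rw [h1, charHat_primeSum hX]
  refine tsum_of_norm_bounded (summable_mangoldt_wt hX j).hasSum fun n ↦ ?_
  rw [norm_mul, Complex.norm_real, Real.norm_of_nonneg (primeWt_nonneg hX z j n)]
  exact (mul_le_of_le_one_left (primeWt_nonneg hX z j n) (χ.norm_le_one _)).trans
    (mul_le_of_le_one_left (mangoldt_wt_nonneg hX j n) (rho_le_one z n))

end Linnik

namespace Linnik

open Finset
open scoped ArithmeticFunction.vonMangoldt

open Params (scale)

lemma exists_scale_bound : ∃ K : ℝ, 16 ≤ K ∧ ∀ X : ℝ, K ≤ X →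
    (∑' n, nonprimeTerm n) / X ≤ 1 / 10 ^ 27 ∧
    ∀ j ≤ 60, |psiZeta j (1 + 1 / X) / (j.factorial * X ^ (j + 1)) - 1| ≤ 1 / 10 ^ 9 := by
  choose C hC0 hC using exists_zeta_bound
  set C0 := ∑' n, nonprimeTerm n
  have hC00 : 0 ≤ C0 := tsum_nonneg nonprimeTerm_nonneg
  have hS : 0 ≤ ∑ j ∈ range 61, C j := sum_nonneg fun j _ ↦ (hC0 j).le
  refine ⟨16 + C0 * 10 ^ 27 + (∑ j ∈ range 61, C j) * 10 ^ 9, by nlinarith, fun X hX ↦ ?_⟩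
  have hX16 : 16 ≤ X := by nlinarith
  have hX0 : 0 < X := by linarith
  constructor
  · rw [div_le_iff₀ hX0]
    nlinarith
  · intro j hj
    have h1 := hC j (1 + 1 / X) (by have : 0 < 1 / X := by positivity
                                    linarith)
      (by have : 1 / X ≤ 1 / 16 := by gcongr
          linarith)
    have hf : (1 : ℝ) ≤ j.factorial := by exact_mod_cast j.factorial_pos
    have hXj : X ≤ X ^ (j + 1) := le_self_pow₀ (by linarith) (by omega)
    have h2 : (j.factorial : ℝ) / (1 + 1 / X - 1) ^ (j + 1) = j.factorial * X ^ (j + 1) := by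
      rw [add_sub_cancel_left, one_div, inv_pow, div_inv_eq_mul]
    rw [h2] at h1
    have hD : 0 < (j.factorial : ℝ) * X ^ (j + 1) := by positivity
    have hDX : X ≤ (j.factorial : ℝ) * X ^ (j + 1) := by nlinarith
    have h3 : C j ≤ ∑ j ∈ range 61, C j :=
      single_le_sum (f := C) (fun i _ ↦ (hC0 i).le) (mem_range.2 (by omega))
    rw [div_sub_one hD.ne', abs_div, abs_of_pos hD, div_le_iff₀ hD]
    refine h1.trans ?_
    rw [div_mul_eq_mul_div, one_mul, le_div_iff₀ (by norm_num)]
    nlinarith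

variable {q : ℕ} {X : ℝ}

lemma char_eq_one_of_primeWt_ne_zero {z : ℕ} (hq : q ≠ 0) (hz : q ≤ z) {j n : ℕ}
    (h : primeWt X z j n ≠ 0) : IsUnit (n : ZMod q) := by
  have hr : IsRough z n := by
    by_contra h0
    exact h (by rw [primeWt, rho_of_not h0, zero_mul])
  rw [ZMod.isUnit_iff_coprime]
  refine Nat.coprime_of_dvd fun p hp hpn hpq ↦ ?_
  exact absurd (hr.2 p hp hpn) (not_lt.2 ((Nat.le_of_dvd (Nat.pos_of_ne_zero hq) hpq).trans hz))

lemma charHat_primeSum_one [NeZero q] (hX : 0 < X) {z : ℕ} (hz : q ≤ z) (j : ℕ) :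
    charHat (primeSum q X z j) 1 = ((∑' n, primeWt X z j n : ℝ) : ℂ) := by
  rw [charHat_primeSum hX, Complex.ofReal_tsum]
  refine tsum_congr fun n ↦ ?_
  by_cases h : primeWt X z j n = 0
  · simp [h]
  · rw [MulChar.one_apply (char_eq_one_of_primeWt_ne_zero (NeZero.ne q) hz h), one_mul]

lemma tsum_primeWt_ge (hX : 0 < X) {z : ℕ} (hz : 1 ≤ z) {κ : ℝ} (hκ : Real.log z / X ≤ κ) (j : ℕ) :
    psiZeta j (1 + 1 / X) / (j.factorial * X ^ (j + 1)) -
      (κ ^ j * ((Real.log z + 5.4) / X) + (∑' n, nonprimeTerm n) / X) ≤ ∑' n, primeWt X z j n := by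
  have h1 : psiZeta j (1 + 1 / X) / (j.factorial * X ^ (j + 1)) =
      ∑' n : ℕ, Λ n / X * wt X j n := by
    rw [psiZeta, ← tsum_div_const]
    exact tsum_congr fun n ↦ (vonMangoldt_mul_wt hX j n).symm
  have h5 : Summable fun n : ℕ ↦ (1 - rho z n) * (Λ n / X * wt X j n) := by
    refine (summable_mangoldt_wt hX j).of_nonneg_of_le
      (fun n ↦ mul_nonneg (one_sub_rho_nonneg z n) (mangoldt_wt_nonneg hX j n)) fun n ↦ ?_
    exact mul_le_of_le_one_left (mangoldt_wt_nonneg hX j n) (by linarith [rho_nonneg z n])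
  have h2 : ∑' n : ℕ, Λ n / X * wt X j n = ∑' n, primeWt X z j n +
      ∑' n : ℕ, (1 - rho z n) * (Λ n / X * wt X j n) := by
    rw [← (summable_primeWt hX z j).tsum_add h5]
    exact tsum_congr fun n ↦ by rw [primeWt]; ring
  linarith [tsum_nonrough_le hX hz hκ j]

/-- If the weighted prime sum is not small, then there is a small prime in the class. -/
lemma exists_prime_of_primeSum [NeZero q] {y t : ℕ} (H : Params q y t) {a : ZMod q} (ha : IsUnit a)
    (hC : (∑' n, nonprimeTerm n) / scale y t ≤ 1 / 10 ^ 27)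
    (hlarge : 1 / 10 ^ 5 / q.totient < primeSum q (scale y t) (y ^ 2 ^ t) 60 a) :
    ∃ p : ℕ, p.Prime ∧ (p : ZMod q) = a ∧ p ≤ (y ^ 2 ^ t) ^ 204800 := by
  by_contra! hno
  refine absurd hlarge (not_lt.2 ?_)
  set X := scale y t with hXdef
  set z := y ^ 2 ^ t with hzdef
  have hX : 0 < X := H.scale_pos
  have hq1 : (1 : ℝ) ≤ q := by exact_mod_cast H.q_pos
  have hφ : (0 : ℝ) < q.totient := by exact_mod_cast Nat.totient_pos.2 H.q_pos
  have hφq : (q.totient : ℝ) ≤ q := by exact_mod_cast Nat.totient_le q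
  have hz : 1 ≤ z := H.q_pos.trans_le H.q_le_z
  have hzN : z ≤ z ^ 204800 := Nat.le_self_pow (OfNat.ofNat_ne_zero _) z
  have hexp : Real.exp (61 : ℕ) ≤ (z ^ 204800 : ℕ) :=
    (H.exp_le le_rfl).trans (Nat.cast_le.2 (H.q_le_z.trans hzN))
  have hbound : ∀ n : ℕ, (if (n : ZMod q) = a then primeWt X z 60 n else 0) ≤
      61 * (if z ^ 204800 < n ∧ (n : ZMod q) = a then rho z n * wt X 61 n else 0) +
        nonprimeTerm n / (X * q) := by
    intro n
    have hnp : 0 ≤ nonprimeTerm n / (X * q) := div_nonneg (nonprimeTerm_nonneg n) (by positivity)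
    have hr : 0 ≤ 61 * (if z ^ 204800 < n ∧ (n : ZMod q) = a then rho z n * wt X 61 n else 0) := by
      refine mul_nonneg (by norm_num) ?_
      split_ifs
      exacts [rho_mul_wt_nonneg hX z 61 n, le_rfl]
    split_ifs with h1 h2 h3
    · refine (primeWt_le hX z 60 n).trans (le_add_of_le_of_nonneg (le_of_eq ?_) hnp)
      push_cast
      ring
    · have hle : n ≤ z ^ 204800 := not_lt.1 fun h ↦ h2 ⟨h, h1⟩
      have hp : ¬ n.Prime := fun hp ↦ absurd (hno n hp h1) (not_lt.2 hle)
      rw [mul_zero, zero_add]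
      by_cases h0 : primeWt X z 60 n = 0
      · rwa [h0]
      have hn1 : 1 < n := by
        by_contra hn
        refine h0 ?_
        interval_cases n <;> simp [primeWt, rho_zero]
      have hzn : z < n := by
        by_contra hn
        exact h0 (by rw [primeWt, rho_eq_zero hn1 (not_lt.1 hn), zero_mul])
      have hn' : (1 : ℝ) ≤ n := by exact_mod_cast hn1.le
      have hn0 : (0 : ℝ) < n := by linarith
      have hqn : (q : ℝ) ≤ (n : ℝ) ^ (1 / 4 : ℝ) := by
        have h4 : ((q ^ 50 : ℕ) : ℝ) ≤ n := Nat.cast_le.2 (H.pow_le.trans hzn.le)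
        calc (q : ℝ) ≤ (q : ℝ) ^ (50 * (1 / 4) : ℝ) := by
              conv_lhs => rw [← Real.rpow_one (q : ℝ)]
              exact Real.rpow_le_rpow_of_exponent_le hq1 (by norm_num)
          _ = ((q ^ 50 : ℕ) : ℝ) ^ (1 / 4 : ℝ) := by
              rw [Real.rpow_mul (by linarith), Nat.cast_pow]
              norm_num
          _ ≤ _ := by gcongr
      have h5 : wt X 60 n ≤ (n : ℝ) ^ (-(3 / 4) : ℝ) / q := by
        refine (wt_le_inv hX hn' 60).trans ?_
        rw [le_div_iff₀ (by linarith)]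
        calc (n : ℝ)⁻¹ * q ≤ (n : ℝ)⁻¹ * (n : ℝ) ^ (1 / 4 : ℝ) := by gcongr
          _ = _ := by
            rw [← Real.rpow_neg_one, ← Real.rpow_add hn0]
            norm_num
      have hΛ : 0 ≤ Λ n := ArithmeticFunction.vonMangoldt_nonneg
      rw [nonprimeTerm, if_neg hp, primeWt]
      calc _ ≤ 1 * (Λ n / X * ((n : ℝ) ^ (-(3 / 4) : ℝ) / q)) := by
            gcongr
            · exact mangoldt_wt_nonneg hX 60 n
            · exact rho_le_one z n
        _ = _ := by field_simp
    · exact absurd h3.2 h1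
    · rw [mul_zero, zero_add]
      exact hnp
  have hsum : Summable fun n : ℕ ↦
      61 * (if z ^ 204800 < n ∧ (n : ZMod q) = a then rho z n * wt X 61 n else 0) :=
    (summable_rough hX hexp z a).mul_left _
  have h6 := (summable_class (summable_primeWt hX z 60) (primeWt_nonneg hX z 60) a).tsum_le_tsum
    hbound (hsum.add (summable_nonprimeTerm.div_const _))
  rw [hsum.tsum_add (summable_nonprimeTerm.div_const _), tsum_mul_left, tsum_div_const] at h6
  refine h6.trans ?_
  have h7 : roughSum q X z (z ^ 204800) 61 a ≤ 1 / 10 ^ 18 / q.totient := H.roughSum_tail_le ha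
  have h8 : (∑' n, nonprimeTerm n) / (X * q) ≤ 1 / 10 ^ 27 / q.totient := by
    rw [← div_div]
    calc _ ≤ (1 : ℝ) / 10 ^ 27 / q := by gcongr
      _ ≤ _ := by gcongr
  have h9 : 61 * (1 / 10 ^ 18 / q.totient) + 1 / 10 ^ 27 / q.totient ≤
      (1 : ℝ) / 10 ^ 5 / q.totient := by
    rw [← mul_div_assoc, ← add_div]
    gcongr
    norm_num
  refine le_trans (add_le_add (mul_le_mul_of_nonneg_left h7 (by norm_num)) h8) h9

end Linnik

namespace Linnik

open Finset

open Params (scale)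

variable {q y t : ℕ}

lemma small_error_le (H : Params q y t) (hX16 : 16 ≤ scale y t)
    (hC : (∑' n, nonprimeTerm n) / scale y t ≤ 1 / 10 ^ 27) {j : ℕ} (hj : 20 ≤ j) :
    (1 / 1024) ^ j * ((Real.log (y ^ 2 ^ t : ℕ) + 5.4) / scale y t) +
      (∑' n, nonprimeTerm n) / scale y t ≤ 2 / 10 ^ 27 := by
  have hz := H.log_z_pos
  have h1 : (Real.log (y ^ 2 ^ t : ℕ) + 5.4) / scale y t ≤ 1 := by
    rw [div_le_one H.scale_pos]
    have : scale y t = 1024 * Real.log (y ^ 2 ^ t : ℕ) := rfl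
    linarith
  have h2 : ((1 : ℝ) / 1024) ^ j ≤ (1 / 1024) ^ 20 :=
    pow_le_pow_of_le_one (by norm_num) (by norm_num) hj
  have h3 : ((1 : ℝ) / 1024) ^ j * ((Real.log (y ^ 2 ^ t : ℕ) + 5.4) / scale y t) ≤
      (1 / 1024) ^ 20 * 1 := by
    gcongr
  have h4 : ((1 : ℝ) / 1024) ^ 20 * 1 ≤ 1 / 10 ^ 27 := by norm_num
  linarith

lemma char_eq_one_or_neg_one {χ : DirichletCharacter ℂ q} (hχ : χ ^ 2 = 1) {a : ZMod q}
    (ha : IsUnit a) : χ a = 1 ∨ χ a = -1 := by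
  have h : (χ a) ^ 2 = 1 := by
    rw [← MulChar.pow_apply' χ (by norm_num), hχ, MulChar.one_apply ha]
  exact mul_self_eq_one_iff.1 (by rw [← sq, h])

variable [NeZero q]

lemma inv_one_add_pow_le {x : ℝ} (hx : 0 ≤ x) (n : ℕ) : ((1 + x) ^ n)⁻¹ ≤ (1 + n * x)⁻¹ := by
  have h := one_add_mul_le_pow (show (-2 : ℝ) ≤ x by linarith) n
  exact inv_anti₀ (by positivity) h

lemma norm_add_le_of_exceptional {w v : ℂ} {X β ε δ R : ℝ} {i : ℕ} (hX : 0 < X)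
    (hw : ‖w - v / (((i + 1).factorial * X ^ (i + 1 + 1) : ℝ) : ℂ)‖ ≤ ε)
    (hv : ‖v + (i + 1).factorial * ((((1 + 1 / X : ℝ) : ℂ) - β) ^ (i + 2))⁻¹‖ ≤ R)
    (hR : R / ((i + 1).factorial * X ^ (i + 1 + 1)) ≤ δ) :
    ‖w + ((((1 + (1 - β) * X) ^ (i + 2))⁻¹ : ℝ) : ℂ)‖ ≤ ε + δ := by
  have hf : ((i + 1).factorial : ℝ) ≠ 0 := by exact_mod_cast Nat.factorial_ne_zero _
  set θ : ℝ := ((1 + (1 - β) * X) ^ (i + 2))⁻¹ with hθ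
  have h6 : θ = (i + 1).factorial * ((1 + 1 / X - β) ^ (i + 2))⁻¹ /
      ((i + 1).factorial * X ^ (i + 1 + 1)) := by
    have h7 : 1 + (1 - β) * X = (1 + 1 / X - β) * X := by
      field_simp
      ring
    rw [hθ, h7, mul_pow, mul_inv, mul_div_mul_left _ _ hf]
    exact (div_eq_mul_inv _ _).symm
  have h5 : v / (((i + 1).factorial * X ^ (i + 1 + 1) : ℝ) : ℂ) + (θ : ℂ) =
      (v + (i + 1).factorial * ((((1 + 1 / X : ℝ) : ℂ) - β) ^ (i + 2))⁻¹) /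
        (((i + 1).factorial * X ^ (i + 1 + 1) : ℝ) : ℂ) := by
    rw [add_div, h6]
    push_cast
    rfl
  have h9 : ‖v / (((i + 1).factorial * X ^ (i + 1 + 1) : ℝ) : ℂ) + (θ : ℂ)‖ ≤ δ := by
    rw [h5, norm_div, Complex.norm_real, Real.norm_of_nonneg (by positivity)]
    refine le_trans ?_ hR
    gcongr
  refine le_trans (le_of_eq ?_) ((norm_add_le _ _).trans (add_le_add hw h9))
  congr 1
  ring

set_option maxHeartbeats 400000 in
/-- The lower bound for the weighted prime sum when the exceptional character does not intervene. -/
lemma primeSum_gt (H : Params q y t) (hX16 : 16 ≤ scale y t)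
    (hC : (∑' n, nonprimeTerm n) / scale y t ≤ 1 / 10 ^ 27)
    (hζ : ∀ j ≤ 60, |psiZeta j (1 + 1 / scale y t) / (j.factorial * scale y t ^ (j + 1)) - 1| ≤
      1 / 10 ^ 9)
    {χ₁ : DirichletCharacter ℂ q} {β : ℝ} (hβ : β < 1) (hχ₁ : χ₁ ^ 2 = 1)
    (hS : ∀ χ : DirichletCharacter ℂ q, χ ≠ 1 → χ ≠ χ₁ → ∀ (j : ℕ) (σ : ℝ), 1 < σ →
      σ ≤ 1 + 1 / (2400 * Real.log q) →
      ‖psiSum χ (j + 1) σ‖ ≤ 6 * (j + 1).factorial * (2400 * Real.log q) ^ (j + 2))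
    (hE : χ₁ ≠ 1 → ∀ (j : ℕ) (σ : ℝ), 1 < σ → σ ≤ 1 + 1 / (2400 * Real.log q) →
      ‖psiSum χ₁ (j + 1) σ + (j + 1).factorial * (((σ : ℂ) - β) ^ (j + 2))⁻¹‖ ≤
        6 * (j + 1).factorial * (2400 * Real.log q) ^ (j + 2))
    {a : ZMod q} (ha : IsUnit a)
    (hA : χ₁ = 1 ∨ χ₁ a ≠ 1 ∨ 5 / 10 ^ 11 ≤ (1 - β) * Real.log q) :
    1 / 10 ^ 5 / q.totient < primeSum q (scale y t) (y ^ 2 ^ t) 60 a := by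
  have hφ : (0 : ℝ) < q.totient := by exact_mod_cast Nat.totient_pos.2 H.q_pos
  have hsmall := fun j hj ↦ small_error_le H hX16 hC (j := j) hj
  have hX : 0 < scale y t := H.scale_pos
  have hzX : Real.log (y ^ 2 ^ t : ℕ) / scale y t ≤ 1 / 1024 := by
    rw [div_le_iff₀ hX]
    have : scale y t = 1024 * Real.log (y ^ 2 ^ t : ℕ) := rfl
    linarith
  have hXq : 51200 * Real.log q ≤ scale y t := by
    have : scale y t = 1024 * Real.log (y ^ 2 ^ t : ℕ) := rfl
    linarith [H.log_z_ge]
  have hqz := H.q_le_z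
  have hz1 : 1 ≤ y ^ 2 ^ t := H.q_pos.trans_le hqz
  set X := scale y t with hXdef
  set z := y ^ 2 ^ t with hzdef
  have hℒ := H.log_q_pos
  have hσ1 : 1 < 1 + 1 / X := by
    have : 0 < 1 / X := by positivity
    linarith
  have hσ2 : 1 + 1 / X ≤ 1 + 1 / (2400 * Real.log q) := by
    have : 1 / X ≤ 1 / (2400 * Real.log q) := by
      gcongr
      linarith
    linarith
  have hratio : ∀ j : ℕ, 20 ≤ j →
      6 * j.factorial * (2400 * Real.log q) ^ (j + 1) / (j.factorial * X ^ (j + 1)) ≤ 1 / 10 ^ 27 := by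
    intro j hj
    have hf : (0 : ℝ) < j.factorial := by exact_mod_cast j.factorial_pos
    have h1 : 2400 * Real.log q / X ≤ 3 / 64 := by
      rw [div_le_iff₀ hX]
      linarith
    have h2 : (2400 * Real.log q / X) ^ (j + 1) ≤ (3 / 64) ^ 21 := by
      calc _ ≤ (3 / 64 : ℝ) ^ (j + 1) := by gcongr
        _ ≤ _ := pow_le_pow_of_le_one (by norm_num) (by norm_num) (by omega)
    calc _ = 6 * (2400 * Real.log q / X) ^ (j + 1) := by
          rw [div_pow]
          field_simp
      _ ≤ 6 * (3 / 64) ^ 21 := by gcongr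
      _ ≤ _ := by norm_num
  have hcmp := fun j χ ↦ norm_charHat_primeSum_sub_le (q := q) hX hz1 hzX j χ
  have hSδ : ∀ j, 20 ≤ j → ∀ χ : DirichletCharacter ℂ q, χ ≠ 1 → χ ≠ χ₁ →
      ‖charHat (primeSum q X z j) χ‖ ≤ 3 / 10 ^ 27 := by
    intro j hj χ h1 h2
    obtain ⟨i, rfl⟩ : ∃ i, j = i + 1 := ⟨j - 1, by omega⟩
    have h3 := hcmp (i + 1) χ
    have h4 : ‖psiSum χ (i + 1) (1 + 1 / X) / (((i + 1).factorial * X ^ (i + 1 + 1) : ℝ) : ℂ)‖ ≤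
        1 / 10 ^ 27 := by
      rw [norm_div, Complex.norm_real, Real.norm_of_nonneg (by positivity)]
      refine le_trans ?_ (hratio (i + 1) hj)
      gcongr
      exact hS χ h1 h2 i _ hσ1 hσ2
    have h5 := norm_le_norm_sub_add (charHat (primeSum q X z (i + 1)) χ)
      (psiSum χ (i + 1) (1 + 1 / X) / (((i + 1).factorial * X ^ (i + 1 + 1) : ℝ) : ℂ))
    linarith [hsmall (i + 1) hj]
  have hone : 1 - 2 / 10 ^ 9 ≤ (charHat (primeSum q X z 60) 1).re := by
    rw [charHat_primeSum_one hX hqz, Complex.ofReal_re]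
    linarith [tsum_primeWt_ge hX hz1 hzX 60, hsmall 60 (by norm_num),
      (abs_le.1 (hζ 60 le_rfl)).1]
  classical
  set B : Finset (DirichletCharacter ℂ q) := {1, χ₁} with hBdef
  set S : Finset (DirichletCharacter ℂ q) := univ \ B with hSdef
  have hSB : ∀ f : DirichletCharacter ℂ q → ℂ, ∑ χ, f χ = ∑ χ ∈ S, f χ + ∑ χ ∈ B, f χ := fun f ↦
    (sum_sdiff (subset_univ B)).symm
  have hmain := norm_partialInv_prime_le (S := S) (B := B) hSB card_le_two (by simp [hSdef, hBdef])
    (P := fun j ↦ roughSum q X z 1 j) (Q := fun j ↦ primeSum q X z j) (ε := 1 / 10 ^ 19)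
    (C := 131074) (δ := 3 / 10 ^ 27) (fun j a ↦ roughSum_nonneg hX z 1 j a)
    (fun j a ↦ primeSum_nonneg hX z j a) (by norm_num) (by norm_num) (by norm_num)
    (fun j hj a ha ↦ H.roughSum_one_le hj ha) (fun j hj hj' ↦ H.roughSum_asymptotic hj hj')
    (fun j hj ↦ (norm_charHat_primeSum_le hX z j 1).trans (by linarith [(abs_le.1 (hζ j hj)).2]))
    (fun j hj χ hχ ↦ by
      simp only [hSdef, hBdef, mem_sdiff, mem_univ, true_and, mem_insert, mem_singleton,
        not_or] at hχ
      exact hSδ j hj χ hχ.1 hχ.2)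
    (fun χ h ↦ primeSum_relation hX z χ h) ha
  have hmain' : ‖partialInv S (charHat (primeSum q X z 60)) a‖ ≤ 1 / 10 ^ 9 :=
    hmain.trans (by norm_num)
  have htotal : (q.totient : ℂ) * primeSum q X z 60 a =
      partialInv S (charHat (primeSum q X z 60)) a +
        ∑ χ ∈ B, χ a⁻¹ * charHat (primeSum q X z 60) χ := by
    rw [← sum_inv_mul_charHat _ ha, hSB]
    rfl
  have hre := congrArg Complex.re htotal
  rw [Complex.add_re, show (q.totient : ℂ) * primeSum q X z 60 a =
    ((q.totient * primeSum q X z 60 a : ℝ) : ℂ) by push_cast; rfl, Complex.ofReal_re] at hre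
  have hp := (abs_le.1 (Complex.abs_re_le_norm (partialInv S (charHat (primeSum q X z 60)) a))).1
  have hBsum : 1 / 10 ^ 4 ≤ (∑ χ ∈ B, χ a⁻¹ * charHat (primeSum q X z 60) χ).re := by
    have hone' : ((1 : DirichletCharacter ℂ q) a⁻¹ * charHat (primeSum q X z 60) 1).re =
        (charHat (primeSum q X z 60) 1).re := by
      rw [MulChar.one_apply (isUnit_inv ha), one_mul]
    by_cases h1 : χ₁ = 1
    · have : B = {1} := by rw [hBdef, h1]; simp
      rw [this, sum_singleton, hone']
      linarith
    · have hne : (1 : DirichletCharacter ℂ q) ≠ χ₁ := fun h ↦ h1 h.symm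
      rw [hBdef, sum_pair hne, Complex.add_re, hone']
      obtain ⟨θ, hθ⟩ : ∃ θ : ℝ, θ = ((1 + (1 - β) * X) ^ 61)⁻¹ := ⟨_, rfl⟩
      have hx0 : 0 ≤ (1 - β) * X := mul_nonneg (by linarith) hX.le
      have hEx : ‖charHat (primeSum q X z 60) χ₁ + (θ : ℂ)‖ ≤ 3 / 10 ^ 27 := by
        rw [hθ]
        refine (norm_add_le_of_exceptional (i := 59) hX ((hcmp (59 + 1) χ₁).trans
          (hsmall (59 + 1) (by norm_num))) (hE h1 59 _ hσ1 hσ2)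
          (hratio (59 + 1) (by norm_num))).trans ?_
        norm_num
      have hre2 := abs_le.1 ((Complex.abs_re_le_norm _).trans hEx)
      rw [Complex.add_re, Complex.ofReal_re] at hre2
      have hθ0 : 0 ≤ θ := by rw [hθ]; positivity
      have hθ1 : θ ≤ (1 + (61 : ℕ) * ((1 - β) * X))⁻¹ :=
        hθ.trans_le (inv_one_add_pow_le hx0 61)
      have hinv : χ₁ a⁻¹ = χ₁ a := by
        rw [← char_inv_apply χ₁ ha]
        congr 1
        exact inv_eq_of_mul_eq_one_left (by rw [← sq, hχ₁])
      rw [hinv]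
      rcases char_eq_one_or_neg_one hχ₁ ha with h | h
      · have hA' : 5 / 10 ^ 11 ≤ (1 - β) * Real.log q := by
          rcases hA with h' | h' | h'
          exacts [absurd h' h1, absurd h h', h']
        have hx1 : 51200 * (5 / 10 ^ 11) ≤ (1 - β) * X := by nlinarith
        have hθ2 : θ ≤ 1 - 15 / 10 ^ 5 := by
          refine hθ1.trans ?_
          rw [inv_le_comm₀ (by positivity) (by norm_num)]
          push_cast
          norm_num at hx1 ⊢
          linarith
        rw [h, one_mul]
        linarith only [hone, hre2.1, hθ2]
      · rw [h, neg_one_mul, Complex.neg_re]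
        linarith only [hone, hre2.2, hθ0]
  rw [div_lt_iff₀ hφ, mul_comm, hre]
  linarith

end Linnik

namespace Linnik

open Finset

variable {q : ℕ}

/-- A quadratic character takes real values. -/
lemma exists_real_char {χ : DirichletCharacter ℂ q} (hχ : χ ^ 2 = 1) :
    ∃ ψ : DirichletCharacter ℝ q, ψ ^ 2 = 1 ∧ ∀ a, χ a = (ψ a : ℂ) := by
  have hre : ∀ a, χ a = ((χ a).re : ℂ) := by
    intro a
    by_cases ha : IsUnit a
    · rcases char_eq_one_or_neg_one hχ ha with h | h <;> simp [h]
    · simp [χ.map_nonunit ha]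
  let ψ : DirichletCharacter ℝ q :=
    { toFun := fun a ↦ (χ a).re
      map_one' := by simp
      map_mul' := fun a b ↦ by
        rw [map_mul, hre a, hre b]
        simp
      map_nonunit' := fun a ha ↦ by simp [χ.map_nonunit ha] }
  have hψ : ∀ a, χ a = (ψ a : ℂ) := hre
  refine ⟨ψ, ?_, hψ⟩
  ext a
  have h : χ (a : ZMod q) ^ 2 = 1 := by
    rw [← MulChar.pow_apply' χ (by norm_num), hχ, MulChar.one_apply a.isUnit]
  rw [MulChar.pow_apply' ψ (by norm_num), MulChar.one_apply a.isUnit]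
  rw [hψ] at h
  exact_mod_cast h

variable {ψ : DirichletCharacter ℝ q}

lemma real_char_mul_self (hψ : ψ ^ 2 = 1) {a : ZMod q} (ha : IsUnit a) : ψ a * ψ a = 1 := by
  rw [← sq, ← MulChar.pow_apply' ψ (by norm_num), hψ, MulChar.one_apply ha]

lemma real_char_cases (hψ : ψ ^ 2 = 1) (a : ZMod q) : ψ a = 0 ∨ ψ a = 1 ∨ ψ a = -1 := by
  by_cases ha : IsUnit a
  · exact Or.inr (mul_self_eq_one_iff.1 (real_char_mul_self hψ ha))
  · exact Or.inl (ψ.map_nonunit ha)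

lemma abs_real_char_le (hψ : ψ ^ 2 = 1) (a : ZMod q) : |ψ a| ≤ 1 := by
  rcases real_char_cases hψ a with h | h | h <;> simp [h]

/-- The convolution of a real character with the constant function one. -/
noncomputable def charDivisorSum (ψ : DirichletCharacter ℝ q) (n : ℕ) : ℝ :=
  ∑ d ∈ n.divisors, ψ d

lemma charDivisorSum_one : charDivisorSum ψ 1 = 1 := by simp [charDivisorSum]

lemma charDivisorSum_prime_pow {p : ℕ} (hp : p.Prime) (k : ℕ) :
    charDivisorSum ψ (p ^ k) = ∑ i ∈ range (k + 1), ψ p ^ i := by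
  rw [charDivisorSum, Nat.sum_divisors_prime_pow hp]
  simp

lemma charDivisorSum_mul {m n : ℕ} (h : m.Coprime n) :
    charDivisorSum ψ (m * n) = charDivisorSum ψ m * charDivisorSum ψ n := by
  let g : ArithmeticFunction ℝ := ⟨fun n ↦ if n = 0 then 0 else ψ n, by simp⟩
  have hg : g.IsMultiplicative := by
    rw [ArithmeticFunction.IsMultiplicative.iff_ne_zero]
    refine ⟨by simp [g], fun {a b} ha hb _ ↦ ?_⟩
    simp [g, ha, hb]
  have hsum : ∀ k : ℕ, (ArithmeticFunction.zeta * g : ArithmeticFunction ℝ) k =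
      charDivisorSum ψ k := by
    intro k
    rw [ArithmeticFunction.coe_zeta_mul_apply, charDivisorSum]
    refine sum_congr rfl fun d hd ↦ ?_
    simp [g, (Nat.pos_of_mem_divisors hd).ne']
  have := (ArithmeticFunction.isMultiplicative_zeta.natCast.mul hg).map_mul_of_coprime h
  rwa [hsum, hsum, hsum] at this

lemma geom_sum_nonneg_of_cases {x : ℝ} (hx : x = 0 ∨ x = 1 ∨ x = -1) (k : ℕ) :
    0 ≤ ∑ i ∈ range (k + 1), x ^ i ∧ (Even k → 1 ≤ ∑ i ∈ range (k + 1), x ^ i) := by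
  rcases hx with rfl | rfl | rfl
  · simp [sum_range_succ', zero_pow]
  · simp
    positivity
  · rw [neg_one_geom_sum]
    split_ifs with h
    · refine ⟨le_rfl, fun h' ↦ absurd h' ?_⟩
      rwa [Nat.even_add_one] at h
    · simp

lemma charDivisorSum_factorization {n : ℕ} (hn : n ≠ 0) :
    charDivisorSum ψ n = n.factorization.prod fun p k ↦ charDivisorSum ψ (p ^ k) :=
  Nat.multiplicative_factorization _ (fun _ _ h ↦ charDivisorSum_mul h) charDivisorSum_one hn

lemma charDivisorSum_nonneg (hψ : ψ ^ 2 = 1) (n : ℕ) : 0 ≤ charDivisorSum ψ n := by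
  rcases eq_or_ne n 0 with rfl | hn
  · simp [charDivisorSum]
  rw [charDivisorSum_factorization hn]
  refine prod_nonneg fun p hp ↦ ?_
  simp only
  rw [charDivisorSum_prime_pow (Nat.prime_of_mem_primeFactors hp)]
  exact (geom_sum_nonneg_of_cases (real_char_cases hψ p) _).1

lemma one_le_charDivisorSum_sq (hψ : ψ ^ 2 = 1) {m : ℕ} (hm : m ≠ 0) :
    1 ≤ charDivisorSum ψ (m ^ 2) := by
  rw [charDivisorSum_factorization (pow_ne_zero 2 hm)]
  refine Finset.prod_induction _ (fun x ↦ 1 ≤ x) (fun a b ha hb ↦ one_le_mul_of_one_le_of_one_le ha hb) le_rfl fun p hp ↦ ?_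
  simp only
  rw [charDivisorSum_prime_pow (Nat.prime_of_mem_primeFactors hp)]
  exact (geom_sum_nonneg_of_cases (real_char_cases hψ p) _).2 (by simp [Nat.factorization_pow])

lemma charDivisorSum_prime_mul {p : ℕ} (hp : p.Prime) (m : ℕ) :
    charDivisorSum ψ (p * m) = (1 + ψ p) * charDivisorSum ψ m -
      ψ p * if p ∣ m then charDivisorSum ψ (m / p) else 0 := by
  rcases eq_or_ne m 0 with rfl | hm
  · simp [charDivisorSum]
  obtain ⟨k, u, hu, rfl⟩ := Nat.exists_eq_pow_mul_and_not_dvd hm p hp.ne_one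
  have hc : ∀ j, (p ^ j).Coprime u := fun j ↦
    Nat.Coprime.pow_left _ ((Nat.Prime.coprime_iff_not_dvd hp).2 hu)
  rw [← mul_assoc, ← pow_succ', charDivisorSum_mul (hc _), charDivisorSum_mul (hc _)]
  rcases k with - | k
  · have : ¬ p ∣ p ^ 0 * u := by simpa using hu
    rw [if_neg this]
    simp only [charDivisorSum_prime_pow hp]
    simp [sum_range_succ]
  · have h : p ∣ p ^ (k + 1) * u := Dvd.dvd.mul_right (dvd_pow_self p (by omega)) u
    have h' : p ^ (k + 1) * u / p = p ^ k * u := by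
      rw [pow_succ', mul_assoc, Nat.mul_div_cancel_left _ hp.pos]
    rw [if_pos h, h', charDivisorSum_mul (hc _)]
    simp only [charDivisorSum_prime_pow hp]
    rw [sum_range_succ _ (k + 1 + 1), sum_range_succ _ (k + 1)]
    ring

end Linnik

namespace Linnik

open Finset Filter Topology

lemma abs_sum_mul_antitone_le {c b : ℕ → ℝ} {B : ℝ} (hc : ∀ m, |∑ i ∈ range m, c i| ≤ B)
    (hb : Antitone b) (hb0 : ∀ n, 0 ≤ b n) (n : ℕ) : |∑ i ∈ range n, c i * b i| ≤ B * b 0 := by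
  have h1 : ∑ i ∈ range n, c i * b i = (∑ i ∈ range n, c i) * b n +
      ∑ i ∈ range n, (∑ k ∈ range (i + 1), c k) * (b i - b (i + 1)) := by
    induction n with
    | zero => simp
    | succ n ih =>
      rw [sum_range_succ, ih, sum_range_succ (fun i ↦ (∑ k ∈ range (i + 1), c k) * _),
        sum_range_succ c]
      ring
  have h2 : |∑ i ∈ range n, (∑ k ∈ range (i + 1), c k) * (b i - b (i + 1))| ≤
      ∑ i ∈ range n, B * (b i - b (i + 1)) := by
    refine (abs_sum_le_sum_abs _ _).trans (sum_le_sum fun i _ ↦ ?_)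
    have h3 : 0 ≤ b i - b (i + 1) := sub_nonneg.2 (hb (Nat.le_succ i))
    rw [abs_mul, abs_of_nonneg h3]
    exact mul_le_mul_of_nonneg_right (hc _) h3
  rw [← mul_sum, sum_range_sub'] at h2
  have h4 : |(∑ i ∈ range n, c i) * b n| ≤ B * b n := by
    rw [abs_mul, abs_of_nonneg (hb0 n)]
    exact mul_le_mul_of_nonneg_right (hc _) (hb0 n)
  rw [h1]
  refine (abs_add_le _ _).trans ?_
  linarith

lemma sum_Ioc_divisorsAntidiagonal {M : Type*} [AddCommMonoid M] (N : ℕ) (h : ℕ → ℕ → M) :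
    ∑ n ∈ Ioc 0 N, ∑ p ∈ n.divisorsAntidiagonal, h p.1 p.2 =
      ∑ d ∈ Ioc 0 N, ∑ m ∈ Ioc 0 N, if d * m ≤ N then h d m else 0 := by
  trans ∑ n ∈ Ioc 0 N, ∑ x ∈ Ioc 0 N ×ˢ Ioc 0 N with x.1 * x.2 = n, h x.1 x.2
  · refine sum_congr rfl fun n hn ↦ ?_
    simp only [mem_Ioc] at hn
    rw [Nat.divisorsAntidiagonal_eq_prod_filter_of_le hn.1.ne' hn.2]
  · simp_rw [sum_filter]
    rw [sum_comm, sum_product]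
    refine sum_congr rfl fun d hd ↦ sum_congr rfl fun m hm ↦ ?_
    simp only [mem_Ioc] at hd hm
    have : 0 < d * m := Nat.mul_pos hd.1 hm.1
    rw [sum_ite_eq]
    simp [this]

lemma Ioc_filter_mul_le {d N : ℕ} (hd : 0 < d) : {m ∈ Ioc 0 N | d * m ≤ N} = Ioc 0 (N / d) := by
  ext m
  simp only [mem_filter, mem_Ioc, Nat.le_div_iff_mul_le hd]
  constructor
  · rintro ⟨⟨h1, _⟩, h3⟩
    exact ⟨h1, by rwa [mul_comm]⟩
  · rintro ⟨h1, h2⟩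
    refine ⟨⟨h1, (Nat.le_mul_of_pos_right m hd).trans h2⟩, by rwa [mul_comm]⟩

section

variable {q : ℕ} {ψ : DirichletCharacter ℝ q}

/-- Partial sums of `L(1, ψ)`. -/
noncomputable def partialL (ψ : DirichletCharacter ℝ q) (D : ℕ) : ℝ :=
  ∑ d ∈ range (D + 1), ψ d / d

lemma abs_sum_char_mul_le (hB : ∀ m : ℕ, |∑ k ∈ range m, ψ k| ≤ q) {b : ℕ → ℝ} (hb : Antitone b)
    (hb0 : ∀ n, 0 ≤ b n) (m n : ℕ) :
    |∑ i ∈ range n, ψ ((m + i : ℕ) : ZMod q) * b i| ≤ 2 * q * b 0 := by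
  refine abs_sum_mul_antitone_le (fun k ↦ ?_) hb hb0 n
  have h := sum_range_add (fun i : ℕ ↦ ψ (i : ZMod q)) m k
  have h1 := abs_le.1 (hB (m + k))
  have h2 := abs_le.1 (hB m)
  rw [abs_le]
  constructor <;> linarith [h1.1, h1.2, h2.1, h2.2]

lemma abs_partialL_sub_le (hB : ∀ m : ℕ, |∑ k ∈ range m, ψ k| ≤ q) (D n : ℕ) :
    |partialL ψ (D + n) - partialL ψ D| ≤ 2 * q / (D + 1) := by
  have h := sum_range_add (fun d : ℕ ↦ ψ (d : ZMod q) / d) (D + 1) n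
  have h1 : partialL ψ (D + n) - partialL ψ D =
      ∑ i ∈ range n, ψ ((D + 1 + i : ℕ) : ZMod q) * (1 / ((D : ℝ) + 1 + i)) := by
    rw [partialL, partialL, show D + n + 1 = D + 1 + n by ring, h, add_sub_cancel_left]
    refine sum_congr rfl fun i _ ↦ ?_
    push_cast
    rw [mul_one_div]
  rw [h1]
  refine (abs_sum_char_mul_le hB (fun i j hij ↦ ?_) (fun i ↦ by positivity) (D + 1) n).trans ?_
  · have : (i : ℝ) ≤ j := by exact_mod_cast hij
    gcongr
  · simp [div_eq_mul_inv]

lemma exists_limit_partialL (hB : ∀ m : ℕ, |∑ k ∈ range m, ψ k| ≤ q) :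
    ∃ L : ℝ, Tendsto (partialL ψ) atTop (𝓝 L) ∧ ∀ D : ℕ, |partialL ψ D - L| ≤ 2 * q / (D + 1) := by
  have hle : ∀ N n, N ≤ n → |partialL ψ n - partialL ψ N| ≤ 2 * q / (N + 1) := by
    intro N n h
    obtain ⟨k, rfl⟩ := Nat.exists_eq_add_of_le h
    exact abs_partialL_sub_le hB N k
  have hc : CauchySeq (partialL ψ) := by
    refine cauchySeq_of_le_tendsto_0 (fun N : ℕ ↦ 4 * (q : ℝ) * (1 / ((N : ℝ) + 1)))
      (fun n m N hn hm ↦ ?_) ?_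
    · rw [Real.dist_eq]
      have h1 := hle N n hn
      have h2 := hle N m hm
      rw [abs_sub_comm] at h2
      refine (abs_sub_le _ (partialL ψ N) _).trans ((add_le_add h1 h2).trans (le_of_eq ?_))
      ring
    · simpa using (tendsto_one_div_add_atTop_nhds_zero_nat (𝕜 := ℝ)).const_mul (4 * (q : ℝ))
  obtain ⟨L, hL⟩ := cauchySeq_tendsto_of_complete hc
  refine ⟨L, hL, fun D ↦ ?_⟩
  rw [abs_sub_comm]
  refine le_of_tendsto ((hL.sub_const _).abs) ?_
  filter_upwards [eventually_ge_atTop D] with n hn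
  exact hle D n hn

end

lemma mul_pow_le_geom_sum (s : ℝ) (n : ℕ) :
    (n + 1) * s ^ n ≤ ∑ i ∈ range (n + 1), (s ^ 2) ^ i := by
  induction n using Nat.twoStepInduction with
  | zero => simp
  | one =>
    simp [sum_range_succ]
    nlinarith [sq_nonneg (s - 1)]
  | more n ih _ =>
    rw [sum_range_succ', sum_range_succ]
    have h1 : ∑ k ∈ range (n + 1), (s ^ 2) ^ (k + 1) = s ^ 2 * ∑ k ∈ range (n + 1), (s ^ 2) ^ k := by
      rw [mul_sum]
      exact sum_congr rfl fun k _ ↦ by ring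
    rw [h1]
    have h2 := mul_le_mul_of_nonneg_left ih (sq_nonneg s)
    have h3 := sq_nonneg (s ^ (n + 2) - 1)
    have h4 : (s ^ 2) ^ (n + 1 + 1) = (s ^ (n + 2)) ^ 2 := by ring
    push_cast
    rw [h4, pow_zero]
    have h5 : s ^ 2 * ((n + 1) * s ^ n) = (n + 1) * s ^ (n + 2) := by ring
    nlinarith

/-- The Lambert-series remainder `1 / (n (1 - t)) - tⁿ / (1 - tⁿ)` with `t = s²`, times `1 - t`,
in index `n = i + 1`. -/
noncomputable def lambertRem (s : ℝ) (i : ℕ) : ℝ :=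
  1 / ((i : ℝ) + 1) - (s ^ 2) ^ (i + 1) / ∑ k ∈ range (i + 1), (s ^ 2) ^ k

lemma geom_sum_pos' {s : ℝ} (i : ℕ) : 0 < ∑ k ∈ range (i + 1), (s ^ 2) ^ k := by
  rw [sum_range_succ']
  positivity

lemma lambertRem_nonneg {s : ℝ} (hs : 0 ≤ s) (hs1 : s ≤ 1) (i : ℕ) : 0 ≤ lambertRem s i := by
  rw [lambertRem, sub_nonneg, div_le_div_iff₀ (geom_sum_pos' i) (by positivity), one_mul]
  refine le_trans ?_ (mul_pow_le_geom_sum s i)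
  rw [mul_comm]
  gcongr
  rw [← pow_mul]
  exact pow_le_pow_of_le_one hs hs1 (by omega)

lemma lambertRem_antitone {s : ℝ} (hs : 0 ≤ s) (hs1 : s ≤ 1) : Antitone (lambertRem s) := by
  refine antitone_nat_of_succ_le fun i ↦ ?_
  have hA := geom_sum_pos' (s := s) i
  have hB := geom_sum_pos' (s := s) (i + 1)
  have hA' := mul_pow_le_geom_sum s i
  have hB' := mul_pow_le_geom_sum s (i + 1)
  have hAB : ∑ k ∈ range (i + 1 + 1), (s ^ 2) ^ k =
      1 + s ^ 2 * ∑ k ∈ range (i + 1), (s ^ 2) ^ k := by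
    rw [sum_range_succ', mul_sum, add_comm, pow_zero]
    congr 1
    exact sum_congr rfl fun k _ ↦ by ring
  rw [lambertRem, lambertRem]
  set A := ∑ k ∈ range (i + 1), (s ^ 2) ^ k
  set B := ∑ k ∈ range (i + 1 + 1), (s ^ 2) ^ k
  have h1 : 1 / ((i : ℝ) + 1) - (s ^ 2) ^ (i + 1) / A -
      (1 / (((i + 1 : ℕ) : ℝ) + 1) - (s ^ 2) ^ (i + 1 + 1) / B) =
      1 / (((i : ℝ) + 1) * (i + 2)) - (s ^ 2) ^ (i + 1) / (A * B) := by
    have e1 : (s ^ 2) ^ (i + 1) / A - (s ^ 2) ^ (i + 1 + 1) / B = (s ^ 2) ^ (i + 1) / (A * B) := by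
      rw [div_sub_div _ _ hA.ne' hB.ne', hAB]
      congr 1
      ring
    have e2 : 1 / ((i : ℝ) + 1) - 1 / (((i + 1 : ℕ) : ℝ) + 1) = 1 / (((i : ℝ) + 1) * (i + 2)) := by
      push_cast
      field_simp
      ring
    linarith
  have h2 : (s ^ 2) ^ (i + 1) / (A * B) ≤ 1 / (((i : ℝ) + 1) * (i + 2)) := by
    rw [div_le_div_iff₀ (by positivity) (by positivity), one_mul]
    have h3 : ((i : ℝ) + 1) * s ^ i * ((((i + 1 : ℕ) : ℝ) + 1) * s ^ (i + 1)) ≤ A * B := by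
      gcongr
    refine le_trans ?_ h3
    have h4 : (s ^ 2) ^ (i + 1) ≤ s ^ i * s ^ (i + 1) := by
      rw [← pow_mul, ← pow_add]
      exact pow_le_pow_of_le_one hs hs1 (by omega)
    push_cast
    calc _ ≤ s ^ i * s ^ (i + 1) * (((i : ℝ) + 1) * (i + 2)) := by gcongr
      _ = _ := by ring
  linarith

end Linnik

namespace Linnik

open Finset Filter Topology

variable {q : ℕ} {ψ : DirichletCharacter ℝ q}

lemma charDivisorSum_eq_sum_antidiagonal (n : ℕ) :
    charDivisorSum ψ n = ∑ p ∈ n.divisorsAntidiagonal, ψ p.1 := by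
  rw [charDivisorSum, Nat.sum_divisorsAntidiagonal (fun i _ ↦ ψ (i : ZMod q))]

lemma sum_charDivisorSum_pow_le (hψ : ψ ^ 2 = 1) {t : ℝ} (ht : 0 ≤ t) (ht1 : t < 1) (R : ℕ) :
    ∑ n ∈ Ioc 0 R, charDivisorSum ψ n * t ^ n ≤
      ∑ d ∈ Ioc 0 R, ψ d * (t ^ d / (1 - t ^ d)) + R * t ^ R / (1 - t) := by
  have h1 : ∑ n ∈ Ioc 0 R, charDivisorSum ψ n * t ^ n =
      ∑ d ∈ Ioc 0 R, ∑ m ∈ Ioc 0 (R / d), ψ d * (t ^ d) ^ m := by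
    trans ∑ n ∈ Ioc 0 R, ∑ p ∈ n.divisorsAntidiagonal, ψ p.1 * (t ^ p.1) ^ p.2
    · refine sum_congr rfl fun n _ ↦ ?_
      rw [charDivisorSum_eq_sum_antidiagonal, sum_mul]
      refine sum_congr rfl fun p hp ↦ ?_
      rw [← pow_mul, (Nat.mem_divisorsAntidiagonal.1 hp).1]
    · rw [sum_Ioc_divisorsAntidiagonal R fun d m ↦ ψ (d : ZMod q) * (t ^ d) ^ m]
      refine sum_congr rfl fun d hd ↦ ?_
      rw [← sum_filter, Ioc_filter_mul_le (mem_Ioc.1 hd).1]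
  have h2 : (R : ℝ) * t ^ R / (1 - t) = ∑ d ∈ Ioc 0 R, t ^ R / (1 - t) := by
    rw [sum_const, Nat.card_Ioc, nsmul_eq_mul, Nat.sub_zero, mul_div_assoc]
  rw [h1, h2, ← sum_add_distrib]
  refine sum_le_sum fun d hd ↦ ?_
  obtain ⟨hd0, hdR⟩ := mem_Ioc.1 hd
  set x := t ^ d with hx
  have hxt : x ≤ t := by
    rw [hx]
    exact pow_le_of_le_one ht ht1.le hd0.ne'
  have hx0 : 0 ≤ x := pow_nonneg ht d
  have hgeom : ∑ m ∈ Ioc 0 (R / d), x ^ m = x / (1 - x) - x ^ (R / d + 1) / (1 - x) := by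
    have h := geom_sum_Ico' (show x ≠ 1 by linarith) (Nat.le_add_left 1 (R / d))
    rw [pow_one] at h
    rw [← sub_div, ← h]
    rfl
  rw [← mul_sum, hgeom, mul_sub]
  have h3 : x ^ (R / d + 1) ≤ t ^ R := by
    rw [hx, ← pow_mul]
    refine pow_le_pow_of_le_one ht ht1.le ?_
    have := Nat.lt_mul_div_succ R hd0
    exact this.le
  have h4 : x ^ (R / d + 1) / (1 - x) ≤ t ^ R / (1 - t) := by
    have : 0 < 1 - t := by linarith
    gcongr
  have h5 : 0 ≤ x ^ (R / d + 1) / (1 - x) := div_nonneg (by positivity) (by linarith)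
  have h6 := abs_le.1 (abs_real_char_le hψ (d : ZMod q))
  nlinarith [h6.1]

lemma sum_sq_le_sum_charDivisorSum (hψ : ψ ^ 2 = 1) {t : ℝ} (ht : 0 ≤ t) {K R : ℕ}
    (hKR : K ^ 2 ≤ R) :
    ∑ m ∈ Ioc 0 K, t ^ m ^ 2 ≤ ∑ n ∈ Ioc 0 R, charDivisorSum ψ n * t ^ n := by
  have h1 : ∑ m ∈ Ioc 0 K, t ^ m ^ 2 ≤ ∑ m ∈ Ioc 0 K, charDivisorSum ψ (m ^ 2) * t ^ m ^ 2 := by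
    refine sum_le_sum fun m hm ↦ ?_
    exact le_mul_of_one_le_left (by positivity)
      (one_le_charDivisorSum_sq hψ (mem_Ioc.1 hm).1.ne')
  refine h1.trans ?_
  have hinj : Set.InjOn (fun m : ℕ ↦ m ^ 2) (Ioc 0 K : Finset ℕ) :=
    fun a _ b _ h ↦ Nat.pow_left_injective (by norm_num) h
  rw [← sum_image (f := fun n ↦ charDivisorSum ψ n * t ^ n) hinj]
  refine sum_le_sum_of_subset_of_nonneg ?_ fun n _ _ ↦
    mul_nonneg (charDivisorSum_nonneg hψ n) (by positivity)
  intro n hn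
  obtain ⟨m, hm, rfl⟩ := mem_image.1 hn
  rw [mem_Ioc] at hm ⊢
  exact ⟨pow_pos hm.1 2, (Nat.pow_le_pow_left hm.2 2).trans hKR⟩

lemma partialL_ge (hψ : ψ ^ 2 = 1) (hB : ∀ m : ℕ, |∑ k ∈ range m, ψ k| ≤ q) {s : ℝ} (hs : 0 ≤ s)
    (hs1 : s < 1) {K R : ℕ} (hKR : K ^ 2 ≤ R) :
    (1 - s ^ 2) * (∑ m ∈ Ioc 0 K, (s ^ 2) ^ m ^ 2 - 2 * q) - R * (s ^ 2) ^ R ≤ partialL ψ R := by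
  have ht1 : s ^ 2 < 1 := by nlinarith
  have h1 := sum_sq_le_sum_charDivisorSum hψ (sq_nonneg s) hKR
  have h2 := sum_charDivisorSum_pow_le hψ (sq_nonneg s) ht1 R
  have h3 := (abs_le.1 (abs_sum_char_mul_le hB (lambertRem_antitone hs hs1.le)
    (lambertRem_nonneg hs hs1.le) 1 R)).1
  have h0 : lambertRem s 0 = 1 - s ^ 2 := by simp [lambertRem]
  have h4 : ∑ i ∈ range R, ψ ((1 + i : ℕ) : ZMod q) * lambertRem s i =
      partialL ψ R - (1 - s ^ 2) * ∑ d ∈ Ioc 0 R, ψ d * ((s ^ 2) ^ d / (1 - (s ^ 2) ^ d)) := by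
    have e1 : partialL ψ R = ∑ i ∈ range R, ψ ((1 + i : ℕ) : ZMod q) * (1 / ((i : ℝ) + 1)) := by
      rw [partialL, sum_range_succ']
      simp [add_comm, div_eq_mul_inv]
    have e2 : ∑ d ∈ Ioc 0 R, ψ d * ((s ^ 2) ^ d / (1 - (s ^ 2) ^ d)) =
        ∑ i ∈ range R, ψ ((1 + i : ℕ) : ZMod q) *
          ((s ^ 2) ^ (i + 1) / (1 - (s ^ 2) ^ (i + 1))) := by
      rw [show Ioc 0 R = Ico (0 + 1) (R + 1) from rfl, ← sum_Ico_add', ← range_eq_Ico]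
      refine sum_congr rfl fun i _ ↦ ?_
      rw [add_comm 1 i]
    rw [e1, e2, mul_sum, ← sum_sub_distrib]
    refine sum_congr rfl fun i _ ↦ ?_
    have e3 : (1 - s ^ 2) * ∑ k ∈ range (i + 1), (s ^ 2) ^ k = 1 - (s ^ 2) ^ (i + 1) :=
      mul_neg_geom_sum _ _
    have e4 := geom_sum_pos' (s := s) i
    have e5 : (1 - s ^ 2) * ((s ^ 2) ^ (i + 1) / (1 - (s ^ 2) ^ (i + 1))) =
        (s ^ 2) ^ (i + 1) / ∑ k ∈ range (i + 1), (s ^ 2) ^ k := by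
      rw [← e3]
      have : (1 - s ^ 2) ≠ 0 := by linarith
      field_simp
    rw [lambertRem, ← e5]
    ring
  rw [h4, h0] at h3
  have h5 : 0 < 1 - s ^ 2 := by linarith
  have h6 := mul_le_mul_of_nonneg_left (h1.trans h2) h5.le
  have h7 : (1 - s ^ 2) * (R * (s ^ 2) ^ R / (1 - s ^ 2)) = R * (s ^ 2) ^ R := by
    field_simp
  rw [mul_add, h7] at h6
  linarith

lemma limit_partialL_ge (hψ : ψ ^ 2 = 1) (hB : ∀ m : ℕ, |∑ k ∈ range m, ψ k| ≤ q) (hq : 0 < q)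
    {L : ℝ} (hL : Tendsto (partialL ψ) atTop (𝓝 L)) : 1 / (128 * q) ≤ L := by
  have hq' : (1 : ℝ) ≤ q := by exact_mod_cast hq
  set ε : ℝ := 1 / (256 * q ^ 2) with hε
  have hε0 : 0 < ε := by positivity
  have hε1 : ε < 1 := by
    rw [hε, div_lt_one (by positivity)]
    nlinarith
  set s := 1 - ε with hs
  have hs0 : 0 ≤ s := by linarith
  have hs1 : s < 1 := by linarith
  have ht1 : s ^ 2 < 1 := by nlinarith
  have ht : 1 - s ^ 2 ≤ 2 * ε := by nlinarith
  have ht' : ε ≤ 1 - s ^ 2 := by nlinarith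
  have hsum : 4 * (q : ℝ) ≤ ∑ m ∈ Ioc 0 (8 * q), (s ^ 2) ^ m ^ 2 := by
    have h1 : (1 : ℝ) / 2 ≤ (s ^ 2) ^ (8 * q) ^ 2 := by
      have h2 := one_add_mul_le_pow (show (-2 : ℝ) ≤ -(1 - s ^ 2) by nlinarith) ((8 * q) ^ 2)
      rw [show 1 + -(1 - s ^ 2) = s ^ 2 by ring] at h2
      refine le_trans ?_ h2
      have h3 : (((8 * q) ^ 2 : ℕ) : ℝ) * (1 - s ^ 2) ≤ ((8 * q) ^ 2 : ℕ) * (2 * ε) := by gcongr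
      have h4 : (((8 * q) ^ 2 : ℕ) : ℝ) * (2 * ε) = 1 / 2 := by
        rw [hε]
        push_cast
        field_simp
        norm_num
      linarith
    calc 4 * (q : ℝ) = ∑ m ∈ Ioc 0 (8 * q), (1 / 2 : ℝ) := by
          rw [sum_const, Nat.card_Ioc, nsmul_eq_mul]
          simp only [Nat.sub_zero]
          push_cast
          ring
      _ ≤ _ := by
          refine sum_le_sum fun m hm ↦ h1.trans ?_
          exact pow_le_pow_of_le_one (sq_nonneg s) ht1.le (Nat.pow_le_pow_left (mem_Ioc.1 hm).2 2)
  have hlim : Tendsto (fun R : ℕ ↦ (1 - s ^ 2) *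
      (∑ m ∈ Ioc 0 (8 * q), (s ^ 2) ^ m ^ 2 - 2 * q) - R * (s ^ 2) ^ R) atTop
      (𝓝 ((1 - s ^ 2) * (∑ m ∈ Ioc 0 (8 * q), (s ^ 2) ^ m ^ 2 - 2 * q) - 0)) :=
    tendsto_const_nhds.sub (tendsto_self_mul_const_pow_of_lt_one (sq_nonneg s) ht1)
  have h := le_of_tendsto_of_tendsto hlim hL (by
    filter_upwards [eventually_ge_atTop ((8 * q) ^ 2)] with R hR
    exact partialL_ge hψ hB hs0 hs1 hR)
  refine le_trans ?_ h
  have h1 : ε * (2 * q) ≤ (1 - s ^ 2) * (∑ m ∈ Ioc 0 (8 * q), (s ^ 2) ^ m ^ 2 - 2 * q) := by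
    gcongr
    linarith
  have h2 : ε * (2 * q) = 1 / (128 * q) := by
    rw [hε]
    field_simp
    norm_num
  linarith

end Linnik

namespace Linnik

open Finset Filter Topology

variable {q : ℕ} {ψ : DirichletCharacter ℝ q}

/-- The number of positive integers up to `N` in a residue class. -/
noncomputable def classCount (N : ℕ) (b : ZMod q) : ℝ :=
  ∑ m ∈ Ioc 0 N, if (m : ZMod q) = b then 1 else 0

lemma abs_classCount_sub_le (hq : 0 < q) (b : ZMod q) {Y : ℝ} (hY : 0 ≤ Y) :
    |classCount ⌊Y⌋₊ b - Y / q| ≤ 2 := by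
  have : NeZero q := ⟨hq.ne'⟩
  have hq' : (1 : ℝ) ≤ q := by exact_mod_cast hq
  set N := ⌊Y⌋₊ with hN
  have h1 : classCount N b = (#{x ∈ Ioc 0 N | x ≡ b.val [MOD q]} : ℝ) := by
    rw [classCount, sum_boole]
    congr 2
    ext m
    simp only [mem_filter, and_congr_right_iff]
    intro _
    rw [← ZMod.natCast_eq_natCast_iff, ZMod.natCast_zmod_val]
  have h2 := Nat.Ioc_filter_modEq_card 0 N hq b.val
  set u : ℚ := (N - b.val) / (q : ℚ) with hu
  set v : ℚ := ((0 : ℕ) - b.val) / (q : ℚ) with hv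
  have huv : u - v = N / (q : ℚ) := by
    rw [hu, hv]
    push_cast
    ring
  have hvu : ⌊v⌋ ≤ ⌊u⌋ := by
    refine Int.floor_mono ?_
    have : (0 : ℚ) ≤ N / (q : ℚ) := by positivity
    linarith
  rw [max_eq_left (by linarith)] at h2
  have h3 : |(#{x ∈ Ioc 0 N | x ≡ b.val [MOD q]} : ℚ) - N / (q : ℚ)| ≤ 1 := by
    have h2' : (#{x ∈ Ioc 0 N | x ≡ b.val [MOD q]} : ℚ) = ⌊u⌋ - ⌊v⌋ := by
      exact_mod_cast h2
    rw [h2', ← huv, abs_le]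
    constructor <;> linarith [Int.floor_le u, Int.lt_floor_add_one u, Int.floor_le v,
      Int.lt_floor_add_one v]
  have h4 : |(#{x ∈ Ioc 0 N | x ≡ b.val [MOD q]} : ℝ) - N / (q : ℝ)| ≤ 1 := by
    have := (Rat.cast_le (K := ℝ)).2 h3
    push_cast at this
    exact this
  have h5 : |(N : ℝ) / q - Y / q| ≤ 1 := by
    rw [← sub_div, abs_div, abs_of_pos (show (0 : ℝ) < q by linarith),
      div_le_one (by linarith), abs_le]
    constructor <;> linarith [Nat.floor_le hY, Nat.lt_floor_add_one Y]
  rw [h1]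
  refine (abs_sub_le _ ((N : ℝ) / q) _).trans ?_
  linarith

/-- The sum of `charDivisorSum ψ` over multiples of the elements of `T` in a residue class. -/
noncomputable def classSum (ψ : DirichletCharacter ℝ q) (T : Finset ℕ) (N : ℕ) (b : ZMod q) : ℝ :=
  ∑ n ∈ Ioc 0 N, if (n : ZMod q) = b ∧ ∀ p ∈ T, p ∣ n then charDivisorSum ψ n else 0

lemma sum_box_of_symm {f : ℕ → ℕ → ℝ} {D N : ℕ} (hD : D ≤ N) (hf : ∀ d m, f d m = f m d)
    (h0 : ∀ d m, D < d → D < m → f d m = 0) :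
    ∑ d ∈ Ioc 0 N, ∑ m ∈ Ioc 0 N, f d m =
      ∑ d ∈ Ioc 0 D, (2 * ∑ m ∈ Ioc 0 N, f d m - ∑ m ∈ Ioc 0 D, f d m) := by
  have hs : ∀ g : ℕ → ℝ, ∑ d ∈ Ioc 0 N, g d = ∑ d ∈ Ioc 0 D, g d + ∑ d ∈ Ioc D N, g d :=
    fun g ↦ (sum_Ioc_consecutive g (Nat.zero_le D) hD).symm
  have h1 : ∑ d ∈ Ioc D N, ∑ m ∈ Ioc 0 N, f d m = ∑ d ∈ Ioc 0 D, ∑ m ∈ Ioc D N, f d m := by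
    rw [sum_comm' (t' := Ioc 0 N) (s' := fun _ ↦ Ioc D N) (by tauto), hs]
    have : ∑ m ∈ Ioc D N, ∑ d ∈ Ioc D N, f d m = 0 :=
      sum_eq_zero fun m hm ↦ sum_eq_zero fun d hd ↦ h0 d m (mem_Ioc.1 hd).1 (mem_Ioc.1 hm).1
    rw [this, add_zero]
    exact sum_congr rfl fun d _ ↦ sum_congr rfl fun m _ ↦ hf m d
  rw [hs, h1, ← sum_add_distrib]
  refine sum_congr rfl fun d _ ↦ ?_
  rw [hs (f d)]
  ring

lemma mul_eq_iff_eq_mul_inv {d m b : ZMod q} (hd : IsUnit d) : d * m = b ↔ m = b * d⁻¹ := by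
  constructor
  · rintro rfl
    rw [mul_comm d m, mul_assoc, ZMod.mul_inv_of_unit d hd, mul_one]
  · rintro rfl
    rw [mul_comm d, mul_assoc, ZMod.inv_mul_of_unit d hd, mul_one]

/-- The hyperbola method in a residue class. -/
lemma abs_classSum_empty_sub_le (hψ : ψ ^ 2 = 1) (hB : ∀ m : ℕ, |∑ k ∈ range m, ψ k| ≤ q)
    (hq : 0 < q) (h00 : ψ 0 = 0) {L : ℝ} (hL : ∀ D : ℕ, |partialL ψ D - L| ≤ 2 * q / (D + 1))
    {b : ZMod q} (hb : ψ b = 1) {Y : ℝ} (hY : 0 ≤ Y) :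
    |classSum ψ ∅ ⌊Y⌋₊ b - 2 * L / q * Y| ≤ 11 * √Y := by
  have hq' : (0 : ℝ) < q := by exact_mod_cast hq
  set N := ⌊Y⌋₊ with hN
  set D := N.sqrt with hD
  have hDN : D ≤ N := Nat.sqrt_le_self N
  have hDY : (D : ℝ) ≤ √Y := by
    refine Real.le_sqrt_of_sq_le ?_
    have h1 : D ^ 2 ≤ N := Nat.sqrt_le' N
    calc ((D : ℝ)) ^ 2 ≤ N := by exact_mod_cast h1
      _ ≤ Y := Nat.floor_le hY
  have hYD : √Y ≤ D + 1 := by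
    rw [Real.sqrt_le_left (by positivity)]
    have h1 : N + 1 ≤ (D + 1) ^ 2 := Nat.succ_le_of_lt (Nat.lt_succ_sqrt' N)
    have h2 : ((N : ℝ) + 1) ≤ ((D : ℝ) + 1) ^ 2 := by exact_mod_cast h1
    linarith [Nat.lt_floor_add_one Y]
  set f : ℕ → ℕ → ℝ := fun d m ↦ if d * m ≤ N then
    if ((d : ZMod q) * m) = b then ψ d else 0 else 0 with hf
  have hsum : classSum ψ ∅ N b = ∑ d ∈ Ioc 0 N, ∑ m ∈ Ioc 0 N, f d m := by
    rw [← sum_Ioc_divisorsAntidiagonal N fun d m ↦ if ((d : ZMod q) * m) = b then ψ d else 0]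
    refine sum_congr rfl fun n _ ↦ ?_
    rw [charDivisorSum_eq_sum_antidiagonal]
    have : ∀ p ∈ n.divisorsAntidiagonal,
        (if ((p.1 : ZMod q) * p.2) = b then ψ (p.1 : ZMod q) else 0) =
          if (n : ZMod q) = b then ψ (p.1 : ZMod q) else 0 := by
      intro p hp
      rw [← Nat.cast_mul, (Nat.mem_divisorsAntidiagonal.1 hp).1]
    rw [sum_congr rfl this]
    by_cases hn : (n : ZMod q) = b <;> simp [hn]
  have hbu : IsUnit b := by
    by_contra h
    rw [ψ.map_nonunit h] at hb
    norm_num at hb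
  have hsymm : ∀ d m, f d m = f m d := by
    intro d m
    simp only [hf]
    rw [mul_comm m d, mul_comm (m : ZMod q) d]
    by_cases h : (d : ZMod q) * m = b
    · have hdu : IsUnit (d : ZMod q) := isUnit_of_mul_isUnit_left (h ▸ hbu)
      have h1 : ψ d * ψ m = 1 := by rw [← map_mul, h, hb]
      have h2 := real_char_mul_self hψ hdu
      have : ψ d = ψ m := by
        have h3 : ψ d ≠ 0 := left_ne_zero_of_mul_eq_one h1
        exact mul_left_cancel₀ h3 (h2.trans h1.symm)
      rw [this]
    · simp [h]
  have hzero : ∀ d m, D < d → D < m → f d m = 0 := by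
    intro d m hd hm
    simp only [hf]
    rw [if_neg]
    push Not
    have : D + 1 ≤ d := hd
    calc N < (D + 1) * (D + 1) := Nat.lt_succ_sqrt N
      _ ≤ d * m := Nat.mul_le_mul hd hm
  have hinner : ∀ d : ℕ, 0 < d → ∀ M : ℕ,
      (∑ m ∈ Ioc 0 M, if ((d : ZMod q) * m) = b then ψ d else 0) =
        ψ d * classCount M (b * (d : ZMod q)⁻¹) := by
    intro d _ M
    rw [classCount, mul_sum]
    refine sum_congr rfl fun m _ ↦ ?_
    by_cases hd : IsUnit (d : ZMod q)
    · simp [mul_eq_iff_eq_mul_inv hd]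
    · simp [ψ.map_nonunit hd]
  have hmain : classSum ψ ∅ N b = ∑ d ∈ Ioc 0 D,
      ψ d * (2 * classCount (N / d) (b * (d : ZMod q)⁻¹) - classCount D (b * (d : ZMod q)⁻¹)) := by
    rw [hsum, sum_box_of_symm hDN hsymm hzero]
    refine sum_congr rfl fun d hd ↦ ?_
    obtain ⟨hd0, hdD⟩ := mem_Ioc.1 hd
    have e1 : ∑ m ∈ Ioc 0 N, f d m = ψ d * classCount (N / d) (b * (d : ZMod q)⁻¹) := by
      rw [← hinner d hd0, ← Ioc_filter_mul_le hd0, sum_filter]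
    have e2 : ∑ m ∈ Ioc 0 D, f d m = ψ d * classCount D (b * (d : ZMod q)⁻¹) := by
      rw [← hinner d hd0]
      refine sum_congr rfl fun m hm ↦ ?_
      simp only [hf]
      rw [if_pos ((Nat.mul_le_mul hdD (mem_Ioc.1 hm).2).trans (Nat.sqrt_le N))]
    rw [e1, e2]
    ring
  have happrox : |classSum ψ ∅ N b - ∑ d ∈ Ioc 0 D, ψ d * (2 * (Y / d / q) - D / q)| ≤ 6 * D := by
    rw [hmain, ← sum_sub_distrib]
    refine (abs_sum_le_sum_abs _ _).trans ?_
    have : ∀ d ∈ Ioc 0 D, |ψ d * (2 * classCount (N / d) (b * (d : ZMod q)⁻¹) -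
        classCount D (b * (d : ZMod q)⁻¹)) - ψ d * (2 * (Y / d / q) - D / q)| ≤ 6 := by
      intro d hd
      have h1 := abs_le.1 (abs_classCount_sub_le hq (b * (d : ZMod q)⁻¹)
        (show 0 ≤ Y / d by positivity))
      rw [Nat.floor_div_natCast] at h1
      have h2 := abs_le.1 (abs_classCount_sub_le hq (b * (d : ZMod q)⁻¹)
        (show (0 : ℝ) ≤ (D : ℝ) by positivity))
      rw [Nat.floor_natCast] at h2
      rw [← mul_sub, abs_mul]
      refine (mul_le_of_le_one_left (abs_nonneg _) (abs_real_char_le hψ _)).trans ?_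
      rw [abs_le]
      constructor <;> linarith [h1.1, h1.2, h2.1, h2.2]
    refine (sum_le_card_nsmul _ _ _ this).trans (le_of_eq ?_)
    rw [Nat.card_Ioc, nsmul_eq_mul, Nat.sub_zero, mul_comm]
  have hsumD : ∀ g : ℕ → ℝ, ∑ d ∈ Ioc 0 D, ψ d * g d = ∑ d ∈ range (D + 1), ψ d * g d := by
    intro g
    rw [range_eq_Ico, sum_eq_sum_Ico_succ_bot (by omega), Nat.cast_zero, h00, zero_mul, zero_add]
    rfl
  have hval : ∑ d ∈ Ioc 0 D, ψ d * (2 * (Y / d / q) - D / q) =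
      2 * Y / q * partialL ψ D - D / q * ∑ d ∈ range (D + 1), ψ d := by
    rw [hsumD fun d ↦ 2 * (Y / d / q) - D / q, partialL, mul_sum, mul_sum, ← sum_sub_distrib]
    refine sum_congr rfl fun d _ ↦ ?_
    ring
  have h1 : |2 * Y / q * partialL ψ D - 2 * L / q * Y| ≤ 4 * √Y := by
    have e : 2 * Y / q * partialL ψ D - 2 * L / q * Y = 2 * Y / q * (partialL ψ D - L) := by ring
    rw [e, abs_mul, abs_of_nonneg (show 0 ≤ 2 * Y / q by positivity)]
    calc _ ≤ 2 * Y / q * (2 * q / (D + 1)) := by gcongr; exact hL D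
      _ = 4 * (Y / (D + 1)) := by field_simp; ring
      _ ≤ 4 * √Y := by
        gcongr
        rw [div_le_iff₀ (by positivity)]
        calc Y = √Y * √Y := (Real.mul_self_sqrt hY).symm
          _ ≤ _ := by gcongr
  have h2 : |(D : ℝ) / q * ∑ d ∈ range (D + 1), ψ d| ≤ D := by
    rw [abs_mul, abs_of_nonneg (show 0 ≤ (D : ℝ) / q by positivity)]
    calc _ ≤ (D : ℝ) / q * q := by gcongr; exact hB _
      _ = D := by field_simp
  rw [hval] at happrox
  rw [abs_le] at *
  constructor <;> linarith [happrox.1, happrox.2, h1.1, h1.2, h2.1, h2.2]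

end Linnik

namespace Linnik

open Finset Filter Topology

lemma sum_Ioc_ite_dvd {M : Type*} [AddCommMonoid M] {p : ℕ} (hp : 0 < p) (N : ℕ) (g : ℕ → M) :
    (∑ n ∈ Ioc 0 N, if p ∣ n then g n else 0) = ∑ m ∈ Ioc 0 (N / p), g (p * m) := by
  rw [← sum_filter]
  symm
  refine sum_nbij (fun m ↦ p * m) (fun m hm ↦ ?_) (fun a _ b _ h ↦ ?_) (fun n hn ↦ ?_)
    fun m _ ↦ rfl
  · rw [mem_Ioc, Nat.le_div_iff_mul_le hp] at hm
    rw [mem_filter, mem_Ioc]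
    exact ⟨⟨Nat.mul_pos hp hm.1, by rw [mul_comm]; exact hm.2⟩, dvd_mul_right _ _⟩
  · exact Nat.eq_of_mul_eq_mul_left hp h
  · rw [mem_coe, mem_filter, mem_Ioc] at hn
    obtain ⟨⟨h1, h2⟩, k, rfl⟩ := hn
    refine ⟨k, ?_, rfl⟩
    rw [mem_coe, mem_Ioc, Nat.le_div_iff_mul_le hp, mul_comm]
    exact ⟨Nat.pos_of_mul_pos_left h1, h2⟩

variable {q : ℕ} {ψ : DirichletCharacter ℝ q}

lemma classSum_insert {p : ℕ} (hp : p.Prime) (hpu : IsUnit (p : ZMod q)) {T : Finset ℕ}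
    (hT : ∀ r ∈ T, r.Prime) (hpT : p ∉ T) (N : ℕ) (b : ZMod q) :
    classSum ψ (insert p T) N b =
      (1 + ψ p) * classSum ψ T (N / p) (b * (p : ZMod q)⁻¹) -
        ψ p * classSum ψ T (N / p / p) (b * (p : ZMod q)⁻¹ * (p : ZMod q)⁻¹) := by
  have hdvd : ∀ m, (∀ r ∈ T, r ∣ p * m) ↔ ∀ r ∈ T, r ∣ m := by
    intro m
    refine forall₂_congr fun r hr ↦ ?_
    have hc : r.Coprime p := (Nat.coprime_primes (hT r hr) hp).2 fun h ↦ hpT (h ▸ hr)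
    exact hc.dvd_mul_left
  have hcond : ∀ (c : ZMod q) (m : ℕ), ((p * m : ℕ) : ZMod q) = c ↔
      (m : ZMod q) = c * (p : ZMod q)⁻¹ := by
    intro c m
    rw [Nat.cast_mul, mul_eq_iff_eq_mul_inv hpu]
  have h1 : classSum ψ (insert p T) N b = ∑ m ∈ Ioc 0 (N / p),
      if (m : ZMod q) = b * (p : ZMod q)⁻¹ ∧ ∀ r ∈ T, r ∣ m then charDivisorSum ψ (p * m) else 0 := by
    have e : ∀ n : ℕ, (if (n : ZMod q) = b ∧ ∀ r ∈ insert p T, r ∣ n then charDivisorSum ψ n else 0) =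
        if p ∣ n then (if (n : ZMod q) = b ∧ ∀ r ∈ T, r ∣ n then charDivisorSum ψ n else 0)
          else 0 := by
      intro n
      rw [← ite_and]
      refine if_congr ?_ rfl rfl
      rw [forall_mem_insert]
      tauto
    rw [classSum, sum_congr rfl fun n _ ↦ e n, sum_Ioc_ite_dvd hp.pos]
    refine sum_congr rfl fun m _ ↦ ?_
    refine if_congr ?_ rfl rfl
    rw [hcond, hdvd]
  have h2 : classSum ψ T (N / p / p) (b * (p : ZMod q)⁻¹ * (p : ZMod q)⁻¹) =
      ∑ m ∈ Ioc 0 (N / p), if p ∣ m then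
        (if (m : ZMod q) = b * (p : ZMod q)⁻¹ ∧ ∀ r ∈ T, r ∣ m then charDivisorSum ψ (m / p) else 0)
          else 0 := by
    rw [sum_Ioc_ite_dvd hp.pos]
    refine sum_congr rfl fun m _ ↦ ?_
    rw [Nat.mul_div_cancel_left _ hp.pos]
    refine if_congr ?_ rfl rfl
    rw [hcond, hdvd]
  rw [h1, h2, classSum, mul_sum, mul_sum, ← sum_sub_distrib]
  refine sum_congr rfl fun m _ ↦ ?_
  rw [charDivisorSum_prime_mul hp]
  by_cases hm : (m : ZMod q) = b * (p : ZMod q)⁻¹ ∧ ∀ r ∈ T, r ∣ m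
  · simp only [if_pos hm]
  · simp only [if_neg hm, mul_zero, ite_self, sub_zero]

/-- The local density of `charDivisorSum ψ` at multiples of `p`. -/
noncomputable def localDensity (ψ : DirichletCharacter ℝ q) (p : ℕ) : ℝ :=
  (1 + ψ p) / p - ψ p / p ^ 2

/-- The level of distribution of `charDivisorSum ψ` in a residue class. -/
lemma abs_classSum_sub_le (hψ : ψ ^ 2 = 1) (hB : ∀ m : ℕ, |∑ k ∈ range m, ψ k| ≤ q)
    (hq : 0 < q) (h00 : ψ 0 = 0) {L : ℝ} (hL : ∀ D : ℕ, |partialL ψ D - L| ≤ 2 * q / (D + 1))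
    {T : Finset ℕ} (hT : ∀ p ∈ T, p.Prime ∧ ¬ p ∣ q) :
    ∀ {b : ZMod q}, ψ b = 1 → ∀ {Y : ℝ}, 0 ≤ Y →
    |classSum ψ T ⌊Y⌋₊ b - 2 * L / q * Y * ∏ p ∈ T, localDensity ψ p| ≤
      11 * 3 ^ #T * √(Y / ∏ p ∈ T, (p : ℝ)) := by
  induction T using Finset.induction with
  | empty =>
    intro b hb Y hY
    simpa using abs_classSum_empty_sub_le hψ hB hq h00 hL hb hY
  | insert p T hpT ih =>
    intro b hb Y hY
    have hT' : ∀ r ∈ T, r.Prime ∧ ¬ r ∣ q := fun r hr ↦ hT r (mem_insert_of_mem hr)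
    obtain ⟨hp, hpq⟩ := hT p (mem_insert_self _ _)
    have hpu : IsUnit (p : ZMod q) :=
      (ZMod.isUnit_iff_coprime p q).2 ((Nat.Prime.coprime_iff_not_dvd hp).2 hpq)
    have hinv : (p : ZMod q)⁻¹ * p = 1 := ZMod.inv_mul_of_unit _ hpu
    have hψinv : ψ (p : ZMod q)⁻¹ = ψ p := by
      have h1 : ψ (p : ZMod q)⁻¹ * ψ p = 1 := by rw [← map_mul, hinv, map_one]
      have h2 := real_char_mul_self hψ hpu
      exact mul_right_cancel₀ (right_ne_zero_of_mul_eq_one h1) (h1.trans h2.symm)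
    have hp0 : (0 : ℝ) < p := by exact_mod_cast hp.pos
    have hp1 : (1 : ℝ) ≤ p := by exact_mod_cast hp.one_le
    have hP : 0 < ∏ r ∈ T, (r : ℝ) := prod_pos fun r hr ↦ by exact_mod_cast (hT' r hr).1.pos
    have hA2 := ih hT' (b := b * (p : ZMod q)⁻¹ * (p : ZMod q)⁻¹)
      (by rw [map_mul, map_mul, hb, one_mul, hψinv, real_char_mul_self hψ hpu])
      (Y := Y / p / p) (by positivity)
    rw [Nat.floor_div_natCast, Nat.floor_div_natCast] at hA2
    rw [classSum_insert hp hpu (fun r hr ↦ (hT' r hr).1) hpT, prod_insert hpT, prod_insert hpT,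
      card_insert_of_notMem hpT]
    set A₂ := classSum ψ T (⌊Y⌋₊ / p / p) (b * (p : ZMod q)⁻¹ * (p : ZMod q)⁻¹)
    set A₁ := classSum ψ T (⌊Y⌋₊ / p) (b * (p : ZMod q)⁻¹) with hA₁
    set G := ∏ r ∈ T, localDensity ψ r
    set W := √(Y / (p * ∏ r ∈ T, (r : ℝ))) with hW
    have hW1 : √(Y / p / ∏ r ∈ T, (r : ℝ)) = W := by rw [hW, div_div]
    have hW2 : √(Y / p / p / ∏ r ∈ T, (r : ℝ)) ≤ W := by
      rw [hW, div_div (Y / p), div_right_comm]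
      refine Real.sqrt_le_sqrt ?_
      exact div_le_self (by positivity) hp1
    have hE2 : |A₂ - 2 * L / q * (Y / p / p) * G| ≤ 11 * 3 ^ #T * W := hA2.trans (by gcongr)
    have hpow : (11 : ℝ) * 3 ^ (#T + 1) * W = 3 * (11 * 3 ^ #T * W) := by ring
    rw [hpow]
    rcases mul_self_eq_one_iff.1 (real_char_mul_self hψ hpu) with h | h
    · have hA1 := ih hT' (b := b * (p : ZMod q)⁻¹) (by rw [map_mul, hb, one_mul, hψinv, h])
        (Y := Y / p) (by positivity)
      rw [Nat.floor_div_natCast, hW1, ← hA₁] at hA1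
      have e : (1 + ψ p) * A₁ - ψ p * A₂ - 2 * L / q * Y * (localDensity ψ p * G) =
          2 * (A₁ - 2 * L / q * (Y / p) * G) - (A₂ - 2 * L / q * (Y / p / p) * G) := by
        rw [localDensity, h]
        field_simp
        ring
      rw [e]
      rw [abs_le] at *
      constructor <;> linarith [hA1.1, hA1.2, hE2.1, hE2.2]
    · have e : (1 + ψ p) * A₁ - ψ p * A₂ - 2 * L / q * Y * (localDensity ψ p * G) =
          A₂ - 2 * L / q * (Y / p / p) * G := by
        rw [localDensity, h]
        field_simp
        ring
      rw [e]
      have : 0 ≤ 11 * 3 ^ #T * W := by positivity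
      linarith

end Linnik

namespace Linnik

open Finset Filter Topology

variable {q : ℕ} {ψ : DirichletCharacter ℝ q}

lemma one_sub_localDensity (ψ : DirichletCharacter ℝ q) {p : ℕ} (hp : p.Prime) :
    1 - localDensity ψ p = (1 - (p : ℝ)⁻¹) * (1 - ψ p / p) := by
  have : (p : ℝ) ≠ 0 := by exact_mod_cast hp.ne_zero
  rw [localDensity]
  field_simp
  ring

lemma localDensity_bounds (hψ : ψ ^ 2 = 1) {p : ℕ} (hp : p.Prime) :
    0 ≤ localDensity ψ p ∧ localDensity ψ p ≤ 1 ∧ localDensity ψ p ≤ 2 / p := by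
  have hp2 : (2 : ℝ) ≤ p := by exact_mod_cast hp.two_le
  have hp0 : (0 : ℝ) < p := by linarith
  have e : localDensity ψ p = ((1 + ψ p) * p - ψ p) / p ^ 2 := by
    rw [localDensity]
    field_simp
  have e2 : (2 : ℝ) / p = 2 * p / p ^ 2 := by
    field_simp
  rw [e, e2, div_le_one (by positivity)]
  refine ⟨div_nonneg ?_ (by positivity), ?_, ?_⟩
  · rcases real_char_cases hψ (p : ZMod q) with h | h | h <;> rw [h] <;> linarith
  · rcases real_char_cases hψ (p : ZMod q) with h | h | h <;> rw [h] <;> nlinarith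
  · refine div_le_div_of_nonneg_right ?_ (by positivity)
    rcases real_char_cases hψ (p : ZMod q) with h | h | h <;> rw [h] <;> linarith

/-- The part of `classSum` supported on integers free of prime factors in `P`. -/
noncomputable def siftedSum (ψ : DirichletCharacter ℝ q) (P U : Finset ℕ) (N : ℕ) (b : ZMod q) :
    ℝ :=
  ∑ n ∈ Ioc 0 N, if ((n : ZMod q) = b ∧ ∀ p ∈ U, p ∣ n) ∧ ∀ p ∈ P, ¬ p ∣ n then
    charDivisorSum ψ n else 0

lemma three_pow_card_le {T : Finset ℕ} (hT : ∀ p ∈ T, p.Prime) :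
    (3 : ℝ) ^ #T ≤ (∏ p ∈ T, (p : ℝ)) ^ 2 := by
  rw [← prod_pow, ← prod_const]
  refine prod_le_prod (fun _ _ ↦ by norm_num) fun p hp ↦ ?_
  have : (2 : ℝ) ≤ p := by exact_mod_cast (hT p hp).two_le
  nlinarith

lemma siftedSum_approx (hψ : ψ ^ 2 = 1) (hB : ∀ m : ℕ, |∑ k ∈ range m, ψ k| ≤ q)
    (hq : 0 < q) (h00 : ψ 0 = 0) {L : ℝ} (hL : ∀ D : ℕ, |partialL ψ D - L| ≤ 2 * q / (D + 1))
    (hL0 : 0 ≤ L) {P U : Finset ℕ} (hP : ∀ p ∈ P, p.Prime ∧ ¬ p ∣ q)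
    (hU : ∀ p ∈ U, p.Prime ∧ ¬ p ∣ q) (hUP : Disjoint U P) {D E : ℝ} {lp lm : Finset ℕ → ℝ}
    (hD : 0 ≤ D) (H : SievePair P (localDensity ψ) D E lp lm) {b : ZMod q} (hb : ψ b = 1) (N : ℕ) :
    |siftedSum ψ P U N b - 2 * L / q * N * (∏ p ∈ U, localDensity ψ p) *
        ∏ p ∈ P, (1 - localDensity ψ p)| ≤
      E * (2 * L / q * N * ∏ p ∈ U, localDensity ψ p) * ∏ p ∈ P, (1 - localDensity ψ p) +
        D * (11 * 3 ^ #U * D ^ 2 * √(N / ∏ p ∈ U, (p : ℝ))) := by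
  set w : ℕ → ℝ := fun n ↦ if n ∈ Ioc 0 N ∧ (n : ZMod q) = b ∧ ∀ p ∈ U, p ∣ n then
    charDivisorSum ψ n else 0 with hw
  have hw0 : ∀ n, 0 ≤ w n := by
    intro n
    simp only [hw]
    split_ifs
    exacts [charDivisorSum_nonneg hψ n, le_rfl]
  have hfin : ∀ n ∉ Ioc 0 N, w n = 0 := fun n hn ↦ if_neg fun h ↦ hn h.1
  have hsum : Summable w := summable_of_ne_finset_zero hfin
  have hg : ∀ p, p.Prime → 0 ≤ localDensity ψ p := fun p hp ↦ (localDensity_bounds hψ hp).1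
  have key := H.bound (fun p hp ↦ (hP p hp).1) hD hw0 hsum
    (M := 2 * L / q * N * ∏ p ∈ U, localDensity ψ p)
    (R := 11 * 3 ^ #U * D ^ 2 * √(N / ∏ p ∈ U, (p : ℝ)))
    (mul_nonneg (by positivity) (prod_nonneg fun p hp ↦ hg p (hU p hp).1)) (by positivity) ?_
  · convert key using 2
    rw [tsum_eq_sum (s := Ioc 0 N) fun n hn ↦ by rw [hfin n hn, ite_self], siftedSum]
    congr 1
    refine sum_congr rfl fun n hn ↦ ?_
    simp only [hw, hn, true_and]
    rw [← ite_and]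
    exact if_congr and_comm rfl rfl
  · intro T hT hTD
    have hT' : ∀ p ∈ T, p.Prime ∧ ¬ p ∣ q := fun p hp ↦ hP p (hT hp)
    have hdis : Disjoint U T := hUP.mono_right hT
    have h := abs_classSum_sub_le hψ hB hq h00 hL (T := U ∪ T)
      (fun p hp ↦ (mem_union.1 hp).elim (hU p) (hT' p)) hb (Y := N) (Nat.cast_nonneg N)
    rw [Nat.floor_natCast, prod_union hdis, prod_union hdis, card_union_of_disjoint hdis,
      ← mul_assoc (2 * L / q * N)] at h
    have e : (∑' n, if ∀ p ∈ T, p ∣ n then w n else 0) = classSum ψ (U ∪ T) N b := by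
      rw [tsum_eq_sum (s := Ioc 0 N) fun n hn ↦ by rw [hfin n hn, ite_self], classSum]
      refine sum_congr rfl fun n hn ↦ ?_
      simp only [hw, hn, true_and]
      rw [← ite_and]
      refine if_congr ?_ rfl rfl
      rw [forall_mem_union]
      tauto
    rw [e]
    refine h.trans ?_
    have hU0 : 0 < ∏ p ∈ U, (p : ℝ) := prod_pos fun p hp ↦ by exact_mod_cast (hU p hp).1.pos
    have hT1 : 1 ≤ ∏ p ∈ T, (p : ℝ) := by
      have : 1 ≤ ∏ p ∈ T, p := Nat.one_le_iff_ne_zero.2 (prod_ne_zero_iff.2 fun p hp ↦ (hT' p hp).1.ne_zero)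
      rw [← Nat.cast_prod]
      exact_mod_cast this
    have h3 : (3 : ℝ) ^ #T ≤ D ^ 2 := (three_pow_card_le fun p hp ↦ (hT' p hp).1).trans (by gcongr)
    have h4 : √(N / ((∏ p ∈ U, (p : ℝ)) * ∏ p ∈ T, (p : ℝ))) ≤ √(N / ∏ p ∈ U, (p : ℝ)) := by
      refine Real.sqrt_le_sqrt ?_
      rw [← div_div]
      exact div_le_self (by positivity) hT1
    rw [pow_add, ← mul_assoc (11 : ℝ)]
    gcongr

/-- The primes in `(z, M]` not dividing `q`. -/
def midPrimes (q z M : ℕ) : Finset ℕ := {p ∈ Ioc z M | p.Prime ∧ ¬ p ∣ q}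

lemma siftedSum_empty_le [NeZero q] (hψ : ψ ^ 2 = 1) {b : ZMod q} (hb : IsUnit b) {z M N : ℕ}
    (hN : N ≤ M ^ 2) (h : ∀ p : ℕ, p.Prime → (p : ZMod q) = b → N < p) :
    siftedSum ψ (sievePrimes (fun p ↦ ¬ p ∣ q) z) ∅ N b ≤
      1 + ∑ p ∈ midPrimes q z M, siftedSum ψ (sievePrimes (fun p ↦ ¬ p ∣ q) z) {p} N b := by
  have hone : (1 : ℝ) ≥ ∑ n ∈ Ioc 0 N, if n = 1 then (1 : ℝ) else 0 := by
    rw [sum_ite_eq']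
    split_ifs <;> norm_num
  refine le_trans ?_ (add_le_add_left hone _)
  simp only [siftedSum]
  rw [sum_comm, ← sum_add_distrib]
  refine sum_le_sum fun n hn ↦ ?_
  have hnn : 0 ≤ charDivisorSum ψ n := charDivisorSum_nonneg hψ n
  have hterm : ∀ p : ℕ, 0 ≤ if ((n : ZMod q) = b ∧ ∀ r ∈ ({p} : Finset ℕ), r ∣ n) ∧
      ∀ r ∈ sievePrimes (fun p ↦ ¬ p ∣ q) z, ¬ r ∣ n then charDivisorSum ψ n else 0 := by
    intro p
    split_ifs
    exacts [hnn, le_rfl]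
  have hs := sum_nonneg fun p (_ : p ∈ midPrimes q z M) ↦ hterm p
  rw [mem_Ioc] at hn
  split_ifs with h1 h2 h2
  · refine le_add_of_le_of_nonneg ?_ hs
    rw [h2, charDivisorSum_one]
  · obtain ⟨⟨hnb, -⟩, hn2⟩ := h1
    have hrough := (isRough_iff_of_isUnit hb (by omega) hnb).2 hn2
    have hpr := Nat.minFac_prime h2
    have hd := Nat.minFac_dvd n
    have hnp : ¬ n.Prime := fun hp ↦ absurd (h n hp hnb) (not_lt.2 hn.2)
    have hcop : Nat.Coprime n q := (ZMod.isUnit_iff_coprime n q).1 (hnb ▸ hb)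
    have hmem : n.minFac ∈ midPrimes q z M := by
      rw [midPrimes, mem_filter, mem_Ioc]
      refine ⟨⟨hrough.2 _ hpr hd, ?_⟩, hpr, fun hq ↦ ?_⟩
      · have := (Nat.minFac_sq_le_self hn.1 hnp).trans (hn.2.trans hN)
        exact (Nat.pow_le_pow_iff_left two_ne_zero).1 this
      · exact hpr.one_lt.ne' (Nat.dvd_one.1 (hcop ▸ Nat.dvd_gcd hd hq))
    have := single_le_sum (fun p _ ↦ hterm p) hmem
    rw [zero_add]
    refine le_trans ?_ this
    rw [if_pos ⟨⟨hnb, fun r hr ↦ by rw [mem_singleton.1 hr]; exact hd⟩, hn2⟩]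
  · exact add_nonneg zero_le_one hs
  · exact add_nonneg le_rfl hs

end Linnik

namespace Linnik

open Finset Filter Topology
open scoped ArithmeticFunction.vonMangoldt

variable {q : ℕ} {ψ : DirichletCharacter ℝ q}

lemma prod_Ioc_one_sub_inv {z : ℕ} (hz : 1 ≤ z) :
    ∏ n ∈ Ioc 1 z, (1 - (n : ℝ)⁻¹) = (z : ℝ)⁻¹ := by
  induction z, hz using Nat.le_induction with
  | base => simp
  | succ n hn ih =>
    have h0 : (n : ℝ) ≠ 0 := by positivity
    rw [prod_Ioc_succ_top hn, ih]
    push_cast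
    field_simp
    ring

lemma inv_sq_le_prod_one_sub_localDensity (hψ : ψ ^ 2 = 1) {z : ℕ} (hz : 1 ≤ z) :
    ((z : ℝ) ^ 2)⁻¹ ≤ ∏ p ∈ sievePrimes (fun p ↦ ¬ p ∣ q) z, (1 - localDensity ψ p) := by
  have hinv : ∀ n : ℕ, 0 ≤ 1 - (n : ℝ)⁻¹ := by
    intro n
    have := Nat.cast_inv_le_one (α := ℝ) n
    linarith
  have hsub : sievePrimes (fun p ↦ ¬ p ∣ q) z ⊆ Ioc 1 z := by
    intro p hp
    obtain ⟨h1, h2, -⟩ := mem_sievePrimes.1 hp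
    exact mem_Ioc.2 ⟨h2.one_lt, h1⟩
  have h1 : (z : ℝ)⁻¹ ≤ ∏ p ∈ sievePrimes (fun p ↦ ¬ p ∣ q) z, (1 - (p : ℝ)⁻¹) := by
    rw [← prod_Ioc_one_sub_inv hz, ← prod_sdiff hsub]
    refine mul_le_of_le_one_left (prod_nonneg fun p _ ↦ hinv p)
      (prod_le_one (fun p _ ↦ hinv p) fun p _ ↦ ?_)
    have : (0 : ℝ) ≤ (p : ℝ)⁻¹ := by positivity
    linarith
  calc ((z : ℝ) ^ 2)⁻¹ = ((z : ℝ)⁻¹) ^ 2 := by rw [inv_pow]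
    _ ≤ (∏ p ∈ sievePrimes (fun p ↦ ¬ p ∣ q) z, (1 - (p : ℝ)⁻¹)) ^ 2 := by gcongr
    _ = ∏ p ∈ sievePrimes (fun p ↦ ¬ p ∣ q) z, (1 - (p : ℝ)⁻¹) ^ 2 := (prod_pow _ _ _).symm
    _ ≤ _ := by
      refine prod_le_prod (fun p _ ↦ sq_nonneg _) fun p hp ↦ ?_
      rw [one_sub_localDensity ψ (mem_sievePrimes.1 hp).2.1, sq]
      refine mul_le_mul_of_nonneg_left ?_ (hinv p)
      rw [inv_eq_one_div]
      have : ψ p ≤ 1 := (abs_le.1 (abs_real_char_le hψ _)).2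
      gcongr

lemma sum_midPrimes_le {χ : DirichletCharacter ℂ q} (hψ : ψ ^ 2 = 1)
    (hχ : ∀ b, χ b = (ψ b : ℂ)) {z M : ℕ} (hz : 1 < z) {X : ℝ} (hX : 0 < X)
    (hM : Real.log M ≤ X / 2) :
    ∑ p ∈ midPrimes q z M, (1 + ψ p) / p ≤ Real.exp (1 / 2) / Real.log z *
      (psiZeta 0 (1 + 1 / X) + (psiSum χ 0 (1 + 1 / X : ℝ)).re) := by
  have hlogz : 0 < Real.log z := Real.log_pos (by exact_mod_cast hz)
  have hσ : 1 < 1 + 1 / X := by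
    have : 0 < 1 / X := by positivity
    linarith
  set σ := 1 + 1 / X with hσdef
  have hψ1 : ∀ b, 0 ≤ 1 + ψ b := fun b ↦ by linarith [(abs_le.1 (abs_real_char_le hψ b)).1]
  have hsum := (summable_psi 0 hσ).add (summable_re_psi χ 0 hσ)
  have e : ∀ n : ℕ, Λ n * Real.log n ^ 0 * (n : ℝ) ^ (-σ) +
      (χ n).re * (Λ n * Real.log n ^ 0 * (n : ℝ) ^ (-σ)) =
      (1 + ψ n) * (Λ n * Real.log n ^ 0 * (n : ℝ) ^ (-σ)) := by
    intro n
    rw [hχ, Complex.ofReal_re]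
    ring
  have hfin := hsum.sum_le_tsum (midPrimes q z M) fun n _ ↦ by
    rw [e]
    exact mul_nonneg (hψ1 _) (psi_term_nonneg 0 n σ)
  rw [(summable_psi 0 hσ).tsum_add (summable_re_psi χ 0 hσ), ← re_psiSum χ 0 hσ, ← psiZeta,
    sum_congr rfl fun n _ ↦ e n] at hfin
  refine le_trans ?_ (mul_le_mul_of_nonneg_left hfin (by positivity))
  rw [mul_sum]
  refine sum_le_sum fun p hp ↦ ?_
  rw [midPrimes, mem_filter, mem_Ioc] at hp
  obtain ⟨⟨hpz, hpM⟩, hp, -⟩ := hp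
  have hp0 : (0 : ℝ) < p := by exact_mod_cast hp.pos
  have h1 : Real.log z ≤ Real.log p :=
    Real.log_le_log (by exact_mod_cast (by omega : 0 < z)) (by exact_mod_cast hpz.le)
  have h2 : Real.log p ≤ X / 2 := (Real.log_le_log hp0 (by exact_mod_cast hpM)).trans hM
  have h3 : (p : ℝ)⁻¹ ≤ Real.exp (1 / 2) * (p : ℝ) ^ (-σ) := by
    rw [Real.rpow_def_of_pos hp0, ← Real.exp_add, ← Real.exp_log (inv_pos.2 hp0), Real.log_inv,
      Real.exp_le_exp]
    have : Real.log p * (1 / X) ≤ 1 / 2 := by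
      rw [mul_one_div, div_le_iff₀ hX]
      linarith
    rw [hσdef]
    linarith
  rw [ArithmeticFunction.vonMangoldt_apply_prime hp, pow_zero, mul_one]
  calc (1 + ψ p) / p = (1 + ψ p) * (p : ℝ)⁻¹ := div_eq_mul_inv _ _
    _ ≤ (1 + ψ p) * (Real.exp (1 / 2) * (p : ℝ) ^ (-σ)) :=
      mul_le_mul_of_nonneg_left h3 (hψ1 _)
    _ ≤ (1 + ψ p) * (Real.exp (1 / 2) * (p : ℝ) ^ (-σ)) * (Real.log p / Real.log z) := by
      refine le_mul_of_one_le_right (mul_nonneg (hψ1 _) (by positivity)) ?_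
      rwa [one_le_div hlogz]
    _ = _ := by ring

lemma sum_localDensity_midPrimes_le {χ : DirichletCharacter ℂ q} (hψ : ψ ^ 2 = 1)
    (hχ : ∀ b, χ b = (ψ b : ℂ)) {z M : ℕ} (hz : 1 < z) (hzM : z ≤ M) {X : ℝ} (hX : 0 < X)
    (hM : Real.log M ≤ X / 2) :
    ∑ p ∈ midPrimes q z M, localDensity ψ p ≤ Real.exp (1 / 2) / Real.log z *
      (psiZeta 0 (1 + 1 / X) + (psiSum χ 0 (1 + 1 / X : ℝ)).re) + (z : ℝ)⁻¹ := by
  have h1 : ∑ p ∈ midPrimes q z M, ((p : ℝ) ^ 2)⁻¹ ≤ (z : ℝ)⁻¹ := by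
    refine (sum_le_sum_of_subset_of_nonneg (filter_subset _ _) fun _ _ _ ↦ by positivity).trans
      ((sum_Ioc_inv_sq_le_sub (by omega) hzM).trans ?_)
    have : (0 : ℝ) ≤ (M : ℝ)⁻¹ := by positivity
    linarith
  refine le_trans ?_ (add_le_add (sum_midPrimes_le hψ hχ hz hX hM) h1)
  rw [← sum_add_distrib]
  refine sum_le_sum fun p _ ↦ ?_
  have : -1 ≤ ψ p := (abs_le.1 (abs_real_char_le hψ _)).1
  have h2 : 0 ≤ (1 + ψ p) * ((p : ℝ) ^ 2)⁻¹ := mul_nonneg (by linarith) (by positivity)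
  rw [localDensity, div_eq_mul_inv (ψ p)]
  linarith

end Linnik

namespace Linnik

open Finset Filter Topology

open Params (scale)

lemma truncErr_twenty_le : 2 * truncErr 4.2 20 ≤ 1 / 200 := by
  have h1 : Real.exp (2 * 4.2) ≤ 2.72 ^ 9 := by
    calc Real.exp (2 * 4.2) ≤ Real.exp ((9 : ℕ) * 1) := Real.exp_le_exp.2 (by norm_num)
      _ = Real.exp 1 ^ 9 := Real.exp_nat_mul _ _
      _ ≤ 2.72 ^ 9 := by
        gcongr
        exact Real.exp_one_lt_d9.le.trans (by norm_num)
  rw [truncErr]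
  calc _ ≤ 2 * ((2.72 : ℝ) ^ 9 * 4.2 ^ (20 + 1) / (20 + 1).factorial) := by gcongr
    _ ≤ _ := by norm_num [Nat.factorial]

lemma sum_Ioc_inv_sqrt_le (M : ℕ) : ∑ n ∈ Ioc 0 M, (√(n : ℝ))⁻¹ ≤ 2 * √M := by
  induction M with
  | zero => simp
  | succ n ih =>
    rw [sum_Ioc_succ_top (Nat.zero_le n)]
    have h0 : 0 < √((n + 1 : ℕ) : ℝ) := Real.sqrt_pos.2 (by positivity)
    have h1 : √((n + 1 : ℕ) : ℝ) ^ 2 = n + 1 := by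
      rw [Real.sq_sqrt (by positivity)]
      push_cast
      ring
    have h2 : √(n : ℝ) ^ 2 = n := Real.sq_sqrt (by positivity)
    have h3 : (√((n + 1 : ℕ) : ℝ))⁻¹ ≤ 2 * √((n + 1 : ℕ) : ℝ) - 2 * √(n : ℝ) := by
      rw [inv_le_iff_one_le_mul₀ h0]
      nlinarith [sq_nonneg (√((n + 1 : ℕ) : ℝ) - √(n : ℝ))]
    linarith

variable {q y t : ℕ}

lemma psi_sum_le_of_exceptional (H : Params q y t) {χ : DirichletCharacter ℂ q} {β : ℝ}
    (hβ : β < 1) (hβ' : (1 - β) * Real.log q < 5 / 10 ^ 11)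
    (hζ : psiZeta 0 (1 + 1 / scale y t) ≤ scale y t + Real.log q)
    (hχ : (psiSum χ 0 (1 + 1 / scale y t : ℝ)).re ≤
      25 * Real.log q - (1 + 1 / scale y t - β)⁻¹) :
    psiZeta 0 (1 + 1 / scale y t) + (psiSum χ 0 (1 + 1 / scale y t : ℝ)).re ≤
      0.5253 * Real.log (y ^ 2 ^ t : ℕ) := by
  have hX := H.scale_pos
  have hl := H.log_z_ge
  have hl2 := H.log_z_le
  have hl0 := H.log_z_pos
  have hXl : scale y t = 1024 * Real.log (y ^ 2 ^ t : ℕ) := rfl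
  generalize Real.log (y ^ 2 ^ t : ℕ) = l at *
  generalize scale y t = X at *
  have hδ : 0 < 1 - β := by linarith
  have h1 : X - (1 - β) * X ^ 2 ≤ (1 + 1 / X - β)⁻¹ := by
    have e : 1 + 1 / X - β = (1 + (1 - β) * X) / X := by field_simp; ring
    have h0 : 0 < (1 - β) * X := by positivity
    rw [e, inv_div, le_div_iff₀ (by positivity)]
    nlinarith [mul_pos hX (mul_pos h0 h0)]
  have h2 : (1 - β) * X ^ 2 ≤ 0.00525 * l := by
    have : (1 - β) * l ≤ 5 / 10 ^ 9 := by
      calc (1 - β) * l ≤ (1 - β) * (100 * Real.log q) := by gcongr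
        _ = 100 * ((1 - β) * Real.log q) := by ring
        _ ≤ _ := by linarith
    calc (1 - β) * X ^ 2 = 1024 ^ 2 * ((1 - β) * l) * l := by rw [hXl]; ring
      _ ≤ 1024 ^ 2 * (5 / 10 ^ 9) * l := by gcongr
      _ ≤ _ := by
        refine mul_le_mul_of_nonneg_right ?_ hl0.le
        norm_num
  linarith

lemma exp_half_le : Real.exp (1 / 2) ≤ 1.65 := by
  have h : Real.exp (1 / 2) ^ 2 = Real.exp 1 := by
    rw [← Real.exp_nat_mul]
    norm_num
  have := Real.exp_one_lt_d9
  refine le_of_sq_le_sq ?_ (by norm_num)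
  rw [h]
  linarith

end Linnik

namespace Linnik

open Finset Filter Topology

open Params (scale)

variable {q y t : ℕ}

/-- The size comparison in the exceptional case. -/
lemma main_term_beats_error {Z Q D L V : ℝ} (hQ0 : 0 < Q) (hQ : Q ≤ Z) (hZ : 10 ^ 30 ≤ Z)
    (hD0 : 0 ≤ D) (hD : D ≤ Z ^ 47) (hL : 1 / (128 * Q) ≤ L) (hV : (Z ^ 2)⁻¹ ≤ V) :
    1 + 11 * D ^ 3 * Z ^ 512 + 66 * D ^ 3 * Z ^ 768 < 0.12 * (2 * L / Q * Z ^ 1024 * V) := by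
  have hZ0 : 0 < Z := lt_of_lt_of_le (by norm_num) hZ
  have hZ1 : 1 ≤ Z := le_trans (by norm_num) hZ
  have h1 : D ^ 3 ≤ Z ^ 141 := by
    calc D ^ 3 ≤ (Z ^ 47) ^ 3 := by gcongr
      _ = Z ^ 141 := by rw [← pow_mul]
  have h2 : D ^ 3 * Z ^ 512 ≤ Z ^ 909 := by
    calc D ^ 3 * Z ^ 512 ≤ Z ^ 141 * Z ^ 768 := by gcongr; norm_num
      _ = Z ^ 909 := by rw [← pow_add]
  have h3 : D ^ 3 * Z ^ 768 ≤ Z ^ 909 := by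
    calc D ^ 3 * Z ^ 768 ≤ Z ^ 141 * Z ^ 768 := by gcongr
      _ = Z ^ 909 := by rw [← pow_add]
  have h4 : 1 ≤ Z ^ 909 := one_le_pow₀ hZ1
  have h5 : Z ^ 1020 / 64 ≤ 2 * L / Q * Z ^ 1024 * V := by
    calc Z ^ 1020 / 64 = 2 * (1 / (128 * Z)) / Z * Z ^ 1024 * (Z ^ 2)⁻¹ := by
          have : Z ^ 1024 = Z ^ 1020 * Z ^ 2 * Z ^ 2 := by rw [← pow_add, ← pow_add]
          rw [this]
          field_simp
          norm_num
      _ ≤ 2 * (1 / (128 * Q)) / Q * Z ^ 1024 * (Z ^ 2)⁻¹ := by gcongr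
      _ ≤ _ := by
        have : 0 ≤ L := le_trans (by positivity) hL
        gcongr
  have h6 : Z ^ 909 * 10 ^ 30 ≤ Z ^ 1020 := by
    calc Z ^ 909 * 10 ^ 30 ≤ Z ^ 909 * Z ^ 111 := by
          gcongr
          exact hZ.trans (le_self_pow₀ hZ1 (by norm_num))
      _ = Z ^ 1020 := by rw [← pow_add]
  generalize Z ^ 1020 = A at *
  generalize Z ^ 909 = B at *
  rw [mul_assoc 11, mul_assoc 66]
  linarith

lemma exists_prime_of_exceptional [NeZero q] (H : Params q y t) {χ : DirichletCharacter ℂ q}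
    (hχ1 : χ ≠ 1) (hχ2 : χ ^ 2 = 1) {β : ℝ}
    (hβ : β < 1) (hβ' : (1 - β) * Real.log q < 5 / 10 ^ 11)
    (hζ : psiZeta 0 (1 + 1 / scale y t) ≤ scale y t + Real.log q)
    (hχ : (psiSum χ 0 (1 + 1 / scale y t : ℝ)).re ≤
      25 * Real.log q - (1 + 1 / scale y t - β)⁻¹)
    {a : ZMod q} (ha : IsUnit a) (hχa : χ a = 1) :
    ∃ p : ℕ, p.Prime ∧ (p : ZMod q) = a ∧ p ≤ (y ^ 2 ^ t) ^ 1024 := by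
  by_contra! hno
  obtain ⟨ψ, hψ, hψχ⟩ := exists_real_char hχ2
  have hψa : ψ a = 1 := by
    have := hψχ a
    rw [hχa] at this
    exact_mod_cast this.symm
  have hB : ∀ m : ℕ, |∑ k ∈ range m, ψ k| ≤ q := by
    intro m
    have := norm_sum_range_char_le hχ1 m
    simp only [hψχ] at this
    rwa [← Complex.ofReal_sum, Complex.norm_real, Real.norm_eq_abs] at this
  have hq := H.q_pos
  have hq1 : 1 < q := lt_of_lt_of_le (by norm_num) H.q_ge
  have h00 : ψ 0 = 0 := by
    have : Fact (1 < q) := ⟨hq1⟩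
    exact MulChar.map_nonunit _ not_isUnit_zero
  obtain ⟨L, hLlim, hL⟩ := exists_limit_partialL hB
  have hLge := limit_partialL_ge hψ hB hq hLlim
  have hL0 : 0 ≤ L := le_trans (by positivity) hLge
  obtain ⟨lp, lm, HS⟩ := exists_sievePair H.log_y (good := fun p ↦ ¬ p ∣ q)
    (g := localDensity ψ) (fun p hp _ ↦ localDensity_bounds hψ hp) t (b := 20) (by decide)
    (by norm_num) (by linarith [truncErr_twenty_le])
  have hsum := psi_sum_le_of_exceptional H hβ hβ' hζ hχ
  have hdens := fun (M : ℕ) ↦ sum_localDensity_midPrimes_le hψ hψχ (z := y ^ 2 ^ t) (M := M)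
    (hq1.trans_le H.q_le_z) (X := scale y t)
  have hX := H.scale_pos
  have hXl : scale y t = 1024 * Real.log (y ^ 2 ^ t : ℕ) := rfl
  have hl0 := H.log_z_pos
  have hqz := H.q_le_z
  have hqge := H.q_ge
  have h4 := H.four_pow_le
  have hyz : (y : ℝ) ^ 2 ^ t = ((y ^ 2 ^ t : ℕ) : ℝ) := by push_cast; rfl
  rw [hyz] at HS
  generalize y ^ 2 ^ t = z at *
  have hE := truncErr_twenty_le
  have hE0 : 0 ≤ 2 * truncErr 4.2 20 := by unfold truncErr; positivity
  generalize 2 * truncErr 4.2 20 = E at *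
  have hz0 : 0 < z := hq.trans_le hqz
  have hzR : (0 : ℝ) < z := by exact_mod_cast hz0
  have hzge : (10 : ℝ) ^ 30 ≤ z := by exact_mod_cast hqge.trans hqz
  obtain ⟨D, hD⟩ : ∃ D : ℝ, D = 4 ^ y * (z : ℝ) ^ (2 * 20 + 6) := ⟨_, rfl⟩
  rw [← hD] at HS
  have hD0 : 0 ≤ D := by rw [hD]; positivity
  have hDz : D ≤ (z : ℝ) ^ 47 := by
    have : (4 : ℝ) ^ y ≤ z := by exact_mod_cast h4.trans hqz
    rw [hD]
    calc (4 : ℝ) ^ y * (z : ℝ) ^ (2 * 20 + 6) ≤ z * (z : ℝ) ^ (2 * 20 + 6) := by gcongr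
      _ = (z : ℝ) ^ 47 := by rw [← pow_succ']
  obtain ⟨P, hPdef⟩ : ∃ P, P = sievePrimes (fun p ↦ ¬ p ∣ q) z := ⟨_, rfl⟩
  have hP : ∀ p ∈ P, p.Prime ∧ ¬ p ∣ q := fun p hp ↦ (mem_sievePrimes.1 (hPdef ▸ hp)).2
  have hle := siftedSum_empty_le hψ ha (z := z) (M := z ^ 512) (N := z ^ 1024)
    (by rw [← pow_mul]) hno
  have hV := inv_sq_le_prod_one_sub_localDensity hψ (q := q) (z := z) hz0
  rw [← hPdef] at HS hle hV
  have hdens' := hdens (z ^ 512) (Nat.le_self_pow (by norm_num) z) hX (by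
    rw [hXl, Nat.cast_pow, Real.log_pow]
    push_cast
    linarith)
  obtain ⟨V, hVdef⟩ : ∃ V, V = ∏ p ∈ P, (1 - localDensity ψ p) := ⟨_, rfl⟩
  obtain ⟨M, hM⟩ : ∃ M, M = 2 * L / q * (z : ℝ) ^ 1024 := ⟨_, rfl⟩
  have hM0 : 0 ≤ M := by rw [hM]; positivity
  rw [← hVdef] at hV
  have hV0 : 0 ≤ V := le_trans (by positivity) hV
  have hNc : ((z ^ 1024 : ℕ) : ℝ) = (z : ℝ) ^ 1024 := Nat.cast_pow _ _
  have hsqrt : √((z : ℝ) ^ 1024) = (z : ℝ) ^ 512 := by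
    rw [show (z : ℝ) ^ 1024 = ((z : ℝ) ^ 512) ^ 2 by rw [← pow_mul]]
    exact Real.sqrt_sq (by positivity)
  have hlow := siftedSum_approx hψ hB hq h00 hL hL0 hP (U := ∅) (by simp) (disjoint_empty_left _)
    hD0 HS hψa (z ^ 1024)
  rw [hNc, prod_empty, prod_empty, div_one, card_empty, hsqrt, mul_one, ← hM, ← hVdef] at hlow
  have hup : ∀ p ∈ midPrimes q z (z ^ 512), siftedSum ψ P {p} (z ^ 1024) a ≤
      (1 + E) * M * V * localDensity ψ p + 33 * D ^ 3 * (z : ℝ) ^ 512 * (√(p : ℝ))⁻¹ := by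
    intro p hp
    rw [midPrimes, mem_filter, mem_Ioc] at hp
    have h := siftedSum_approx hψ hB hq h00 hL hL0 hP (U := {p})
      (fun r hr ↦ by rw [mem_singleton.1 hr]; exact hp.2)
      (disjoint_singleton_left.2 fun h ↦ absurd (mem_sievePrimes.1 (hPdef ▸ h)).1
        (not_le.2 hp.1.1)) hD0 HS hψa (z ^ 1024)
    rw [hNc, prod_singleton, prod_singleton, card_singleton, Real.sqrt_div (by positivity), hsqrt,
      ← hM, ← hVdef, div_eq_mul_inv] at h
    have := (abs_le.1 h).2
    linarith
  have hS : ∑ p ∈ midPrimes q z (z ^ 512), siftedSum ψ P {p} (z ^ 1024) a ≤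
      (1 + E) * M * V * 0.87 + 66 * D ^ 3 * (z : ℝ) ^ 768 := by
    refine (sum_le_sum hup).trans ?_
    rw [sum_add_distrib, ← mul_sum, ← mul_sum]
    refine add_le_add (mul_le_mul_of_nonneg_left ?_ (by positivity)) ?_
    · refine hdens'.trans ?_
      have h1 : Real.exp (1 / 2) / Real.log z *
          (psiZeta 0 (1 + 1 / scale y t) + (psiSum χ 0 (1 + 1 / scale y t : ℝ)).re) ≤
          1.65 / Real.log z * (0.5253 * Real.log z) := by
        refine (mul_le_mul_of_nonneg_left hsum (by positivity)).trans ?_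
        have := exp_half_le
        gcongr
      have h2 : 1.65 / Real.log z * (0.5253 * Real.log z) = 1.65 * 0.5253 := by
        field_simp
      have h3 : (z : ℝ)⁻¹ ≤ 1 / 1000 := by
        rw [inv_eq_one_div]
        gcongr
        linarith
      rw [h2] at h1
      norm_num at h1 h3 ⊢
      linarith
    · have h1 : ∑ p ∈ midPrimes q z (z ^ 512), (√(p : ℝ))⁻¹ ≤ 2 * (z : ℝ) ^ 256 := by
        have h2 : √((z ^ 512 : ℕ) : ℝ) = (z : ℝ) ^ 256 := by
          rw [Nat.cast_pow, show (z : ℝ) ^ 512 = ((z : ℝ) ^ 256) ^ 2 by rw [← pow_mul]]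
          exact Real.sqrt_sq (by positivity)
        rw [← h2]
        refine le_trans ?_ (sum_Ioc_inv_sqrt_le (z ^ 512))
        refine sum_le_sum_of_subset_of_nonneg (fun p hp ↦ ?_) fun _ _ _ ↦ by positivity
        have := mem_Ioc.1 (mem_filter.1 hp).1
        exact mem_Ioc.2 ⟨by omega, this.2⟩
      calc _ ≤ 33 * D ^ 3 * (z : ℝ) ^ 512 * (2 * (z : ℝ) ^ 256) := by gcongr
        _ = 66 * D ^ 3 * ((z : ℝ) ^ 512 * (z : ℝ) ^ 256) := by ring
        _ = _ := by rw [← pow_add]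
  have hbig := main_term_beats_error (Q := q) (by exact_mod_cast hq) (by exact_mod_cast hqz)
    hzge hD0 hDz hLge hV
  rw [← hM] at hbig
  have hlow' := (abs_le.1 hlow).1
  have hMV : 0 ≤ M * V := by positivity
  have hEMV : E * (M * V) ≤ 1 / 200 * (M * V) := by gcongr
  generalize (z : ℝ) ^ 512 = Z₁ at *
  generalize (z : ℝ) ^ 768 = Z₂ at *
  linarith

end Linnik

namespace Linnik

open Finset Filter Topology

open Params (scale)

lemma exists_params {q y : ℕ} (hy : 54 ≤ Real.log y) (hq : 4 ^ y ≤ q) : ∃ t, Params q y t := by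
  have hy2 : y ^ 2 < q := by
    refine lt_of_lt_of_le ?_ hq
    calc y ^ 2 < (2 ^ y) ^ 2 := Nat.pow_lt_pow_left Nat.lt_two_pow_self two_ne_zero
      _ = 4 ^ y := by rw [← pow_mul, mul_comm, pow_mul]; norm_num
  have hy1 : 2 ≤ y := by
    by_contra! h
    interval_cases y <;> norm_num at hy
  have hq1 : 0 < q := by omega
  have hex : ∃ t, q ^ 50 ≤ y ^ 2 ^ t := by
    refine ⟨q ^ 50, ?_⟩
    calc q ^ 50 ≤ 2 ^ (q ^ 50) := Nat.lt_two_pow_self.le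
      _ ≤ 2 ^ 2 ^ (q ^ 50) := Nat.pow_le_pow_right two_pos Nat.lt_two_pow_self.le
      _ ≤ y ^ 2 ^ (q ^ 50) := Nat.pow_le_pow_left hy1 _
  classical
  have hspec := Nat.find_spec hex
  have hmin : ∀ m < Nat.find hex, y ^ 2 ^ m < q ^ 50 := fun m hm ↦ not_le.1 (Nat.find_min hex hm)
  generalize Nat.find hex = t at *
  have ht : 7 ≤ t := by
    by_contra! h
    have h1 : y ^ 2 ^ t ≤ (y ^ 2) ^ 32 := by
      rw [← pow_mul]
      refine Nat.pow_le_pow_right (by omega) ?_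
      exact Nat.pow_le_pow_right two_pos (by omega : t ≤ 6)
    have h2 : (y ^ 2) ^ 32 < q ^ 32 := Nat.pow_lt_pow_left hy2 (by norm_num)
    have h3 : q ^ 32 ≤ q ^ 50 := Nat.pow_le_pow_right hq1 (by norm_num)
    omega
  refine ⟨t, hy, hq, ht, hspec, ?_⟩
  obtain ⟨s, rfl⟩ : ∃ s, t = s + 1 := ⟨t - 1, by omega⟩
  rw [pow_succ, pow_mul]
  calc (y ^ 2 ^ s) ^ 2 ≤ (q ^ 50) ^ 2 := Nat.pow_le_pow_left (hmin s (by omega)).le 2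
    _ = q ^ 100 := by rw [← pow_mul]

end Linnik

open Linnik

/-- **Linnik's theorem** with the explicit exponent `L = 75744000`:
there exists `Q₀` such that for every integer `q ≥ Q₀` and every integer `a`
coprime to `q`, there is a prime `p ≡ a (mod q)` with `p ≤ q ^ 75744000`. -/
theorem linnik_least_prime_in_AP :
    ∃ Q₀ : ℕ, ∀ q : ℕ, Q₀ ≤ q → ∀ a : ℤ, Int.gcd a q = 1 →
      ∃ p : ℕ, p.Prime ∧ ((p : ℤ) : ZMod q) = (a : ZMod q) ∧ (p : ℕ) ≤ q ^ 75744000 := by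
  obtain ⟨L₀, hL₀, hexc⟩ := exists_exceptional
  obtain ⟨K, hK, hscale⟩ := exists_scale_bound
  obtain ⟨y, hy⟩ : ∃ y : ℕ, 54 ≤ Real.log y := by
    refine ⟨⌈Real.exp 54⌉₊, ?_⟩
    exact (Real.le_log_iff_exp_le (by positivity)).2 (Nat.le_ceil _)
  refine ⟨max (4 ^ y) ⌈Real.exp (max L₀ K)⌉₊, fun q hq a ha ↦ ?_⟩
  obtain ⟨t, H⟩ := exists_params hy ((le_max_left _ _).trans hq)
  have : NeZero q := ⟨H.q_pos.ne'⟩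
  have hlog : max L₀ K ≤ Real.log q := by
    refine (Real.le_log_iff_exp_le (by exact_mod_cast H.q_pos)).2 ((Nat.le_ceil _).trans ?_)
    exact_mod_cast (le_max_right _ _).trans hq
  have hXK : K ≤ Params.scale y t := by
    have h1 : Params.scale y t = 1024 * Real.log (y ^ 2 ^ t : ℕ) := rfl
    have := H.log_z_ge
    have := H.log_q_pos
    linarith [(le_max_right L₀ K).trans hlog]
  have hX := H.scale_pos
  obtain ⟨hC, hζ⟩ := hscale _ hXK
  obtain ⟨hζ₀, χ, β, hβ, -, hχ2, hS, hE⟩ := hexc q ((le_max_left _ _).trans hlog)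
  have hu : IsUnit (a : ZMod q) := (ZMod.coe_int_isUnit_iff_isCoprime a q).2
    (Int.isCoprime_iff_gcd_eq_one.2 (by rwa [Int.gcd_comm]))
  obtain ⟨p, hp, hpa, hle⟩ : ∃ p : ℕ, p.Prime ∧ (p : ZMod q) = a ∧ p ≤ (y ^ 2 ^ t) ^ 204800 := by
    by_cases hA : χ = 1 ∨ χ a ≠ 1 ∨ 5 / 10 ^ 11 ≤ (1 - β) * Real.log q
    · exact exists_prime_of_primeSum H hu hC
        (primeSum_gt H (hK.trans hXK) hC hζ hβ hχ2 hS (fun h ↦ (hE h).1) hu hA)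
    · push Not at hA
      obtain ⟨h1, h2, h3⟩ := hA
      have hσ : 1 < 1 + 1 / Params.scale y t := lt_add_of_pos_right _ (by positivity)
      have hσ' : 1 + 1 / Params.scale y t ≤ 17 / 16 := by
        have : 1 / Params.scale y t ≤ 1 / 16 := by
          gcongr
          exact hK.trans hXK
        linarith
      have h4 := hζ₀ _ hσ hσ'
      rw [add_sub_cancel_left, one_div_one_div] at h4
      obtain ⟨p, hp, hpa, hle⟩ := exists_prime_of_exceptional H h1 hχ2 hβ h3 h4
        ((hE h1).2 _ hσ hσ') hu h2
      exact ⟨p, hp, hpa, hle.trans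
        (Nat.pow_le_pow_right (H.q_pos.trans_le H.q_le_z) (by norm_num))⟩
  refine ⟨p, hp, by rw [← hpa, Int.cast_natCast], hle.trans ?_⟩
  calc (y ^ 2 ^ t) ^ 204800 ≤ (q ^ 100) ^ 204800 := Nat.pow_le_pow_left H.le_pow _
    _ = q ^ (100 * 204800) := (pow_mul _ _ _).symm
    _ ≤ q ^ 75744000 := Nat.pow_le_pow_right H.q_pos (by norm_num)
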